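/- Basis of complete hyperbolic neighborhoods: Let J be a smooth almost complex structure on an open set Ω ⊆ ℝ^{2n} and let p ∈ Ω. Then p has a basis of complete hyperbolic neighborhoods: for every neighborhood W of p there exists a neighborhood U ⊆ W of p such that the Kobayashi pseudodistance d^K_{(U,J)} is a distance on U (positive off the diagonal) and every Kobayashi ball {q ∈ U : d^K_{(U,J)}(p′,q) < r} (p′ ∈ U, r > 0) is relatively compact in U. -/

import Mathlib

open Complex Metric Set MeasureTheory Filter Topology Bornology ENNReal

noncomputable section

/-- We identify `ℝ^{2n}` with `ℂⁿ` (with the Euclidean norm). -/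
abbrev Cn (n : ℕ) : Type := EuclideanSpace ℂ (Fin n)

/-- The standard complex structure on `ℂⁿ ≅ ℝ^{2n}`: multiplication by `i`,
viewed as an `ℝ`-linear map. -/
def Jstd (n : ℕ) : Cn n →L[ℝ] Cn n :=
  ContinuousLinearMap.restrictScalars ℝ (Complex.I • ContinuousLinearMap.id ℂ (Cn n))

/-- The standard complex structure on `ℂ ≅ ℝ²`. -/
def JstdC : ℂ →L[ℝ] ℂ :=
  ContinuousLinearMap.restrictScalars ℝ (Complex.I • ContinuousLinearMap.id ℂ ℂ)

/-- `J` is a (smooth) almost complex structure on the set `Ω ⊆ ℂⁿ ≅ ℝ^{2n}`: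
a `C^∞` field of linear automorphisms with `J(x) ∘ J(x) = -Id`. -/
def IsACS {n : ℕ} (Ω : Set (Cn n)) (J : Cn n → Cn n →L[ℝ] Cn n) : Prop :=
  ContDiffOn ℝ (⊤ : ℕ∞) J Ω ∧ ∀ x ∈ Ω, (J x).comp (J x) = -ContinuousLinearMap.id ℝ (Cn n)

/-- The open unit disc `Δ` in `ℂ`. -/
def unitDisc : Set ℂ := Metric.ball 0 1

/-- A map between (subsets of) almost complex spaces is `(J,J')`-holomorphic on `s` if
`df_x ∘ J(x) = J'(f(x)) ∘ df_x` on `s`. -/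
def PseudoHolOn {n m : ℕ} (J : Cn n → Cn n →L[ℝ] Cn n) (J' : Cn m → Cn m →L[ℝ] Cn m)
    (f : Cn n → Cn m) (s : Set (Cn n)) : Prop :=
  ∀ x ∈ s, DifferentiableAt ℝ f x ∧
    (fderiv ℝ f x).comp (J x) = (J' (f x)).comp (fderiv ℝ f x)

/-- A map from an open subset of `ℂ` is `J`-holomorphic on `s` if
`df_ζ ∘ J_st = J(f(ζ)) ∘ df_ζ` on `s`. -/
def JHolOn {n : ℕ} (J : Cn n → Cn n →L[ℝ] Cn n) (f : ℂ → Cn n) (s : Set ℂ) : Prop :=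
  ∀ ζ ∈ s, DifferentiableAt ℝ f ζ ∧
    (fderiv ℝ f ζ).comp JstdC = (J (f ζ)).comp (fderiv ℝ f ζ)

/-- A `J`-holomorphic disc in `D`. -/
def JDisc {n : ℕ} (J : Cn n → Cn n →L[ℝ] Cn n) (D : Set (Cn n)) (f : ℂ → Cn n) : Prop :=
  MapsTo f unitDisc D ∧ JHolOn J f unitDisc

/-- The nonnegative part of an extended real number, as an element of `ℝ≥0∞`. -/
def erealPos (x : EReal) : ℝ≥0∞ := if x = ⊤ then ⊤ else ENNReal.ofReal x.toReal

/-- The integral of an `EReal`-valued function: the (unsigned) integral of the positive part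
minus the integral of the negative part. -/
def erealIntegral {X : Type} [MeasurableSpace X] (μ : Measure X) (g : X → EReal) : EReal :=
  ((∫⁻ x, erealPos (g x) ∂μ : ℝ≥0∞) : EReal) - ((∫⁻ x, erealPos (-(g x)) ∂μ : ℝ≥0∞) : EReal)

/-- `h : ℂ → [-∞,∞)` is subharmonic on `s`: upper semicontinuous and satisfying the
sub-mean-value inequality `h(a) ≤ (2π)⁻¹ ∫₀^{2π} h(a + r e^{iθ}) dθ` whenever the closed disc
of center `a` and radius `r` is contained in `s`. -/
def SubharmonicOnE (h : ℂ → EReal) (s : Set ℂ) : Prop :=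
  UpperSemicontinuousOn h s ∧
  ∀ a : ℂ, ∀ r : ℝ, 0 < r → Metric.closedBall a r ⊆ s →
    h a ≤ (((2 * Real.pi)⁻¹ : ℝ) : EReal) *
      erealIntegral (volume.restrict (Set.Ioc (0 : ℝ) (2 * Real.pi)))
        (fun θ : ℝ => h (a + (r : ℂ) * Complex.exp ((θ : ℂ) * Complex.I)))

/-- `u : Ω → [-∞,∞)` is `J`-plurisubharmonic on `Ω`: upper semicontinuous, and `u ∘ f` is
subharmonic on `Δ` for every `J`-holomorphic disc `f : Δ → Ω`. -/
def JPshOn {n : ℕ} (J : Cn n → Cn n →L[ℝ] Cn n) (Ω : Set (Cn n)) (u : Cn n → EReal) : Prop :=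
  UpperSemicontinuousOn u Ω ∧
  ∀ f : ℂ → Cn n, JDisc J Ω f → SubharmonicOnE (fun ζ => u (f ζ)) unitDisc

/-- Real-valued `J`-plurisubharmonic functions. -/
def JPshOnR {n : ℕ} (J : Cn n → Cn n →L[ℝ] Cn n) (Ω : Set (Cn n)) (u : Cn n → ℝ) : Prop :=
  JPshOn J Ω (fun x => (u x : EReal))

/-- The `1`-form `J*dr : w ↦ dr_x(J(x)w)`. -/
def JStarDr {n : ℕ} (J : Cn n → Cn n →L[ℝ] Cn n) (r : Cn n → ℝ) (x : Cn n) : Cn n →L[ℝ] ℝ :=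
  (fderiv ℝ r x).comp (J x)

/-- The Levi form of a `C²` function `r`:
`L^J_r(p,v) = -d(J*dr)_p(v, J(p)v)` where `dα_p(u,w) = (∂_u α)_p(w) - (∂_w α)_p(u)`. -/
def LeviForm {n : ℕ} (J : Cn n → Cn n →L[ℝ] Cn n) (r : Cn n → ℝ) (p v : Cn n) : ℝ :=
  -((fderiv ℝ (JStarDr J r) p v) (J p v) - (fderiv ℝ (JStarDr J r) p (J p v)) v)

/-- `r` is strictly `J`-plurisubharmonic on `S`: its Levi form is positive definite there. -/
def StrictJPshOn {n : ℕ} (J : Cn n → Cn n →L[ℝ] Cn n) (r : Cn n → ℝ) (S : Set (Cn n)) : Prop :=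
  ∀ p ∈ S, ∀ v : Cn n, v ≠ 0 → 0 < LeviForm J r p v

/-- The Kobayashi–Royden infinitesimal pseudometric of `(D,J)`:
`K(p,v) = inf {α > 0 : ∃ J-holomorphic disc f : Δ → D, f(0) = p, df_0(∂/∂x) = v/α}`. -/
def kobMetric {n : ℕ} (J : Cn n → Cn n →L[ℝ] Cn n) (D : Set (Cn n)) (p v : Cn n) : ℝ :=
  sInf {α : ℝ | 0 < α ∧ ∃ f : ℂ → Cn n, JDisc J D f ∧ f 0 = p ∧ fderiv ℝ f 0 1 = α⁻¹ • v}

/-- A piecewise `C¹` path `γ : [0,1] → ℝ^{2n}`. -/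
def PiecewiseC1On {n : ℕ} (γ : ℝ → Cn n) : Prop :=
  ContinuousOn γ (Set.Icc 0 1) ∧
  ∃ (m : ℕ) (t : ℕ → ℝ), t 0 = 0 ∧ t m = 1 ∧ (∀ i < m, t i < t (i + 1)) ∧
    ∀ i < m, ContDiffOn ℝ 1 γ (Set.Icc (t i) (t (i + 1)))

/-- The (integrated) Kobayashi pseudodistance of `(D,J)`: the infimum of the Kobayashi–Royden
lengths of piecewise `C¹` paths in `D` joining `p` to `q`. -/
def kobDist {n : ℕ} (J : Cn n → Cn n →L[ℝ] Cn n) (D : Set (Cn n)) (p q : Cn n) : ℝ :=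
  sInf {L : ℝ | ∃ γ : ℝ → Cn n, PiecewiseC1On γ ∧ MapsTo γ (Set.Icc 0 1) D ∧
    γ 0 = p ∧ γ 1 = q ∧ L = ∫ t in (0 : ℝ)..1, kobMetric J D (γ t) (deriv γ t)}

/-- The cluster set of `f` (defined on `S`) along `A ⊆ closure S`: all limits of sequences
`f(s_k)` where `s_k ∈ S` converges to a point of `A`. -/
def clusterSet {X Y : Type*} [TopologicalSpace X] [TopologicalSpace Y]
    (f : X → Y) (S A : Set X) : Set Y :=
  {y | ∃ u : ℕ → X, (∀ k, u k ∈ S) ∧ (∃ a ∈ A, Tendsto u atTop (𝓝 a)) ∧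
    Tendsto (fun k => f (u k)) atTop (𝓝 y)}

/-- `N` is a `d`-dimensional `C^∞` submanifold of `ℂⁿ ≅ ℝ^{2n}`: near every point it can be
straightened, by a `C^∞` diffeomorphism onto an open subset of `ℝ^{2n}`, to the coordinate
subspace spanned by the first `d` coordinates. -/
def IsSmoothSubmanifold {n : ℕ} (d : ℕ) (N : Set (Cn n)) : Prop :=
  ∀ p ∈ N, ∃ (U : Set (Cn n)) (V : Set (EuclideanSpace ℝ (Fin (2 * n))))
    (φ : Cn n → EuclideanSpace ℝ (Fin (2 * n))) (ψ : EuclideanSpace ℝ (Fin (2 * n)) → Cn n),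
    IsOpen U ∧ p ∈ U ∧ IsOpen V ∧ ContDiffOn ℝ (⊤ : ℕ∞) φ U ∧ ContDiffOn ℝ (⊤ : ℕ∞) ψ V ∧
    (∀ x ∈ U, ψ (φ x) = x) ∧ (∀ y ∈ V, φ (ψ y) = y) ∧ MapsTo φ U V ∧
    φ '' (N ∩ U) = V ∩ {x | ∀ i : Fin (2 * n), d ≤ (i : ℕ) → x i = 0}

/-- The tangent set of `N ⊆ ℂⁿ` at `p`: velocities at `0` of differentiable curves through `p`
staying in `N` near time `0`. For a `C^∞` submanifold this is the tangent space `T_pN`. -/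
def TangentSet {n : ℕ} (N : Set (Cn n)) (p : Cn n) : Set (Cn n) :=
  {v | ∃ γ : ℝ → Cn n, γ 0 = p ∧ (∀ᶠ t in 𝓝 (0 : ℝ), γ t ∈ N) ∧
    DifferentiableAt ℝ γ 0 ∧ deriv γ 0 = v}

/-- `N` is totally real for `J`: `T_pN ∩ J(p)(T_pN) = {0}` at every `p ∈ N`. -/
def TotallyReal {n : ℕ} (J : Cn n → Cn n →L[ℝ] Cn n) (N : Set (Cn n)) : Prop :=
  ∀ p ∈ N, ∀ v ∈ TangentSet N p, J p v ∈ TangentSet N p → v = 0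

/-- `ρ` is a (global) `C^∞` defining function of `D`, defined on the neighborhood `Ω` of the
closure of `D`, with nonvanishing differential on `∂D`.  (This encodes that `D` has
`C^∞` boundary.) -/
def DefiningFunction {n : ℕ} (D Ω : Set (Cn n)) (ρ : Cn n → ℝ) : Prop :=
  IsOpen Ω ∧ closure D ⊆ Ω ∧ ContDiffOn ℝ (⊤ : ℕ∞) ρ Ω ∧
  D = {x ∈ Ω | ρ x < 0} ∧ ∀ x ∈ frontier D, fderiv ℝ ρ x ≠ 0

/-- `D` is a bounded strictly `J`-pseudoconvex domain with `C^∞` boundary: it admits a smooth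
defining function which is `J`-plurisubharmonic on `D` and strictly `J`-plurisubharmonic on a
neighborhood of `∂D`. -/
def StrictlyPseudoconvexDomain {n : ℕ} (J : Cn n → Cn n →L[ℝ] Cn n) (D : Set (Cn n)) : Prop :=
  IsOpen D ∧ IsConnected D ∧ IsBounded D ∧
  ∃ (Ω : Set (Cn n)) (ρ : Cn n → ℝ), DefiningFunction D Ω ρ ∧
    JPshOnR J D ρ ∧ ∃ W : Set (Cn n), IsOpen W ∧ frontier D ⊆ W ∧ StrictJPshOn J ρ W

end

theorem polar_lintegral (c : ℂ) (R : ℝ) (φ : ℂ → ℝ≥0∞) :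
    ∫⁻ x in Ioo (0:ℝ) R ×ˢ Ioo (-Real.pi) Real.pi, ENNReal.ofReal x.1 * φ (circleMap c x.1 x.2)
      = ∫⁻ ζ in ball c R, φ ζ := by
  have h1 := Complex.lintegral_comp_polarCoord_symm
    (fun ζ => (ball c R).indicator φ (c + ζ))
  have h2 : ∫⁻ ζ : ℂ, (ball c R).indicator φ (c + ζ) = ∫⁻ ζ, (ball c R).indicator φ ζ :=
    lintegral_add_left_eq_self (μ := volume) (fun ζ => (ball c R).indicator φ ζ) c
  rw [h2, lintegral_indicator measurableSet_ball] at h1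
  rw [← h1]
  have hsub : Ioo (0:ℝ) R ×ˢ Ioo (-Real.pi) Real.pi ⊆ polarCoord.target := by
    intro x hx
    exact ⟨hx.1.1, hx.2⟩
  rw [← lintegral_indicator (measurableSet_Ioo.prod measurableSet_Ioo),
    ← lintegral_indicator polarCoord.open_target.measurableSet]
  congr 1
  ext x
  have hc : c + (Complex.polarCoord.symm x : ℂ) = circleMap c x.1 x.2 := by
    rw [Complex.polarCoord_symm_apply, circleMap, Complex.exp_mul_I]; simp
  by_cases hx : x ∈ polarCoord.target
  · rw [indicator_of_mem hx, hc]
    have hx0 : 0 < x.1 := hx.1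
    by_cases hR : x.1 < R
    · have : x ∈ Ioo (0:ℝ) R ×ˢ Ioo (-Real.pi) Real.pi := ⟨⟨hx0, hR⟩, hx.2⟩
      rw [indicator_of_mem this, indicator_of_mem]
      · simp
      · simp [circleMap, abs_of_pos hx0, hR]
    · rw [indicator_of_notMem (fun h => hR h.1.2), indicator_of_notMem]
      · simp
      · simp only [circleMap, mem_ball, dist_self_add_left, norm_mul, norm_exp_ofReal_mul_I, mul_one, Complex.norm_real, Real.norm_eq_abs, abs_of_pos hx0]
        exact hR
  · rw [indicator_of_notMem hx, indicator_of_notMem (fun h => hx (hsub h))]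

theorem measurable_circleMap2 (c : ℂ) : Measurable (fun x : ℝ × ℝ => circleMap c x.1 x.2) := by
  unfold circleMap
  fun_prop

theorem polar_integrable (c : ℂ) (R : ℝ) (g : ℂ → ℝ) (hg : Measurable g)
    (hi : IntegrableOn g (ball c R)) :
    IntegrableOn (fun x : ℝ × ℝ => x.1 * g (circleMap c x.1 x.2))
      (Ioo (0:ℝ) R ×ˢ Ioo (-Real.pi) Real.pi) := by
  constructor
  · exact (measurable_fst.mul (hg.comp (measurable_circleMap2 c))).aestronglyMeasurable
  · have h := hi.2
    rw [HasFiniteIntegral] at h ⊢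
    rw [← polar_lintegral c R (fun ζ => ‖g ζ‖ₑ)] at h
    convert h using 1
    apply setLIntegral_congr_fun (measurableSet_Ioo.prod measurableSet_Ioo)
    intro x hx
    simp only [enorm_mul]
    rw [Real.enorm_eq_ofReal_abs x.1, abs_of_pos hx.1.1]

theorem polar_integral {F : Type*} [NormedAddCommGroup F] [NormedSpace ℝ F] (c : ℂ) (R : ℝ) (g : ℂ → F) :
    ∫ x in Ioo (0:ℝ) R ×ˢ Ioo (-Real.pi) Real.pi, x.1 • g (circleMap c x.1 x.2)
      = ∫ ζ in ball c R, g ζ := by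
  have h1 := Complex.integral_comp_polarCoord_symm
    (fun ζ => (ball c R).indicator g (c + ζ))
  have h2 : ∫ ζ : ℂ, (ball c R).indicator g (c + ζ) = ∫ ζ, (ball c R).indicator g ζ :=
    integral_add_left_eq_self (μ := volume) (fun ζ => (ball c R).indicator g ζ) c
  rw [h2, integral_indicator measurableSet_ball] at h1
  rw [← h1]
  have hsub : Ioo (0:ℝ) R ×ˢ Ioo (-Real.pi) Real.pi ⊆ polarCoord.target := by
    intro x hx
    exact ⟨hx.1.1, hx.2⟩
  rw [← integral_indicator (measurableSet_Ioo.prod measurableSet_Ioo),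
    ← integral_indicator polarCoord.open_target.measurableSet]
  congr 1
  ext x
  have hc : c + (Complex.polarCoord.symm x : ℂ) = circleMap c x.1 x.2 := by
    rw [Complex.polarCoord_symm_apply, circleMap, Complex.exp_mul_I]; simp
  by_cases hx : x ∈ polarCoord.target
  · rw [indicator_of_mem hx, hc]
    have hx0 : 0 < x.1 := hx.1
    by_cases hR : x.1 < R
    · have : x ∈ Ioo (0:ℝ) R ×ˢ Ioo (-Real.pi) Real.pi := ⟨⟨hx0, hR⟩, hx.2⟩
      rw [indicator_of_mem this, indicator_of_mem]
      simp [circleMap, abs_of_pos hx0, hR]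
    · rw [indicator_of_notMem (fun h => hR h.1.2), indicator_of_notMem]
      · simp
      · simp only [circleMap, mem_ball, dist_self_add_left, norm_mul, norm_exp_ofReal_mul_I, mul_one, Complex.norm_real, Real.norm_eq_abs, abs_of_pos hx0]
        exact hR
  · rw [indicator_of_notMem hx, indicator_of_notMem (fun h => hx (hsub h))]

/-- The Cauchy-Riemann operator. -/
noncomputable def dbar (g : ℂ → ℂ) (z : ℂ) : ℂ := (fderiv ℝ g z 1 + I * fderiv ℝ g z I) / 2

theorem measurable_dbar (g : ℂ → ℂ) : Measurable (dbar g) := by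
  unfold dbar
  have h := measurable_fderiv ℝ g
  have h1 : Measurable (fun z => fderiv ℝ g z 1) := measurable_fderiv_apply_const ℝ g 1
  have h2 : Measurable (fun z => fderiv ℝ g z I) := measurable_fderiv_apply_const ℝ g I
  fun_prop

theorem rlin_apply (L : ℂ →L[ℝ] ℂ) (w : ℂ) : L w = w.re * L 1 + w.im * L I := by
  conv_lhs => rw [← Complex.re_add_im w]
  have h1 : L ((w.re : ℂ)) = w.re * L 1 := by
    have := L.map_smul w.re 1
    simpa using this
  have h2 : L ((w.im : ℂ) * I) = w.im * L I := by
    have := L.map_smul w.im I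
    simpa using this
  rw [map_add, h1, h2]

theorem circleIntegral_eq_pi (k : ℂ → ℂ) (c : ℂ) (R : ℝ) :
    (∮ ζ in C(c, R), k ζ) = I * ∫ θ in (-Real.pi)..Real.pi, (R * exp (θ * I)) * k (circleMap c R θ) := by
  unfold circleIntegral
  have hper : Function.Periodic (fun θ : ℝ => deriv (circleMap c R) θ • k (circleMap c R θ)) (2 * Real.pi) := by
    intro θ
    simp only [deriv_circleMap]
    rw [periodic_circleMap, periodic_circleMap]
  have := hper.intervalIntegral_add_eq 0 (-Real.pi)
  rw [zero_add, show -Real.pi + 2 * Real.pi = Real.pi by ring] at this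
  rw [this, ← intervalIntegral.integral_const_mul]
  congr 1
  ext θ
  simp [deriv_circleMap, circleMap]
  ring

theorem green_annulus {c : ℂ} {r R : ℝ} (hr : 0 ≤ r) (hrR : r ≤ R) (k : ℂ → ℂ) (S : Set ℂ)
    (hS : S.Countable) (hk : ContinuousOn k {ζ | r ≤ ‖ζ - c‖ ∧ ‖ζ - c‖ ≤ R})
    (hd : ∀ ζ, ζ ∉ S → r < ‖ζ - c‖ → ‖ζ - c‖ < R → DifferentiableAt ℝ k ζ)
    (g : ℂ → ℝ) (hg : Measurable g) (hgi : IntegrableOn g (ball c R)) (hg0 : ∀ ζ, 0 ≤ g ζ)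
    (hb : ∀ ζ, ζ ∉ S → r < ‖ζ - c‖ → ‖ζ - c‖ < R → ‖dbar k ζ‖ ≤ g ζ) :
    ‖(∮ ζ in C(c, R), k ζ) - ∮ ζ in C(c, r), k ζ‖ ≤ 2 * ∫ ζ in ball c R, g ζ := by
  set f : ℝ × ℝ → ℂ := fun x => (x.1 * exp (x.2 * I)) * k (circleMap c x.1 x.2) with hf
  set h : ℝ × ℝ → ℂ := fun x => (I * exp (x.2 * I)) * k (circleMap c x.1 x.2) with hh
  have hpi : (-Real.pi) ≤ Real.pi := by linarith [Real.pi_pos]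
  have hnorm : ∀ x : ℝ × ℝ, 0 ≤ x.1 → ‖circleMap c x.1 x.2 - c‖ = x.1 := by
    intro x hx
    simp [circleMap, abs_of_nonneg hx]
  have hcm : Continuous (fun x : ℝ × ℝ => circleMap c x.1 x.2) := by
    unfold circleMap; fun_prop
  have hkc : ContinuousOn (fun x : ℝ × ℝ => k (circleMap c x.1 x.2)) (uIcc r R ×ˢ uIcc (-Real.pi) Real.pi) := by
    apply hk.comp hcm.continuousOn
    intro x hx
    rw [uIcc_of_le hrR] at hx
    have : 0 ≤ x.1 := le_trans hr hx.1.1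
    simp only [mem_setOf_eq, hnorm x this]
    exact hx.1
  have hfc : ContinuousOn f (uIcc r R ×ˢ uIcc (-Real.pi) Real.pi) := by
    apply ContinuousOn.mul _ hkc
    fun_prop
  have hhc : ContinuousOn h (uIcc r R ×ˢ uIcc (-Real.pi) Real.pi) := by
    apply ContinuousOn.mul _ hkc
    fun_prop
  set s : Set (ℝ × ℝ) := {x | x ∈ Ioo r R ×ˢ Ioo (-Real.pi) Real.pi ∧ circleMap c x.1 x.2 ∈ S} with hs
  have hinj : InjOn (fun x : ℝ × ℝ => circleMap c x.1 x.2) (Ioo r R ×ˢ Ioo (-Real.pi) Real.pi) := by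
    have h0 : ∀ x : ℝ × ℝ, circleMap c x.1 x.2 = c + (Complex.polarCoord.symm x : ℂ) := by
      intro x
      rw [Complex.polarCoord_symm_apply, circleMap, Complex.exp_mul_I]; simp
    have h1 := Complex.polarCoord.symm.injOn
    intro x hx y hy hxy
    apply h1
    · exact ⟨lt_of_le_of_lt hr hx.1.1, hx.2⟩
    · exact ⟨lt_of_le_of_lt hr hy.1.1, hy.2⟩
    · simp only [h0] at hxy
      exact add_left_cancel hxy
  have hsc : s.Countable := by
    apply Set.MapsTo.countable_of_injOn (f := fun x : ℝ × ℝ => circleMap c x.1 x.2) (t := S)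
    · intro x hx; exact hx.2
    · exact hinj.mono (fun x hx => hx.1)
    · exact hS
  have hmm : Ioo (min r R) (max r R) ×ˢ Ioo (min (-Real.pi) Real.pi) (max (-Real.pi) Real.pi)
      = Ioo r R ×ˢ Ioo (-Real.pi) Real.pi := by
    rw [min_eq_left hrR, max_eq_right hrR, min_eq_left hpi, max_eq_right hpi]
  have hkd : ∀ x ∈ (Ioo r R ×ˢ Ioo (-Real.pi) Real.pi) \ s, DifferentiableAt ℝ k (circleMap c x.1 x.2)
      ∧ ‖dbar k (circleMap c x.1 x.2)‖ ≤ g (circleMap c x.1 x.2) := by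
    intro x hx
    have hx0 : 0 ≤ x.1 := le_trans hr hx.1.1.1.le
    have hn : circleMap c x.1 x.2 ∉ S := fun h => hx.2 ⟨hx.1, h⟩
    constructor
    · apply hd _ hn <;> rw [hnorm x hx0]
      exacts [hx.1.1.1, hx.1.1.2]
    · apply hb _ hn <;> rw [hnorm x hx0]
      exacts [hx.1.1.1, hx.1.1.2]
  have hcmd : ∀ x : ℝ × ℝ, DifferentiableAt ℝ (fun x : ℝ × ℝ => circleMap c x.1 x.2) x := by
    intro x; unfold circleMap; fun_prop
  have hkq : ∀ x ∈ (Ioo r R ×ˢ Ioo (-Real.pi) Real.pi) \ s,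
      DifferentiableAt ℝ (fun x : ℝ × ℝ => k (circleMap c x.1 x.2)) x := by
    intro x hx
    exact DifferentiableAt.comp (g := k) x (hkd x hx).1 (hcmd x)
  have hfd : ∀ x ∈ (Ioo r R ×ˢ Ioo (-Real.pi) Real.pi) \ s, HasFDerivAt f (fderiv ℝ f x) x := by
    intro x hx
    apply DifferentiableAt.hasFDerivAt
    apply DifferentiableAt.mul _ (hkq x hx)
    fun_prop
  have hhd : ∀ x ∈ (Ioo r R ×ˢ Ioo (-Real.pi) Real.pi) \ s, HasFDerivAt h (fderiv ℝ h x) x := by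
    intro x hx
    apply DifferentiableAt.hasFDerivAt
    apply DifferentiableAt.mul _ (hkq x hx)
    fun_prop
  have hdiv : ∀ x ∈ (Ioo r R ×ˢ Ioo (-Real.pi) Real.pi) \ s,
      fderiv ℝ f x (1, 0) + fderiv ℝ h x (0, 1) = 2 * x.1 * dbar k (circleMap c x.1 x.2) := by
    intro x hx
    have hK := (hkd x hx).1.hasFDerivAt
    have e1 : HasDerivAt (fun t : ℝ => (t, x.2)) ((1 : ℝ), (0 : ℝ)) x.1 :=
      (hasDerivAt_id x.1).prodMk (hasDerivAt_const x.1 x.2)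
    have e2 : HasDerivAt (fun t : ℝ => (x.1, t)) ((0 : ℝ), (1 : ℝ)) x.2 :=
      (hasDerivAt_const x.2 x.1).prodMk (hasDerivAt_id x.2)
    have d1 := HasFDerivAt.comp_hasDerivAt x.1 (f := fun t : ℝ => (t, x.2)) (hfd x hx) e1
    have d2 := HasFDerivAt.comp_hasDerivAt x.2 (f := fun t : ℝ => (x.1, t)) (hhd x hx) e2
    have c1 : HasDerivAt (fun t : ℝ => circleMap c t x.2) (exp (x.2 * I)) x.1 := by
      unfold circleMap
      have := ((Complex.ofRealCLM.hasDerivAt (x := x.1)).mul_const (exp (x.2 * I))).const_add c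
      simpa using this
    have c2 : HasDerivAt (fun t : ℝ => circleMap c x.1 t) (x.1 * exp (x.2 * I) * I) x.2 := by
      have := hasDerivAt_circleMap c x.1 x.2
      convert this using 1
      simp [circleMap]
    have x2 : HasDerivAt (fun t : ℝ => exp (t * I)) (exp (x.2 * I) * I) x.2 := by
      have := hasDerivAt_circleMap 0 1 x.2
      have he : (fun t : ℝ => exp (t * I)) = circleMap 0 1 := by
        ext t; simp [circleMap]
      rw [he]
      convert this using 1
      simp [circleMap]
    have k1 := HasFDerivAt.comp_hasDerivAt x.1 (f := fun t : ℝ => circleMap c t x.2) hK c1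
    have k2 := HasFDerivAt.comp_hasDerivAt x.2 (f := fun t : ℝ => circleMap c x.1 t) hK c2
    have f1 := ((Complex.ofRealCLM.hasDerivAt (x := x.1)).mul_const (exp (x.2 * I))).mul k1
    have h1 := (x2.const_mul I).mul k2
    have u1 := d1.unique f1
    have u2 := d2.unique h1
    rw [u1, u2]
    simp only [Complex.ofRealCLM_apply, Complex.ofReal_one, one_mul, Function.comp]
    set K := fderiv ℝ k (circleMap c x.1 x.2)
    rw [rlin_apply K (exp (x.2 * I)), rlin_apply K (x.1 * exp (x.2 * I) * I)]
    unfold dbar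
    have hre : (exp (x.2 * I)).re = Real.cos x.2 := exp_ofReal_mul_I_re x.2
    have him : (exp (x.2 * I)).im = Real.sin x.2 := exp_ofReal_mul_I_im x.2
    have hre2 : ((x.1:ℂ) * exp (x.2 * I) * I).re = - (x.1 * Real.sin x.2) := by
      simp [him]
    have him2 : ((x.1:ℂ) * exp (x.2 * I) * I).im = (x.1 * Real.cos x.2) := by
      simp [hre]
    rw [hre, him, hre2, him2]
    have hexp : exp (x.2 * I) = Real.cos x.2 + Real.sin x.2 * I := by
      rw [Complex.exp_mul_I]; simp
    have hcs : (Real.cos x.2 : ℂ) ^ 2 + (Real.sin x.2 : ℂ) ^ 2 = 1 := by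
      exact_mod_cast Real.cos_sq_add_sin_sq x.2
    rw [hexp]
    change _ = 2 * (x.1 : ℂ) * ((K 1 + I * K I) / 2)
    push_cast
    rw [Complex.ofReal_cos, Complex.ofReal_sin] at hcs
    linear_combination (x.1 * (K 1 + I * K I)) * hcs +
      ((-x.1 * K 1 * Complex.sin x.2 ^ 2) + Complex.cos x.2 * k (circleMap c x.1 x.2) + Complex.sin x.2 * I *  k (circleMap c x.1 x.2) + x.1 * Complex.sin x.2 * Complex.cos x.2 * K I) * Complex.I_sq
  have hae : ∀ᵐ x ∂(volume.restrict (Ioo r R ×ˢ Ioo (-Real.pi) Real.pi)),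
      x ∈ (Ioo r R ×ˢ Ioo (-Real.pi) Real.pi) \ s := by
    have a1 := ae_restrict_mem (μ := (volume : Measure (ℝ × ℝ))) (measurableSet_Ioo.prod measurableSet_Ioo : MeasurableSet (Ioo r R ×ˢ Ioo (-Real.pi) Real.pi))
    have a2 : ∀ᵐ x ∂(volume.restrict (Ioo r R ×ˢ Ioo (-Real.pi) Real.pi)), x ∉ s :=
      ae_restrict_of_ae (hsc.ae_notMem volume)
    filter_upwards [a1, a2] with x h1 h2 using ⟨h1, h2⟩
  have hIccIoo : (Ioo r R ×ˢ Ioo (-Real.pi) Real.pi : Set (ℝ × ℝ)) =ᵐ[volume]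
      (uIcc r R ×ˢ uIcc (-Real.pi) Real.pi : Set (ℝ × ℝ)) := by
    rw [uIcc_of_le hrR, uIcc_of_le hpi, Measure.volume_eq_prod]
    exact Measure.set_prod_ae_eq Ioo_ae_eq_Icc Ioo_ae_eq_Icc
  have hgpol := polar_integrable c R g hg hgi
  have hsub : (Ioo r R ×ˢ Ioo (-Real.pi) Real.pi) ⊆ (Ioo 0 R ×ˢ Ioo (-Real.pi) Real.pi) :=
    Set.prod_mono (Ioo_subset_Ioo_left hr) le_rfl
  have hIntg0 : IntegrableOn (fun x : ℝ × ℝ => 2 * x.1 * dbar k (circleMap c x.1 x.2))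
      (Ioo r R ×ˢ Ioo (-Real.pi) Real.pi) := by
    have hG := (hgpol.mono_set hsub).const_mul 2
    apply Integrable.mono' hG
    · have := (measurable_dbar k).comp (measurable_circleMap2 c)
      apply Measurable.aestronglyMeasurable
      apply Measurable.mul _ this
      fun_prop
    · filter_upwards [hae] with x hx
      have hx0 : 0 ≤ x.1 := le_trans hr hx.1.1.1.le
      rw [norm_mul, norm_mul]
      simp only [Complex.norm_ofNat, Complex.norm_real, Real.norm_eq_abs, abs_of_nonneg hx0]
      have := (hkd x hx).2
      have := mul_le_mul_of_nonneg_left this hx0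
      linarith
  have hae2 : (fun x : ℝ × ℝ => 2 * x.1 * dbar k (circleMap c x.1 x.2)) =ᵐ[volume.restrict (Ioo r R ×ˢ Ioo (-Real.pi) Real.pi)]
      (fun x => fderiv ℝ f x (1, 0) + fderiv ℝ h x (0, 1)) := by
    filter_upwards [hae] with x hx using (hdiv x hx).symm
  have hIntg1 : IntegrableOn (fun x => fderiv ℝ f x (1, 0) + fderiv ℝ h x (0, 1))
      (uIcc r R ×ˢ uIcc (-Real.pi) Real.pi) := by
    rw [← integrableOn_congr_set_ae hIccIoo]
    exact hIntg0.congr hae2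
  have main := integral2_divergence_prod_of_hasFDerivAt_off_countable f h (fderiv ℝ f) (fderiv ℝ h)
    r (-Real.pi) R Real.pi s hsc hfc hhc (by rw [hmm]; exact hfd) (by rw [hmm]; exact hhd) hIntg1
  have hside : (∫ x in r..R, h (x, Real.pi)) = ∫ x in r..R, h (x, -Real.pi) := by
    congr 1
    ext x
    simp only [hh]
    have : exp ((Real.pi:ℂ) * I) = exp (((-Real.pi : ℝ):ℂ) * I) := by
      push_cast
      rw [Complex.exp_pi_mul_I, neg_mul, Complex.exp_neg_pi_mul_I]
    simp only [circleMap, this]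
  rw [hside, sub_self, zero_add] at main
  rw [circleIntegral_eq_pi, circleIntegral_eq_pi, ← mul_sub]
  change ‖I * ((∫ y in (-Real.pi)..Real.pi, f (R, y)) - ∫ y in (-Real.pi)..Real.pi, f (r, y))‖ ≤ _
  rw [norm_mul, Complex.norm_I, one_mul, ← main]
  have hiter : (∫ x in r..R, ∫ y in (-Real.pi)..Real.pi, fderiv ℝ f (x, y) (1, 0) + fderiv ℝ h (x, y) (0, 1))
      = ∫ x in Ioo r R ×ˢ Ioo (-Real.pi) Real.pi, fderiv ℝ f x (1, 0) + fderiv ℝ h x (0, 1) := by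
    rw [intervalIntegral.integral_of_le hrR]
    simp_rw [intervalIntegral.integral_of_le hpi]
    rw [integral_Ioc_eq_integral_Ioo]
    simp_rw [integral_Ioc_eq_integral_Ioo]
    rw [← integrableOn_congr_set_ae hIccIoo] at hIntg1
    rw [Measure.volume_eq_prod] at hIntg1 ⊢
    rw [setIntegral_prod _ hIntg1]
  rw [hiter, ← integral_congr_ae hae2]
  have hG := (hgpol.mono_set hsub).const_mul 2
  calc ‖∫ x in Ioo r R ×ˢ Ioo (-Real.pi) Real.pi, 2 * (x.1:ℂ) * dbar k (circleMap c x.1 x.2)‖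
      ≤ ∫ x in Ioo r R ×ˢ Ioo (-Real.pi) Real.pi, 2 * (x.1 * g (circleMap c x.1 x.2)) := by
        apply norm_integral_le_of_norm_le hG
        filter_upwards [hae] with x hx
        have hx0 : 0 ≤ x.1 := le_trans hr hx.1.1.1.le
        rw [norm_mul, norm_mul]
        simp only [Complex.norm_ofNat, Complex.norm_real, Real.norm_eq_abs, abs_of_nonneg hx0]
        have := (hkd x hx).2
        have := mul_le_mul_of_nonneg_left this hx0
        linarith
    _ ≤ ∫ x in Ioo 0 R ×ˢ Ioo (-Real.pi) Real.pi, 2 * (x.1 * g (circleMap c x.1 x.2)) := by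
        apply setIntegral_mono_set (hgpol.const_mul 2)
        · filter_upwards [ae_restrict_mem (measurableSet_Ioo.prod measurableSet_Ioo)] with x hx
          have : 0 ≤ x.1 := hx.1.1.le
          have := hg0 (circleMap c x.1 x.2)
          simp only [Pi.zero_apply]
          positivity
        · exact Filter.Eventually.of_forall hsub
    _ = 2 * ∫ ζ in ball c R, g ζ := by
        rw [integral_const_mul, ← polar_integral c R g]
        simp only [smul_eq_mul]

theorem radial_kernel (z : ℂ) (S : Set ℝ) (hS : MeasurableSet S) (f : ℝ → ℝ)
    (hi : IntegrableOn (fun y => y * f y) (Ioi 0 ∩ S)) :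
    IntegrableOn (fun ζ : ℂ => f ‖ζ - z‖) {ζ | ‖ζ - z‖ ∈ S} ∧
    ∫ ζ in {ζ : ℂ | ‖ζ - z‖ ∈ S}, f ‖ζ - z‖ = 2 * Real.pi * ∫ y in Ioi 0 ∩ S, y * f y := by
  have hm : MeasurableSet {ζ : ℂ | ‖ζ - z‖ ∈ S} := by
    have : Measurable (fun ζ : ℂ => ‖ζ - z‖) := by fun_prop
    exact this hS
  have hind : ∀ ζ : ℂ, ({ζ : ℂ | ‖ζ - z‖ ∈ S}.indicator (fun ζ : ℂ => f ‖ζ - z‖)) ζ = S.indicator f ‖ζ - z‖ := by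
    intro ζ
    by_cases h : ‖ζ - z‖ ∈ S
    · rw [indicator_of_mem h, indicator_of_mem (by exact h)]
    · rw [indicator_of_notMem h, indicator_of_notMem (by exact h)]
  have hind2 : ∀ y : ℝ, y ^ (Module.finrank ℝ ℂ - 1) • S.indicator f y = S.indicator (fun y => y * f y) y := by
    intro y
    by_cases h : y ∈ S <;> simp [h]
  have key : Integrable (fun x : ℂ => S.indicator f ‖x‖) := by
    rw [integrable_fun_norm_addHaar]
    simp_rw [hind2]
    rw [IntegrableOn, integrable_indicator_iff hS, IntegrableOn, Measure.restrict_restrict hS, inter_comm]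
    exact hi
  constructor
  · rw [← integrable_indicator_iff hm]
    simp_rw [funext hind]
    exact key.comp_sub_right z
  · rw [← integral_indicator hm]
    simp_rw [funext hind]
    rw [integral_sub_right_eq_self (fun x : ℂ => S.indicator f ‖x‖) z]
    rw [integral_fun_norm_addHaar]
    simp_rw [hind2]
    rw [integral_indicator hS, Measure.restrict_restrict hS, inter_comm]
    simp only [Complex.finrank_real_complex, nsmul_eq_mul, smul_eq_mul, Measure.real, Complex.volume_ball]
    simp
    ring

theorem rpow_ball (z : ℂ) {R a : ℝ} (hR : 0 ≤ R) (ha : -2 < a) :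
    IntegrableOn (fun ζ : ℂ => ‖ζ - z‖ ^ a) (ball z R) ∧
    ∫ ζ in ball z R, ‖ζ - z‖ ^ a = 2 * Real.pi * (R ^ (a + 2) / (a + 2)) := by
  have hset : {ζ : ℂ | ‖ζ - z‖ ∈ Iio R} = ball z R := by
    ext ζ; simp [dist_eq_norm]
  have hcong : ∀ y ∈ Ioi (0:ℝ) ∩ Iio R, y ^ (a + 1) = y * y ^ a := by
    intro y hy
    rw [Real.rpow_add_one (ne_of_gt hy.1)]; ring
  have hio : Ioi (0:ℝ) ∩ Iio R = Ioo 0 R := rfl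
  have hii : IntegrableOn (fun y : ℝ => y ^ (a+1)) (Ioo 0 R) := by
    have := intervalIntegral.intervalIntegrable_rpow' (a := 0) (b := R) (r := a + 1) (by linarith)
    rw [intervalIntegrable_iff_integrableOn_Ioo_of_le hR] at this
    exact this
  have := radial_kernel z (Iio R) measurableSet_Iio (fun y => y ^ a) (by
    rw [hio] at *
    exact hii.congr_fun hcong measurableSet_Ioo)
  rw [hset] at this
  refine ⟨this.1, this.2.trans ?_⟩
  congr 1
  rw [hio] at *
  rw [← setIntegral_congr_fun measurableSet_Ioo hcong, ← integral_Ioc_eq_integral_Ioo,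
    ← intervalIntegral.integral_of_le hR, integral_rpow (Or.inl (by linarith))]
  rw [show a + 1 + 1 = a + 2 by ring, Real.zero_rpow (by linarith)]
  simp

theorem rpow_ext (z : ℂ) {R a : ℝ} (hR : 0 < R) (ha : a < -2) :
    IntegrableOn (fun ζ : ℂ => ‖ζ - z‖ ^ a) {ζ | R < ‖ζ - z‖} ∧
    ∫ ζ in {ζ | R < ‖ζ - z‖}, ‖ζ - z‖ ^ a = 2 * Real.pi * (-R ^ (a + 2) / (a + 2)) := by
  have hset : {ζ : ℂ | ‖ζ - z‖ ∈ Ioi R} = {ζ | R < ‖ζ - z‖} := by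
    ext ζ; simp
  have hio : Ioi (0:ℝ) ∩ Ioi R = Ioi R := by
    rw [Ioi_inter_Ioi]; simp [hR.le]
  have hcong : ∀ y ∈ Ioi R, y ^ (a + 1) = y * y ^ a := by
    intro y hy
    rw [Real.rpow_add_one (ne_of_gt (hR.trans hy))]; ring
  have := radial_kernel z (Ioi R) measurableSet_Ioi (fun y => y ^ a) (by
    rw [hio] at *
    exact (integrableOn_Ioi_rpow_of_lt (by linarith) hR).congr_fun hcong measurableSet_Ioi)
  rw [hset] at this
  refine ⟨this.1, this.2.trans ?_⟩
  congr 1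
  rw [hio] at *
  rw [← setIntegral_congr_fun measurableSet_Ioi hcong, integral_Ioi_rpow_of_lt (by linarith) hR]
  rw [show a + 1 + 1 = a + 2 by ring]

theorem inv_kernel_ball (c z : ℂ) {R : ℝ} (hR : 0 ≤ R) (hz : ‖z - c‖ ≤ R) :
    IntegrableOn (fun ζ : ℂ => ‖ζ - z‖⁻¹) (ball c R) ∧
    ∫ ζ in ball c R, ‖ζ - z‖⁻¹ ≤ 4 * Real.pi * R := by
  have h := rpow_ball z (R := 2 * R) (a := -1) (by linarith) (by norm_num)
  simp only [Real.rpow_neg_one] at h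
  have hsub : ball c R ⊆ ball z (2 * R) := by
    apply ball_subset_ball'
    rw [dist_comm, dist_eq_norm]; linarith
  refine ⟨h.1.mono_set hsub, ?_⟩
  calc ∫ ζ in ball c R, ‖ζ - z‖⁻¹ ≤ ∫ ζ in ball z (2 * R), ‖ζ - z‖⁻¹ := by
        apply setIntegral_mono_set h.1
        · exact Filter.Eventually.of_forall (fun _ => by positivity)
        · exact Filter.Eventually.of_forall hsub
    _ = 4 * Real.pi * R := by
        rw [h.2]; norm_num; ring

theorem dbar_mul_hol {g h : ℂ → ℂ} {z : ℂ} (hg : DifferentiableAt ℝ g z) (hh : DifferentiableAt ℂ h z) :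
    dbar (fun w => g w * h w) z = dbar g z * h z := by
  have h1 : HasFDerivAt h ((fderiv ℂ h z).restrictScalars ℝ) z := hh.hasFDerivAt.restrictScalars ℝ
  have h2 := (hg.hasFDerivAt.fun_mul h1).fderiv
  have hI : (fderiv ℂ h z) I = I * fderiv ℂ h z 1 := by
    have := (fderiv ℂ h z).map_smul I 1
    simpa using this
  unfold dbar
  rw [h2]
  simp [hI]
  linear_combination (g z * (deriv h z)) * Complex.I_sq / 2

theorem dbar_congr {g h : ℂ → ℂ} {z : ℂ} (e : g =ᶠ[𝓝 z] h) : dbar g z = dbar h z := by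
  unfold dbar
  rw [e.fderiv_eq]

theorem dbar_sub_conj {g : ℂ → ℂ} {z : ℂ} (hg : DifferentiableAt ℝ g z) (a b w : ℂ) :
    DifferentiableAt ℝ (fun ζ => g ζ - a - b * (starRingEnd ℂ) (ζ - w)) z ∧
    dbar (fun ζ => g ζ - a - b * (starRingEnd ℂ) (ζ - w)) z = dbar g z - b := by
  have hc : HasFDerivAt (fun ζ : ℂ => (starRingEnd ℂ) (ζ - w)) (Complex.conjCLE : ℂ →L[ℝ] ℂ) z := by
    have := (Complex.conjCLE.hasFDerivAt (x := z - w)).comp z ((hasFDerivAt_id z).sub_const w)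
    exact this
  have h := (hg.hasFDerivAt.sub_const a).fun_sub (hc.const_mul b)
  refine ⟨h.differentiableAt, ?_⟩
  unfold dbar
  rw [h.fderiv]
  simp
  linear_combination b * Complex.I_sq / 2

theorem fderiv_split {g : ℂ → ℂ} {z w : ℂ} :
    fderiv ℝ g z w = ((fderiv ℝ g z 1 - I * fderiv ℝ g z I) / 2) * w + dbar g z * (starRingEnd ℂ) w := by
  rw [rlin_apply]
  unfold dbar
  have h1 : w = w.re + w.im * I := (Complex.re_add_im w).symm
  have h2 : (starRingEnd ℂ) w = w.re - w.im * I := by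
    apply Complex.ext <;> simp
  rw [h2]
  generalize fderiv ℝ g z 1 = a
  generalize fderiv ℝ g z I = b
  linear_combination ((w.im:ℂ) * b) * Complex.I_sq  + ((I * b - a)/2) * h1

theorem pompeiu {z0 z : ℂ} {r M : ℝ} (hr : 0 < r) (hz : ‖z - z0‖ < r) (g : ℂ → ℂ)
    (hd : ∀ ζ, ‖ζ - z0‖ < r → DifferentiableAt ℝ g ζ) (hc : ContinuousOn g (closedBall z0 r))
    (hM : ∀ ζ, ‖ζ - z0‖ < r → ‖dbar g ζ‖ ≤ M) :
    ‖2 * Real.pi * I * g z - ∮ ζ in C(z0, r), (ζ - z)⁻¹ * g ζ‖ ≤ 18 * Real.pi * r * M := by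
  have hM0 : 0 ≤ M := (norm_nonneg _).trans (hM z hz)
  set b := dbar g z with hb
  set a := (fderiv ℝ g z 1 - I * fderiv ℝ g z I) / 2 with ha
  set q : ℂ → ℂ := fun ζ => (g ζ - g z - b * (starRingEnd ℂ) (ζ - z)) * (ζ - z)⁻¹ with hq
  set k : ℂ → ℂ := Function.update q z a with hk
  have hkne : ∀ ζ, ζ ≠ z → k =ᶠ[𝓝 ζ] q := by
    intro ζ hζ
    filter_upwards [isOpen_ne.mem_nhds hζ] with w hw
    simp [hk, Function.update_of_ne hw]
  have hqd : ∀ ζ, ζ ≠ z → ‖ζ - z0‖ < r → DifferentiableAt ℝ q ζ ∧ dbar q ζ = (dbar g ζ - b) * (ζ - z)⁻¹ := by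
    intro ζ hζ hζr
    have h1 := dbar_sub_conj (hd ζ hζr) (g z) b z
    have h2 : DifferentiableAt ℂ (fun ζ => (ζ - z)⁻¹) ζ := by
      exact (differentiableAt_id.sub_const z).fun_inv (sub_ne_zero.2 hζ)
    refine ⟨h1.1.mul (h2.restrictScalars ℝ), ?_⟩
    rw [hq, dbar_mul_hol h1.1 h2, h1.2]
  have hkz : ContinuousAt k z := by
    rw [hk, continuousAt_update_same]
    have ho := (hd z hz).hasFDerivAt.isLittleO
    have ht : Tendsto (fun ζ => (g ζ - g z - fderiv ℝ g z (ζ - z)) * (ζ - z)⁻¹ + a) (𝓝[≠] z) (𝓝 (0 + a)) := by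
      apply Tendsto.add_const
      have h3 := (ho.mono (nhdsWithin_le_nhds (s := {z}ᶜ))).tendsto_div_nhds_zero
      simpa [div_eq_mul_inv] using h3
    rw [zero_add] at ht
    apply ht.congr'
    filter_upwards [self_mem_nhdsWithin] with ζ hζ
    have hne : ζ - z ≠ 0 := sub_ne_zero.2 hζ
    rw [fderiv_split, ← ha, ← hb, hq]
    field_simp
    ring
  have hball : closedBall z0 r = {ζ | 0 ≤ ‖ζ - z0‖ ∧ ‖ζ - z0‖ ≤ r} := by
    ext ζ; simp [dist_eq_norm]
  have hqc : ContinuousOn q (closedBall z0 r \ {z}) := by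
    apply ContinuousOn.mul
    · apply ContinuousOn.sub
      · exact (hc.mono diff_subset).sub continuousOn_const
      · fun_prop
    · apply ContinuousOn.inv₀ (by fun_prop)
      intro ζ hζ
      exact sub_ne_zero.2 hζ.2
  have hkc : ContinuousOn k (closedBall z0 r) := by
    intro ζ hζ
    by_cases h : ζ = z
    · rw [h]; exact hkz.continuousWithinAt
    · have h1 : ContinuousWithinAt q (closedBall z0 r \ {z}) ζ := hqc ζ ⟨hζ, h⟩
      have h2 : ContinuousWithinAt q (closedBall z0 r) ζ := by
        apply h1.mono_of_mem_nhdsWithin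
        rw [Set.diff_eq]
        exact inter_mem self_mem_nhdsWithin (mem_nhdsWithin_of_mem_nhds (isOpen_compl_singleton.mem_nhds h))
      exact h2.congr_of_eventuallyEq ((hkne ζ h).filter_mono nhdsWithin_le_nhds) (hkne ζ h).eq_of_nhds
  have hik := inv_kernel_ball z0 z hr.le hz.le
  have G := green_annulus (c := z0) (r := 0) (R := r) le_rfl hr.le k {z} (countable_singleton z)
    (by rw [← hball]; exact hkc)
    (by
      intro ζ h1 _ h3
      exact ((hkne ζ h1).differentiableAt_iff).2 (hqd ζ h1 h3).1)
    (fun ζ => 2 * M * ‖ζ - z‖⁻¹) (by fun_prop) (hik.1.const_mul _)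
    (by intro ζ; positivity)
    (by
      intro ζ h1 _ h3
      rw [dbar_congr (hkne ζ h1), (hqd ζ h1 h3).2, norm_mul, norm_inv]
      gcongr
      calc ‖dbar g ζ - b‖ ≤ ‖dbar g ζ‖ + ‖b‖ := norm_sub_le _ _
        _ ≤ 2 * M := by linarith [hM ζ h3, hM z hz])
  rw [circleIntegral.integral_radius_zero, sub_zero, integral_const_mul] at G
  have hsz : ∀ ζ ∈ sphere z0 r, ζ ≠ z := by
    rintro ζ hζ rfl
    rw [mem_sphere, dist_eq_norm] at hζ
    linarith
  have hinv : ContinuousOn (fun ζ => (ζ - z)⁻¹) (sphere z0 r) := by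
    apply ContinuousOn.inv₀ (by fun_prop)
    intro ζ hζ
    exact sub_ne_zero.2 (hsz ζ hζ)
  have i1 : CircleIntegrable (fun ζ => (ζ - z)⁻¹ * g ζ) z0 r :=
    (hinv.mul (hc.mono sphere_subset_closedBall)).circleIntegrable hr.le
  have i2 : CircleIntegrable (fun ζ => g z * (ζ - z)⁻¹) z0 r :=
    (continuousOn_const.mul hinv).circleIntegrable hr.le
  have i3 : CircleIntegrable (fun ζ => b * (starRingEnd ℂ) (ζ - z) * (ζ - z)⁻¹) z0 r := by
    apply ContinuousOn.circleIntegrable hr.le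
    apply ContinuousOn.mul _ hinv
    fun_prop
  have E : (∮ ζ in C(z0, r), k ζ) = (∮ ζ in C(z0, r), (ζ - z)⁻¹ * g ζ) - g z * (2 * Real.pi * I)
      - ∮ ζ in C(z0, r), b * (starRingEnd ℂ) (ζ - z) * (ζ - z)⁻¹ := by
    rw [← circleIntegral.integral_sub_inv_of_mem_ball (c := z0) (w := z) (R := r) (by rwa [mem_ball, dist_eq_norm]),
      ← circleIntegral.integral_const_mul, ← circleIntegral.integral_sub i1 i2, ← circleIntegral.integral_sub (i1.fun_sub i2) i3]
    apply circleIntegral.integral_congr hr.le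
    intro ζ hζ
    simp only [hk, Function.update_of_ne (hsz ζ hζ), hq]
    ring
  have B3 : ‖∮ ζ in C(z0, r), b * (starRingEnd ℂ) (ζ - z) * (ζ - z)⁻¹‖ ≤ 2 * Real.pi * r * M := by
    apply circleIntegral.norm_integral_le_of_norm_le_const hr.le
    intro ζ hζ
    rw [norm_mul, norm_mul, norm_inv, RCLike.norm_conj, mul_assoc, mul_inv_cancel₀ (norm_ne_zero_iff.2 (sub_ne_zero.2 (hsz ζ hζ))), mul_one]
    exact hM z hz
  have : 2 * Real.pi * I * g z - ∮ ζ in C(z0, r), (ζ - z)⁻¹ * g ζ = -(∮ ζ in C(z0, r), k ζ)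
      - ∮ ζ in C(z0, r), b * (starRingEnd ℂ) (ζ - z) * (ζ - z)⁻¹ := by
    rw [E]; ring
  rw [this]
  refine (norm_sub_le _ _).trans ?_
  rw [norm_neg]
  have := mul_le_mul_of_nonneg_left hik.2 (by positivity : 0 ≤ 2 * (2 * M))
  nlinarith [Real.pi_pos]

/-- second difference estimate -/
theorem second_diff {z0 d : ℂ} {r M m : ℝ} (hr : 0 < r) (hd2 : ‖d‖ ≤ r / 2) (g : ℂ → ℂ)
    (hd : ∀ ζ, ‖ζ - z0‖ < r → DifferentiableAt ℝ g ζ) (hc : ContinuousOn g (closedBall z0 r))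
    (hM : ∀ ζ, ‖ζ - z0‖ < r → ‖dbar g ζ‖ ≤ M) (hm : ∀ ζ, ‖ζ - z0‖ ≤ r → ‖g ζ‖ ≤ m) :
    ‖g (z0 + d) - 2 * g (z0 + d / 2) + g z0‖ ≤ 36 * r * M + 4 * m * ‖d‖ ^ 2 / r ^ 2 := by
  have hm0 : 0 ≤ m := (norm_nonneg _).trans (hm z0 (by simp [hr.le]))
  have p1 := pompeiu (z := z0 + d) hr (by simp; linarith) g hd hc hM
  have p2 := pompeiu (z := z0 + d / 2) hr (by simp; linarith) g hd hc hM
  have p3 := pompeiu (z := z0) hr (by simp; linarith) g hd hc hM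
  have hci : ∀ w : ℂ, ‖w - z0‖ < r → CircleIntegrable (fun ζ => (ζ - w)⁻¹ * g ζ) z0 r := by
    intro w hw
    apply ContinuousOn.circleIntegrable hr.le
    apply ContinuousOn.mul _ (hc.mono sphere_subset_closedBall)
    apply ContinuousOn.inv₀ (by fun_prop)
    rintro ζ hζ h
    rw [sub_eq_zero] at h
    rw [mem_sphere, dist_eq_norm, h] at hζ
    linarith
  have i1 := hci (z0 + d) (by simp; linarith)
  have i2 := hci (z0 + d / 2) (by simp; linarith)
  have i3 := hci z0 (by simp; linarith)
  have i2' : CircleIntegrable (fun ζ => 2 * ((ζ - (z0 + d / 2))⁻¹ * g ζ)) z0 r := i2.const_smul (a := (2:ℂ))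
  have B : ‖(∮ ζ in C(z0, r), (ζ - (z0 + d))⁻¹ * g ζ) - 2 * (∮ ζ in C(z0, r), (ζ - (z0 + d / 2))⁻¹ * g ζ)
      + ∮ ζ in C(z0, r), (ζ - z0)⁻¹ * g ζ‖ ≤ 2 * Real.pi * r * (4 * m * ‖d‖ ^ 2 / r ^ 3) := by
    rw [← circleIntegral.integral_const_mul, ← circleIntegral.integral_sub i1 i2', ← circleIntegral.integral_add (i1.fun_sub i2') i3]
    apply circleIntegral.norm_integral_le_of_norm_le_const hr.le
    intro ζ hζ
    rw [mem_sphere, dist_eq_norm] at hζ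
    set u := ζ - z0 with hu
    have e1 : ζ - (z0 + d) = u - d := by rw [hu]; ring
    have e2 : ζ - (z0 + d / 2) = u - d / 2 := by rw [hu]; ring
    have n1 : r / 2 ≤ ‖u - d‖ := by
      have := norm_sub_norm_le u d; linarith
    have n2 : 3 * r / 4 ≤ ‖u - d / 2‖ := by
      have := norm_sub_norm_le u (d / 2)
      have h2 : ‖d / 2‖ = ‖d‖ / 2 := by simp
      linarith
    have u0 : u ≠ 0 := norm_ne_zero_iff.1 (by linarith)
    have u1 : u - d ≠ 0 := norm_ne_zero_iff.1 (by linarith)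
    have u2 : u - d / 2 ≠ 0 := norm_ne_zero_iff.1 (by linarith)
    rw [e1, e2]
    have : (u - d)⁻¹ * g ζ - 2 * ((u - d / 2)⁻¹ * g ζ) + u⁻¹ * g ζ
        = (d ^ 2 / 2) * g ζ / (u * (u - d / 2) * (u - d)) := by
      have u2' : u * 2 - d ≠ 0 := by
        intro h; apply u2; linear_combination h / 2
      field_simp
      ring
    rw [this, norm_div, norm_mul, norm_mul, norm_mul, hζ, norm_div, norm_pow]
    have hg := hm ζ hζ.le
    have hden : r * (3 * r / 4) * (r / 2) ≤ r * ‖u - d / 2‖ * ‖u - d‖ := by gcongr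
    have hden0 : 0 < r * (3 * r / 4) * (r / 2) := by positivity
    calc ‖d‖ ^ 2 / ‖(2:ℂ)‖ * ‖g ζ‖ / (r * ‖u - d / 2‖ * ‖u - d‖)
        ≤ ‖d‖ ^ 2 / ‖(2:ℂ)‖ * m / (r * (3 * r / 4) * (r / 2)) := by gcongr
      _ ≤ 4 * m * ‖d‖ ^ 2 / r ^ 3 := by
        rw [Complex.norm_ofNat]
        rw [div_le_div_iff₀ hden0 (by positivity)]
        have : 0 ≤ m * ‖d‖ ^ 2 * r ^ 3 := by positivity
        nlinarith
  set A1 := ∮ ζ in C(z0, r), (ζ - (z0 + d))⁻¹ * g ζ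
  set A2 := ∮ ζ in C(z0, r), (ζ - (z0 + d / 2))⁻¹ * g ζ
  set A3 := ∮ ζ in C(z0, r), (ζ - z0)⁻¹ * g ζ
  have hpi := Real.pi_pos
  have key : ‖2 * Real.pi * I * (g (z0 + d) - 2 * g (z0 + d / 2) + g z0)‖ ≤ 2 * Real.pi * (36 * r * M + 4 * m * ‖d‖ ^ 2 / r ^ 2) := by
    have : 2 * Real.pi * I * (g (z0 + d) - 2 * g (z0 + d / 2) + g z0) =
      (2 * Real.pi * I * g (z0 + d) - A1) - 2 * (2 * Real.pi * I * g (z0 + d / 2) - A2) + (2 * Real.pi * I * g z0 - A3)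
       + (A1 - 2 * A2 + A3) := by ring
    rw [this]
    have hh : 2 * Real.pi * r * (4 * m * ‖d‖ ^ 2 / r ^ 3) = 2 * Real.pi * (4 * m * ‖d‖ ^ 2 / r ^ 2) := by
      field_simp
    refine (norm_add_le _ _).trans ?_
    have t1 := norm_add_le ((2 * Real.pi * I * g (z0 + d) - A1) - 2 * (2 * Real.pi * I * g (z0 + d / 2) - A2)) (2 * Real.pi * I * g z0 - A3)
    have t2 := norm_sub_le (2 * Real.pi * I * g (z0 + d) - A1) (2 * (2 * Real.pi * I * g (z0 + d / 2) - A2))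
    have t3 : ‖2 * (2 * Real.pi * I * g (z0 + d / 2) - A2)‖ = 2 * ‖2 * Real.pi * I * g (z0 + d / 2) - A2‖ := by
      rw [norm_mul, Complex.norm_ofNat]
    rw [hh] at B
    nlinarith
  rw [norm_mul] at key
  have : ‖(2:ℂ) * Real.pi * I‖ = 2 * Real.pi := by
    simp [abs_of_pos hpi]
  rw [this] at key
  exact le_of_mul_le_mul_left key (by positivity)

theorem Jstd_apply {n : ℕ} (v : Cn n) : Jstd n v = I • v := by
  simp [Jstd]

/-- cube root -/
noncomputable def cbrt (t : ℝ) : ℝ := t ^ (1 / 3 : ℝ)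

theorem cbrt_nonneg {t : ℝ} (ht : 0 ≤ t) : 0 ≤ cbrt t := Real.rpow_nonneg ht _

theorem cbrt_pow {t : ℝ} (ht : 0 ≤ t) : cbrt t ^ 3 = t := by
  unfold cbrt
  rw [← Real.rpow_natCast, ← Real.rpow_mul ht]
  norm_num

theorem cbrt_mono {s t : ℝ} (hs : 0 ≤ s) (hst : s ≤ t) : cbrt s ≤ cbrt t :=
  Real.rpow_le_rpow hs hst (by norm_num)

theorem cbrt_mul {s t : ℝ} (hs : 0 ≤ s) (ht : 0 ≤ t) : cbrt (s * t) = cbrt s * cbrt t :=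
  Real.mul_rpow hs ht

theorem cbrt_zero : cbrt 0 = 0 := Real.zero_rpow (by norm_num)

theorem continuous_cbrt : Continuous cbrt := Real.continuous_rpow_const (by norm_num)

theorem cbrt_half {t : ℝ} (ht : 0 ≤ t) : cbrt (t / 2) ≤ 4 / 5 * cbrt t := by
  have h1 := cbrt_nonneg ht
  have h2 := cbrt_nonneg (show 0 ≤ t / 2 by linarith)
  have h3 := cbrt_pow ht
  have h4 := cbrt_pow (show 0 ≤ t / 2 by linarith)
  apply le_of_pow_le_pow_left₀ (n := 3) (by norm_num) (by positivity)
  rw [h4, mul_pow, h3]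
  linarith

/-- Solutions of the (variable coefficient) Cauchy-Riemann equation. -/
structure Sol {n : ℕ} (f : ℂ → Cn n) (P : ℂ → Cn n →L[ℝ] Cn n) (ε : ℝ) (D : Set ℂ) : Prop where
  diff : ∀ ζ ∈ D, DifferentiableAt ℝ f ζ
  eq : ∀ ζ ∈ D, fderiv ℝ f ζ I = P ζ (fderiv ℝ f ζ 1)
  near : ∀ ζ ∈ D, ‖P ζ - Jstd n‖ ≤ 1 / 2
  sq : ∀ ζ ∈ D, ∀ v, P ζ (P ζ v) = -v
  lip : ∀ ζ ∈ D, ∀ ξ ∈ D, ‖P ζ - P ξ‖ ≤ ε * ‖f ζ - f ξ‖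

theorem near_apply {n : ℕ} {P : Cn n →L[ℝ] Cn n} {δ : ℝ} (h : ‖P - Jstd n‖ ≤ δ) (v : Cn n) :
    ‖P v - I • v‖ ≤ δ * ‖v‖ := by
  have := (P - Jstd n).le_of_opNorm_le h v
  simpa [Jstd_apply] using this

theorem near_norm {n : ℕ} {P : Cn n →L[ℝ] Cn n} {δ : ℝ} (h : ‖P - Jstd n‖ ≤ δ) (v : Cn n) :
    ‖P v‖ ≤ (1 + δ) * ‖v‖ := by
  have h1 := near_apply h v
  have h2 : ‖P v‖ ≤ ‖P v - I • v‖ + ‖I • v‖ := by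
    have := norm_add_le (P v - I • v) (I • v)
    simpa using this
  rw [norm_smul, Complex.norm_I, one_mul] at h2
  linarith

theorem rlin_apply' {n : ℕ} (L : ℂ →L[ℝ] Cn n) (w : ℂ) : L w = w.re • L 1 + w.im • L I := by
  have h : w = w.re • (1:ℂ) + w.im • I := by
    conv_lhs => rw [← Complex.re_add_im w]
    simp
  conv_lhs => rw [h]
  rw [map_add, L.map_smul, L.map_smul]

theorem rlin_norm {n : ℕ} (L : ℂ →L[ℝ] Cn n) {P : Cn n →L[ℝ] Cn n} (h : ‖P - Jstd n‖ ≤ 1 / 2)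
    (e : L I = P (L 1)) : ‖L‖ ≤ 3 * ‖L 1‖ := by
  apply L.opNorm_le_bound (by positivity)
  intro w
  rw [rlin_apply' L w, e]
  have h1 := near_norm h (L 1)
  have hre := Complex.abs_re_le_norm w
  have him := Complex.abs_im_le_norm w
  calc ‖w.re • L 1 + w.im • P (L 1)‖ ≤ ‖w.re • L 1‖ + ‖w.im • P (L 1)‖ := norm_add_le _ _
    _ = |w.re| * ‖L 1‖ + |w.im| * ‖P (L 1)‖ := by
      rw [norm_smul, norm_smul, Real.norm_eq_abs, Real.norm_eq_abs]
    _ ≤ ‖w‖ * ‖L 1‖ + ‖w‖ * ((1 + 1 / 2) * ‖L 1‖) := by gcongr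
    _ ≤ 3 * ‖L 1‖ * ‖w‖ := by nlinarith [mul_nonneg (norm_nonneg w) (norm_nonneg (L 1))]

/-- the complex-linearising projection -/
noncomputable def linA {n : ℕ} (P : Cn n →L[ℝ] Cn n) : Cn n →L[ℝ] Cn n :=
  (1 / 2 : ℝ) • (ContinuousLinearMap.id ℝ (Cn n) - (Jstd n).comp P)

theorem linA_apply {n : ℕ} (P : Cn n →L[ℝ] Cn n) (v : Cn n) : linA P v = (1 / 2 : ℝ) • (v - I • P v) := by
  simp [linA, Jstd_apply]

theorem linA_comp {n : ℕ} {P : Cn n →L[ℝ] Cn n} (h : ∀ v, P (P v) = -v) (v : Cn n) :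
    linA P (P v) = I • linA P v := by
  rw [linA_apply, linA_apply, h, smul_comm I (1 / 2 : ℝ), smul_sub I, smul_smul, Complex.I_mul_I]
  congr 1
  simp [add_comm]

theorem linA_near {n : ℕ} {P : Cn n →L[ℝ] Cn n} {δ : ℝ} (h : ‖P - Jstd n‖ ≤ δ) (v : Cn n) :
    ‖linA P v - v‖ ≤ δ / 2 * ‖v‖ := by
  have : linA P v - v = (1 / 2 : ℝ) • ((-I) • (P v - I • v)) := by
    rw [linA_apply, smul_sub (-I), smul_smul]
    simp only [neg_mul, Complex.I_mul_I, neg_neg, one_smul, neg_smul]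
    module
  rw [this, norm_smul, norm_smul]
  have h1 := near_apply h v
  simp
  linarith

theorem linA_lower {n : ℕ} {P : Cn n →L[ℝ] Cn n} (h : ‖P - Jstd n‖ ≤ 1 / 2) (v : Cn n) :
    ‖v‖ ≤ 4 / 3 * ‖linA P v‖ ∧ ‖linA P v‖ ≤ 5 / 4 * ‖v‖ := by
  have h1 := linA_near h v
  have h2 : ‖v‖ ≤ ‖linA P v‖ + ‖linA P v - v‖ := by
    have := norm_sub_le (linA P v) (linA P v - v)
    simpa using this
  have h3 : ‖linA P v‖ ≤ ‖linA P v - v‖ + ‖v‖ := by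
    have := norm_add_le (linA P v - v) v
    simpa using this
  constructor <;> linarith

theorem Sol.lipf {n : ℕ} {f : ℂ → Cn n} {P : ℂ → Cn n →L[ℝ] Cn n} {ε : ℝ} {D : Set ℂ} (h : Sol f P ε D)
    (hD : Convex ℝ D) {L : ℝ} (hL : ∀ ζ ∈ D, ‖fderiv ℝ f ζ 1‖ ≤ L) {z w : ℂ} (hz : z ∈ D) (hw : w ∈ D) :
    ‖f w - f z‖ ≤ 3 * L * ‖w - z‖ := by
  apply hD.norm_image_sub_le_of_norm_fderiv_le (𝕜 := ℝ) h.diff _ hz hw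
  intro ζ hζ
  exact (rlin_norm _ (h.near ζ hζ) (h.eq ζ hζ)).trans (by linarith [hL ζ hζ])

theorem reg1_step {n : ℕ} {f : ℂ → Cn n} {P : ℂ → Cn n →L[ℝ] Cn n} {ε L : ℝ} (h : Sol f P ε (ball 0 1))
    (hε : ε ≤ 1) (hL : ∀ ζ ∈ ball (0:ℂ) 1, ‖fderiv ℝ f ζ 1‖ ≤ L) {d : ℂ} (hd0 : d ≠ 0) (hd : ‖d‖ ≤ 1 / 8) :
    ‖f d - (2:ℝ) • f (d / 2) + f 0‖ ≤ 150 * (L ^ 2 + L) * (‖d‖ * cbrt ‖d‖) := by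
  have h0 : (0:ℂ) ∈ ball (0:ℂ) 1 := by simp
  have hL0 : 0 ≤ L := (norm_nonneg _).trans (hL 0 h0)
  set t := ‖d‖ with ht
  set s := cbrt t with hs
  have ht0 : 0 < t := norm_pos_iff.2 hd0
  have hs0 : 0 ≤ s := cbrt_nonneg ht0.le
  have hst : s ^ 3 = t := cbrt_pow ht0.le
  have hs1 : 0 < s := by
    rcases hs0.lt_or_eq with h | h
    · exact h
    · rw [← h] at hst; simp at hst; linarith
  have hs2 : s ≤ 1 / 2 := by
    apply le_of_pow_le_pow_left₀ (n := 3) (by norm_num) (by positivity)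
    rw [hst]; norm_num; linarith
  set r := s ^ 2 with hr
  have hr0 : 0 < r := by positivity
  have hr1 : r ≤ 1 / 4 := by nlinarith
  have hdr : t ≤ r / 2 := by rw [← hst, hr]; nlinarith
  set A := linA (P 0) with hA
  have hAl := fun v => linA_lower (h.near 0 h0) v
  have hin : ∀ ζ : ℂ, ‖ζ - 0‖ ≤ r → ζ ∈ ball (0:ℂ) 1 := by
    intro ζ hζ
    rw [mem_ball, dist_eq_norm]; linarith
  obtain ⟨ℓ, hℓ1, hℓ2⟩ := exists_dual_vector'' ℂ (A (f d - (2:ℝ) • f (d / 2) + f 0))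
  set Λ : Cn n →L[ℝ] ℂ := (ℓ.restrictScalars ℝ).comp A with hΛ
  have hΛn : ∀ v, ‖Λ v‖ ≤ 5 / 4 * ‖v‖ := by
    intro v
    have h1 : ‖ℓ (A v)‖ ≤ 1 * ‖A v‖ := ℓ.le_of_opNorm_le hℓ1 _
    have h2 := (hAl v).2
    change ‖ℓ (A v)‖ ≤ _
    linarith
  have hΛI : ∀ v, Λ (P 0 v) = I * Λ v := by
    intro v
    change ℓ (A (P 0 v)) = I * ℓ (A v)
    rw [hA, linA_comp (h.sq 0 h0), map_smul, smul_eq_mul]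
  set g : ℂ → ℂ := fun ζ => Λ (f ζ - f 0) with hg
  have hlf : ∀ ζ ∈ ball (0:ℂ) 1, ‖f ζ - f 0‖ ≤ 3 * L * ‖ζ‖ := by
    intro ζ hζ
    have := h.lipf (convex_ball 0 1) hL h0 hζ
    simpa using this
  have hgd : ∀ ζ ∈ ball (0:ℂ) 1, HasFDerivAt g (Λ.comp (fderiv ℝ f ζ)) ζ := by
    intro ζ hζ
    exact Λ.hasFDerivAt.comp ζ ((h.diff ζ hζ).hasFDerivAt.sub_const (f 0))
  have hdb : ∀ ζ, ‖ζ - 0‖ < r → ‖dbar g ζ‖ ≤ 3 * L ^ 2 * r := by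
    intro ζ hζ
    have hζ1 := hin ζ hζ.le
    set v := fderiv ℝ f ζ I with hv
    have hx : fderiv ℝ f ζ 1 = - P ζ v := by
      rw [hv, h.eq ζ hζ1, h.sq ζ hζ1, neg_neg]
    have e1 : dbar g ζ = (1 / 2 : ℂ) * Λ ((P 0 - P ζ) v) := by
      unfold dbar
      rw [(hgd ζ hζ1).fderiv]
      simp only [ContinuousLinearMap.comp_apply, hx, ← hv, ContinuousLinearMap.sub_apply, map_neg, map_sub]
      rw [← hΛI]
      ring
    have e2 : ‖v‖ ≤ 3 / 2 * L := by
      rw [hv, h.eq ζ hζ1]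
      have := near_norm (h.near ζ hζ1) (fderiv ℝ f ζ 1)
      have := hL ζ hζ1
      linarith
    have e3 : ‖P 0 - P ζ‖ ≤ 3 * L * r := by
      have h1 := h.lip 0 h0 ζ hζ1
      have h2 := hlf ζ hζ1
      rw [norm_sub_rev] at h2
      have h3 : ‖ζ‖ ≤ r := by simpa using hζ.le
      calc ‖P 0 - P ζ‖ ≤ ε * ‖f 0 - f ζ‖ := h1
        _ ≤ 1 * ‖f 0 - f ζ‖ := by gcongr
        _ ≤ 3 * L * ‖ζ‖ := by linarith
        _ ≤ 3 * L * r := by gcongr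
    rw [e1, norm_mul]
    have e4 := hΛn ((P 0 - P ζ) v)
    have e5 := (P 0 - P ζ).le_of_opNorm_le e3 v
    have e6 : 3 * L * r * ‖v‖ ≤ 3 * L * r * (3 / 2 * L) := by gcongr
    have e7 : 0 ≤ L ^ 2 * r := by positivity
    have e8 : ‖(1 / 2 : ℂ)‖ = 1 / 2 := by norm_num
    rw [e8]
    nlinarith
  have SD := second_diff (z0 := 0) (d := d) (r := r) (M := 3 * L ^ 2 * r) (m := 4 * L * r) hr0 hdr g
    (fun ζ hζ => (hgd ζ (hin ζ hζ.le)).differentiableAt)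
    (fun ζ hζ => (hgd ζ (hin ζ (by simpa [dist_eq_norm] using hζ))).continuousAt.continuousWithinAt)
    hdb (by
      intro ζ hζ
      have h1 := hlf ζ (hin ζ hζ)
      have h2 := hΛn (f ζ - f 0)
      have h3 : ‖ζ‖ ≤ r := by simpa using hζ
      have h4 : 3 * L * ‖ζ‖ ≤ 3 * L * r := by gcongr
      have h5 : 0 ≤ L * r := by positivity
      change ‖Λ (f ζ - f 0)‖ ≤ _
      nlinarith)
  have e0 : g (0 + d) - 2 * g (0 + d / 2) + g 0 = ℓ (A (f d - (2:ℝ) • f (d / 2) + f 0)) := by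
    have : Λ (f d - (2:ℝ) • f (d / 2) + f 0) = g (0 + d) - 2 * g (0 + d / 2) + g 0 := by
      simp only [hg, zero_add, map_sub, map_add, Λ.map_smul]
      simp
      ring
    rw [← this]; rfl
  rw [e0, hℓ2] at SD
  have hnn : ‖((‖A (f d - (2:ℝ) • f (d / 2) + f 0)‖ : ℝ) : ℂ)‖ = ‖A (f d - (2:ℝ) • f (d / 2) + f 0)‖ := by
    rw [Complex.norm_real, norm_norm]
  have SD' : ‖A (f d - (2:ℝ) • f (d / 2) + f 0)‖ ≤ 36 * r * (3 * L ^ 2 * r) + 4 * (4 * L * r) * ‖d‖ ^ 2 / r ^ 2 := by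
    rw [← hnn]; exact SD
  have hq : 36 * r * (3 * L ^ 2 * r) + 4 * (4 * L * r) * ‖d‖ ^ 2 / r ^ 2 = (108 * L ^ 2 + 16 * L) * (t * s) := by
    rw [← ht, ← hst, hr]
    field_simp
    ring
  rw [hq] at SD'
  have := (hAl (f d - (2:ℝ) • f (d / 2) + f 0)).1
  have h9 : 0 ≤ t * s := by positivity
  have h10 : 0 ≤ L * (t * s) := by positivity
  nlinarith

theorem reg1 {n : ℕ} {f : ℂ → Cn n} {P : ℂ → Cn n →L[ℝ] Cn n} {ε L : ℝ} (h : Sol f P ε (ball 0 1))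
    (hε : ε ≤ 1) (hL : ∀ ζ ∈ ball (0:ℂ) 1, ‖fderiv ℝ f ζ 1‖ ≤ L) {z : ℂ} (hz : ‖z‖ < 1) :
    ‖f z - f 0 - fderiv ℝ f 0 z‖ ≤ 1000 * (L ^ 2 + L) * (‖z‖ * cbrt ‖z‖) := by
  have h0 : (0:ℂ) ∈ ball (0:ℂ) 1 := by simp
  have hL0 : 0 ≤ L := (norm_nonneg _).trans (hL 0 h0)
  set e : ℂ → Cn n := fun z => f z - f 0 - fderiv ℝ f 0 z with he
  set C := 1000 * (L ^ 2 + L) with hC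
  have hC0 : 0 ≤ C := by positivity
  change ‖e z‖ ≤ _
  by_cases hz8 : 1 / 8 < ‖z‖
  · have h1 := h.lipf (convex_ball 0 1) hL h0 (show z ∈ ball (0:ℂ) 1 by simpa using hz)
    have h2 := rlin_norm _ (h.near 0 h0) (h.eq 0 h0)
    have h3 := (fderiv ℝ f 0).le_opNorm z
    have h4 := hL 0 h0
    have h5 : ‖fderiv ℝ f 0 z‖ ≤ 3 * L * ‖z‖ := by
      refine h3.trans ?_
      gcongr
      linarith
    have h6 : 1 / 2 ≤ cbrt ‖z‖ := by
      apply le_of_pow_le_pow_left₀ (n := 3) (by norm_num) (cbrt_nonneg (norm_nonneg _))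
      rw [cbrt_pow (norm_nonneg _)]; norm_num; linarith
    have h7 : ‖e z‖ ≤ 6 * L * ‖z‖ := by
      have := norm_sub_le (f z - f 0) (fderiv ℝ f 0 z)
      simp only [sub_zero] at h1
      simp only [he]
      linarith
    have h8 : 6 * L * ‖z‖ ≤ C * ‖z‖ * (1 / 2) := by
      have : 0 ≤ L * ‖z‖ := by positivity
      have : 0 ≤ L ^ 2 * ‖z‖ := by positivity
      rw [hC]; nlinarith
    calc ‖e z‖ ≤ C * ‖z‖ * (1 / 2) := h7.trans h8
      _ ≤ C * ‖z‖ * cbrt ‖z‖ := by gcongr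
      _ = C * (‖z‖ * cbrt ‖z‖) := by ring
  · push Not at hz8
    have step : ∀ w : ℂ, ‖w‖ ≤ 1 / 8 → ‖e w‖ ≤ 2 * ‖e (w / 2)‖ + C / 5 * (‖w‖ * cbrt ‖w‖) := by
      intro w hw
      by_cases hw0 : w = 0
      · simp [hw0, he]
      have h1 := reg1_step h hε hL hw0 hw
      have h2 : f w - (2:ℝ) • f (w / 2) + f 0 = e w - (2:ℝ) • e (w / 2) := by
        have : fderiv ℝ f 0 w = (2:ℝ) • fderiv ℝ f 0 (w / 2) := by
          rw [← (fderiv ℝ f 0).map_smul]; congr 1; simp; ring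
        simp only [he, this]
        module
      rw [h2] at h1
      have h3 : ‖e w‖ ≤ ‖e w - (2:ℝ) • e (w / 2)‖ + ‖(2:ℝ) • e (w / 2)‖ := by
        have := norm_add_le (e w - (2:ℝ) • e (w / 2)) ((2:ℝ) • e (w / 2))
        simpa using this
      rw [norm_smul] at h3
      have h4 : 0 ≤ ‖w‖ * cbrt ‖w‖ := mul_nonneg (norm_nonneg _) (cbrt_nonneg (norm_nonneg _))
      have h5 : 0 ≤ (L ^ 2 + L) * (‖w‖ * cbrt ‖w‖) := by positivity
      simp only [Real.norm_ofNat] at h3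
      rw [hC]
      nlinarith
    have iter : ∀ k : ℕ, ∀ w : ℂ, ‖w‖ ≤ 1 / 8 → ‖e w‖ ≤ C * (‖w‖ * cbrt ‖w‖) + 2 ^ k * ‖e (w / 2 ^ k)‖ := by
      intro k
      induction k with
      | zero =>
        intro w _
        have h4 : 0 ≤ ‖w‖ * cbrt ‖w‖ := mul_nonneg (norm_nonneg _) (cbrt_nonneg (norm_nonneg _))
        simp only [pow_zero, div_one, one_mul]
        nlinarith
      | succ k ih =>
        intro w hw
        have hw2 : ‖w / 2‖ = ‖w‖ / 2 := by simp
        have h1 := step w hw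
        have h2 := ih (w / 2) (by rw [hw2]; linarith [norm_nonneg w])
        rw [hw2, div_div, ← pow_succ'] at h2
        have h3 := cbrt_half (norm_nonneg w)
        have h4 : ‖w‖ / 2 * cbrt (‖w‖ / 2) ≤ ‖w‖ / 2 * (4 / 5 * cbrt ‖w‖) := by gcongr
        have h5 := mul_le_mul_of_nonneg_left h4 hC0
        rw [pow_succ' (2:ℝ)]
        linarith
    have hlim : Tendsto (fun k : ℕ => (2:ℝ) ^ k * ‖e (z / 2 ^ k)‖) atTop (𝓝 0) := by
      have ho := (h.diff 0 h0).hasFDerivAt.isLittleO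
      have hseq : Tendsto (fun k : ℕ => z / 2 ^ k) atTop (𝓝 0) := by
        have h1 : Tendsto (fun k : ℕ => z * (1 / 2 : ℂ) ^ k) atTop (𝓝 (z * 0)) := by
          apply Filter.Tendsto.const_mul
          apply tendsto_pow_atTop_nhds_zero_of_norm_lt_one
          norm_num
        rw [mul_zero] at h1
        refine h1.congr (fun k => ?_)
        rw [one_div, inv_pow, div_eq_mul_inv]
      have h2 := ho.comp_tendsto hseq
      have h3 : (fun k : ℕ => e (z / 2 ^ k)) =o[atTop] (fun k : ℕ => (1 / 2 : ℝ) ^ k) := by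
        have h4 : (fun k : ℕ => e (z / 2 ^ k)) =o[atTop] (fun k : ℕ => z / 2 ^ k) := by
          refine h2.congr (fun k => ?_) (fun k => ?_)
          · simp [he]
          · simp
        refine h4.trans_isBigO ?_
        apply Asymptotics.IsBigO.of_bound ‖z‖
        filter_upwards with k
        simp [div_eq_mul_inv]
      have h5 := h3.norm_left.tendsto_div_nhds_zero
      refine h5.congr (fun k => ?_)
      rw [one_div, inv_pow, div_inv_eq_mul, mul_comm]
    have h9 : Tendsto (fun k : ℕ => C * (‖z‖ * cbrt ‖z‖) + (2:ℝ) ^ k * ‖e (z / 2 ^ k)‖) atTop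
        (𝓝 (C * (‖z‖ * cbrt ‖z‖) + 0)) := hlim.const_add _
    rw [add_zero] at h9
    exact ge_of_tendsto' h9 (fun k => iter k z hz8)

theorem fderiv_scale {n : ℕ} {f : ℂ → Cn n} {c a : ℝ} {z ζ : ℂ} (hd : DifferentiableAt ℝ f (z + a * ζ)) :
    HasFDerivAt (fun ζ : ℂ => c • f (z + a * ζ)) ((c * a) • fderiv ℝ f (z + a * ζ)) ζ := by
  have h1 : HasFDerivAt (fun ζ : ℂ => z + a * ζ) (a • ContinuousLinearMap.id ℝ ℂ) ζ := by
    have := ((a • ContinuousLinearMap.id ℝ ℂ).hasFDerivAt (x := ζ)).const_add z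
    refine this.congr_of_eventuallyEq (Filter.Eventually.of_forall fun w => ?_)
    simp
  have h2 := (hd.hasFDerivAt.comp ζ h1).const_smul c
  refine h2.congr_fderiv ?_
  ext w
  simp [smul_smul]

theorem Sol.scale {n : ℕ} {f : ℂ → Cn n} {P : ℂ → Cn n →L[ℝ] Cn n} {ε : ℝ} {D D' : Set ℂ} (h : Sol f P ε D)
    {c a : ℝ} (hc : 0 < c) {z : ℂ} (hD : ∀ ζ ∈ D', z + a * ζ ∈ D) :
    Sol (fun ζ : ℂ => c • f (z + a * ζ)) (fun ζ => P (z + a * ζ)) (ε / c) D' := by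
  constructor
  · intro ζ hζ
    exact (fderiv_scale (h.diff _ (hD ζ hζ))).differentiableAt
  · intro ζ hζ
    rw [(fderiv_scale (h.diff _ (hD ζ hζ))).fderiv]
    simp [h.eq _ (hD ζ hζ)]
  · intro ζ hζ
    exact h.near _ (hD ζ hζ)
  · intro ζ hζ
    exact h.sq _ (hD ζ hζ)
  · intro ζ hζ ξ hξ
    have := h.lip _ (hD ζ hζ) _ (hD ξ hξ)
    rw [← smul_sub, norm_smul, Real.norm_eq_abs, abs_of_pos hc]
    calc _ ≤ _ := this
      _ = _ := by field_simp

/-- universal small constant -/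
noncomputable def dl0 : ℝ := 1 / (8 * 40000 ^ 3)

theorem dl0_pos : 0 < dl0 := by unfold dl0; positivity

theorem cbrt_cube {t : ℝ} (ht : 0 ≤ t) : cbrt (t ^ 3) = t := by
  have h1 := cbrt_nonneg (show 0 ≤ t ^ 3 by positivity)
  have h2 := cbrt_pow (show 0 ≤ t ^ 3 by positivity)
  exact pow_left_injective₀ h1 ht h2
where
  pow_left_injective₀ {a b : ℝ} (ha : 0 ≤ a) (hb : 0 ≤ b) (h : a ^ 3 = b ^ 3) : a = b :=
    (pow_left_inj₀ ha hb (by norm_num)).1 h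

theorem grad_unit {n : ℕ} {f : ℂ → Cn n} {P : ℂ → Cn n →L[ℝ] Cn n} {ε : ℝ} (h : Sol f P ε (ball 0 1))
    (hε : ε ≤ 1) (hB : ∃ B, ∀ z : ℂ, ‖z‖ ≤ 1 / 2 → ‖fderiv ℝ f z 1‖ ≤ B)
    (ho : ∀ z : ℂ, ‖z‖ < 1 → ‖f z - f 0‖ ≤ dl0) : ‖fderiv ℝ f 0 1‖ ≤ 8 := by
  by_contra hcon
  push Not at hcon
  obtain ⟨B, hB⟩ := hB
  have hB0 : 0 ≤ B := (norm_nonneg _).trans (hB 0 (by simp))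
  set φ : ℂ → ℝ := fun z => (1 / 2 - ‖z‖) * ‖fderiv ℝ f z 1‖ with hφ
  set S := φ '' closedBall 0 (1 / 2) with hS
  have hbdd : BddAbove S := by
    refine ⟨B, ?_⟩
    rintro _ ⟨z, hz, rfl⟩
    have hz' : ‖z‖ ≤ 1 / 2 := by simpa using hz
    have := hB z hz'
    simp only [hφ]
    have h1 : 1 / 2 - ‖z‖ ≤ 1 := by linarith [norm_nonneg z]
    calc (1 / 2 - ‖z‖) * ‖fderiv ℝ f z 1‖ ≤ 1 * B := by
          apply mul_le_mul h1 this (norm_nonneg _) (by norm_num)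
      _ = B := one_mul B
  set M := sSup S with hM
  have h0S : φ 0 ∈ S := ⟨0, by simp, rfl⟩
  have hM4 : 4 < M := by
    have h1 := le_csSup hbdd h0S
    have : φ 0 = 1 / 2 * ‖fderiv ℝ f 0 1‖ := by simp [hφ]
    linarith
  obtain ⟨_, ⟨z, hz, rfl⟩, hzM⟩ := exists_lt_of_lt_csSup ⟨_, h0S⟩ (show M / 2 < sSup S by linarith)
  have hz' : ‖z‖ ≤ 1 / 2 := by simpa using hz
  set m := ‖fderiv ℝ f z 1‖ with hm
  set ρ := (1 / 2 - ‖z‖) / 2 with hρ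
  have hφz : φ z = 2 * ρ * m := by simp only [hφ, hρ, hm]; ring
  rw [hφz] at hzM
  have hm0 : 0 ≤ m := norm_nonneg _
  have hρ0 : 0 ≤ ρ := by rw [hρ]; linarith
  have hρm : 1 < ρ * m := by nlinarith
  have hmp : 0 < m := by
    rcases hm0.lt_or_eq with h | h
    · exact h
    · rw [← h] at hρm; linarith
  have hρp : 0 < ρ := by
    rcases hρ0.lt_or_eq with h | h
    · exact h
    · rw [← h] at hρm; linarith
  have hmρ : m⁻¹ ≤ ρ := by
    rw [inv_le_iff_one_le_mul₀ hmp]; exact hρm.le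
  have hin : ∀ ζ ∈ ball (0:ℂ) 1, ‖z + ((m⁻¹ : ℝ):ℂ) * ζ‖ ≤ ‖z‖ + ρ := by
    intro ζ hζ
    have hζ' : ‖ζ‖ < 1 := by simpa using hζ
    have h1 := norm_add_le z (((m⁻¹ : ℝ):ℂ) * ζ)
    rw [norm_mul, Complex.norm_real, Real.norm_eq_abs, abs_of_pos (inv_pos.2 hmp)] at h1
    have : m⁻¹ * ‖ζ‖ ≤ ρ * 1 := mul_le_mul hmρ hζ'.le (norm_nonneg _) hρ0
    linarith
  have hsum : ‖z‖ + ρ ≤ 1 / 2 - ρ := by rw [hρ]; linarith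
  have hinD : ∀ ζ ∈ ball (0:ℂ) 1, z + ((m⁻¹ : ℝ):ℂ) * ζ ∈ ball (0:ℂ) 1 := by
    intro ζ hζ
    have := hin ζ hζ
    rw [mem_ball, dist_zero_right]; linarith
  have hF := h.scale (c := 1) (a := m⁻¹) (z := z) one_pos hinD
  have hFd : ∀ ζ ∈ ball (0:ℂ) 1, fderiv ℝ (fun ζ : ℂ => (1:ℝ) • f (z + ((m⁻¹ : ℝ):ℂ) * ζ)) ζ 1
      = m⁻¹ • fderiv ℝ f (z + ((m⁻¹ : ℝ):ℂ) * ζ) 1 := by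
    intro ζ hζ
    rw [(fderiv_scale (h.diff _ (hinD ζ hζ))).fderiv]; simp
  have hFL : ∀ ζ ∈ ball (0:ℂ) 1, ‖fderiv ℝ (fun ζ : ℂ => (1:ℝ) • f (z + ((m⁻¹ : ℝ):ℂ) * ζ)) ζ 1‖ ≤ 4 := by
    intro ζ hζ
    rw [hFd ζ hζ, norm_smul, Real.norm_eq_abs, abs_of_pos (inv_pos.2 hmp)]
    set w := z + ((m⁻¹ : ℝ):ℂ) * ζ with hw
    have h1 := hin ζ hζ
    have h2 : φ w ≤ M := le_csSup hbdd ⟨w, by simp; linarith, rfl⟩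
    have h3 : ρ * ‖fderiv ℝ f w 1‖ ≤ φ w := by
      simp only [hφ]
      gcongr
      linarith
    have h4 : ρ * ‖fderiv ℝ f w 1‖ ≤ ρ * (4 * m) := by linarith
    have h5 := le_of_mul_le_mul_left h4 hρp
    rw [inv_mul_le_iff₀ hmp]; linarith
  have R := reg1 (z := ((1 / 40000 ^ 3 : ℝ) : ℂ)) hF (by simpa using hε) hFL (by
    rw [Complex.norm_real]; norm_num)
  have h00 : (0:ℂ) ∈ ball (0:ℂ) 1 := by simp
  have hs : ‖((1 / 40000 ^ 3 : ℝ) : ℂ)‖ = (1 / 40000) ^ 3 := by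
    rw [Complex.norm_real, Real.norm_eq_abs, abs_of_pos (by positivity)]; norm_num
  rw [hs, cbrt_cube (by norm_num)] at R
  have hlin : fderiv ℝ (fun ζ : ℂ => (1:ℝ) • f (z + ((m⁻¹ : ℝ):ℂ) * ζ)) 0 ((1 / 40000 ^ 3 : ℝ) : ℂ)
      = (1 / 40000 ^ 3 : ℝ) • fderiv ℝ (fun ζ : ℂ => (1:ℝ) • f (z + ((m⁻¹ : ℝ):ℂ) * ζ)) 0 1 := by
    rw [← ContinuousLinearMap.map_smul]; simp
  rw [hlin, hFd 0 h00] at R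
  simp only [one_smul, mul_zero, add_zero] at R
  set w := z + ((m⁻¹ : ℝ):ℂ) * ((1 / 40000 ^ 3 : ℝ) : ℂ) with hw
  have hw1 : ‖w‖ < 1 := by
    have := hinD ((1 / 40000 ^ 3 : ℝ) : ℂ) (by rw [mem_ball, dist_zero_right, hs]; norm_num)
    rwa [mem_ball, dist_zero_right] at this
  have o1 := ho w hw1
  have o2 := ho z (by linarith)
  have o3 : ‖f w - f z‖ ≤ 2 * dl0 := by
    have := norm_sub_le (f w - f 0) (f z - f 0)
    rw [sub_sub_sub_cancel_right] at this
    linarith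
  set V := (1 / 40000 ^ 3 : ℝ) • m⁻¹ • fderiv ℝ f z 1 with hV
  have hVn : ‖V‖ = 1 / 40000 ^ 3 := by
    rw [hV, norm_smul, norm_smul, ← hm, Real.norm_eq_abs, Real.norm_eq_abs, abs_of_pos (inv_pos.2 hmp), inv_mul_cancel₀ hmp.ne',
      abs_of_pos (by positivity), mul_one]
  have o4 : ‖V‖ ≤ ‖f w - f z‖ + ‖f w - f z - V‖ := by
    have := norm_sub_le (f w - f z) (f w - f z - V)
    simpa using this
  rw [hVn] at o4
  unfold dl0 at o3
  norm_num at *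
  linarith

theorem grad_est {n : ℕ} {f : ℂ → Cn n} {P : ℂ → Cn n →L[ℝ] Cn n} {ε m ρ : ℝ} {z0 : ℂ} (hρ : 0 < ρ) (h : Sol f P ε (ball z0 ρ))
    (hm : 0 < m) (hε : ε * m ≤ dl0) (hB : ∃ B, ∀ z : ℂ, ‖z - z0‖ ≤ ρ / 2 → ‖fderiv ℝ f z 1‖ ≤ B)
    (ho : ∀ z : ℂ, ‖z - z0‖ < ρ → ‖f z - f z0‖ ≤ m) : ‖fderiv ℝ f z0 1‖ ≤ 8 / dl0 * m / ρ := by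
  have hδ := dl0_pos
  have hin : ∀ ζ ∈ ball (0:ℂ) 1, z0 + (ρ:ℂ) * ζ ∈ ball z0 ρ := by
    intro ζ hζ
    have hζ' : ‖ζ‖ < 1 := by simpa using hζ
    rw [mem_ball, dist_eq_norm, add_sub_cancel_left, norm_mul, Complex.norm_real, Real.norm_eq_abs, abs_of_pos hρ]
    nlinarith
  have hF := h.scale (c := dl0 / m) (a := ρ) (z := z0) (by positivity) hin
  have hFd : ∀ ζ ∈ ball (0:ℂ) 1, fderiv ℝ (fun ζ : ℂ => (dl0 / m) • f (z0 + (ρ:ℂ) * ζ)) ζ 1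
      = (dl0 / m * ρ) • fderiv ℝ f (z0 + (ρ:ℂ) * ζ) 1 := by
    intro ζ hζ
    rw [(fderiv_scale (h.diff _ (hin ζ hζ))).fderiv]; simp
  have hpos : 0 < dl0 / m * ρ := by positivity
  have G := grad_unit hF (by
      rw [div_div_eq_mul_div, div_le_one hδ]; exact hε)
    (by
      obtain ⟨B, hB⟩ := hB
      refine ⟨dl0 / m * ρ * B, ?_⟩
      intro z hz
      rw [hFd z (by rw [mem_ball, dist_zero_right]; linarith), norm_smul, Real.norm_eq_abs, abs_of_pos hpos]
      gcongr
      apply hB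
      rw [add_sub_cancel_left, norm_mul, Complex.norm_real, Real.norm_eq_abs, abs_of_pos hρ]
      nlinarith)
    (by
      intro z hz
      have := ho (z0 + ρ * z) (by
        have := hin z (by simpa using hz)
        rwa [mem_ball, dist_eq_norm] at this)
      simp only [mul_zero, add_zero]
      rw [← smul_sub, norm_smul, Real.norm_eq_abs, abs_of_pos (by positivity)]
      calc dl0 / m * ‖f (z0 + ρ * z) - f z0‖ ≤ dl0 / m * m := by gcongr
        _ = dl0 := by field_simp)
  rw [hFd 0 (by simp), norm_smul, Real.norm_eq_abs, abs_of_pos hpos] at G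
  simp only [mul_zero, add_zero] at G
  rw [le_div_iff₀ hρ, div_mul_eq_mul_div, le_div_iff₀ hδ]
  have : dl0 / m * ρ * ‖fderiv ℝ f z0 1‖ * m = dl0 * ρ * ‖fderiv ℝ f z0 1‖ := by field_simp
  nlinarith

theorem bounded_of_locally {K : Set ℂ} (hK : IsCompact K) (g : ℂ → ℝ)
    (h : ∀ z ∈ K, ∃ r > 0, ∃ B, ∀ w ∈ ball z r, g w ≤ B) : ∃ B, ∀ w ∈ K, g w ≤ B := by
  apply hK.induction_on (p := fun s => ∃ B, ∀ w ∈ s, g w ≤ B)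
  · exact ⟨0, by simp⟩
  · rintro s t hst ⟨B, hB⟩
    exact ⟨B, fun w hw => hB w (hst hw)⟩
  · rintro s t ⟨B, hB⟩ ⟨B', hB'⟩
    refine ⟨max B B', ?_⟩
    rintro w (hw | hw)
    · exact (hB w hw).trans (le_max_left _ _)
    · exact (hB' w hw).trans (le_max_right _ _)
  · intro z hz
    obtain ⟨r, hr, B, hB⟩ := h z hz
    exact ⟨ball z r, mem_nhdsWithin_of_mem_nhds (ball_mem_nhds z hr), B, hB⟩

theorem locally_bounded_deriv {n : ℕ} {f : ℂ → Cn n} {P : ℂ → Cn n →L[ℝ] Cn n} {ε : ℝ} {U : Set ℂ}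
    (hU : IsOpen U) (h : Sol f P ε U) :
    ∀ z ∈ U, ∃ r > 0, ∃ B, ∀ w ∈ ball z r, ‖fderiv ℝ f w 1‖ ≤ B := by
  by_contra hcon
  push Not at hcon
  obtain ⟨z1, hz1U, hz1⟩ := hcon
  set good : Set ℂ := {z | ∃ r > 0, ∃ B, ∀ w ∈ ball z r, ‖fderiv ℝ f w 1‖ ≤ B} with hgood
  have hgo : IsOpen good := by
    rw [Metric.isOpen_iff]
    rintro z ⟨r, hr, B, hB⟩
    refine ⟨r, hr, ?_⟩
    intro w hw
    refine ⟨r - dist w z, by simpa using hw, B, ?_⟩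
    intro u hu
    apply hB
    rw [mem_ball] at *
    linarith [dist_triangle u w z]
  set Q : Set ℂ := U \ good with hQ
  have hz1Q : z1 ∈ Q := by
    refine ⟨hz1U, ?_⟩
    rintro ⟨r, hr, B, hB⟩
    obtain ⟨w, hw, hw2⟩ := hz1 r hr B
    exact absurd (hB w hw) (not_le.2 hw2)
  have hlc : IsLocallyClosed Q := by
    rw [hQ, Set.diff_eq]
    exact hU.isLocallyClosed.inter hgo.isClosed_compl.isLocallyClosed
  haveI : LocallyCompactSpace Q := hlc.locallyCompactSpace
  haveI : Nonempty Q := ⟨⟨z1, hz1Q⟩⟩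
  set E : ℕ → Set Q := fun k => {z | ∀ w : ℂ, ‖w - z‖ < 1 / ((k:ℝ) + 1) → ‖f w - f z‖ ≤ ((k:ℝ) + 1) * ‖w - z‖} with hE
  have hcont : ContinuousOn f U := fun z hz => (h.diff z hz).continuousAt.continuousWithinAt
  have hfQ : Continuous (fun z : Q => f z) := by
    have := hcont.mono (diff_subset : Q ⊆ U)
    exact continuousOn_iff_continuous_restrict.1 this
  have hEc : ∀ k, IsClosed (E k) := by
    intro k
    simp only [hE]
    rw [Set.setOf_forall]
    apply isClosed_iInter
    intro w
    have : {z : Q | ‖w - z‖ < 1 / ((k:ℝ) + 1) → ‖f w - f z‖ ≤ ((k:ℝ) + 1) * ‖w - z‖}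
        = {z : Q | 1 / ((k:ℝ) + 1) ≤ ‖w - z‖} ∪ {z : Q | ‖f w - f z‖ ≤ ((k:ℝ) + 1) * ‖w - z‖} := by
      ext z
      simp only [mem_setOf_eq, mem_union]
      rw [imp_iff_not_or, not_lt]
    rw [this]
    apply IsClosed.union
    · exact isClosed_le (by fun_prop) (by fun_prop)
    · exact isClosed_le (continuous_const.sub hfQ).norm (by fun_prop)
  have hEu : ⋃ k, E k = univ := by
    rw [eq_univ_iff_forall]
    intro z
    obtain ⟨C, hC⟩ := (h.diff z z.2.1).hasFDerivAt.isBigO_sub.bound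
    obtain ⟨r, hr, hr2⟩ := Metric.eventually_nhds_iff.1 hC
    obtain ⟨k, hk⟩ := exists_nat_gt (max C (1 / r))
    rw [mem_iUnion]
    refine ⟨k, ?_⟩
    intro w hw
    have h1 : C < k := (le_max_left _ _).trans_lt hk
    have h2 : 1 / r < k := (le_max_right _ _).trans_lt hk
    have hk0 : (0:ℝ) < k + 1 := by positivity
    have h3 : 1 / ((k:ℝ) + 1) < r := by
      rw [div_lt_iff₀ hr] at h2
      rw [div_lt_iff₀ hk0]; nlinarith
    have h4 := hr2 (show dist w z < r by rw [dist_eq_norm]; linarith)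
    refine h4.trans ?_
    gcongr
    linarith
  obtain ⟨k, ⟨x0, hx0⟩⟩ := nonempty_interior_of_iUnion_of_closed hEc hEu
  rw [mem_interior_iff_mem_nhds, Metric.mem_nhds_iff] at hx0
  obtain ⟨ρ1, hρ1, hsub⟩ := hx0
  obtain ⟨z0, hz0⟩ := x0
  obtain ⟨ρ2, hρ2, hsub2⟩ := Metric.isOpen_iff.1 hU z0 hz0.1
  have hδ := dl0_pos
  set κ : ℝ := (k:ℝ) + 1 with hκ
  have hκ1 : 1 ≤ κ := by rw [hκ]; linarith [Nat.cast_nonneg (α := ℝ) k]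
  have hκ0 : 0 < κ := by linarith
  set ρ3 := dl0 / (6 * κ * (|ε| + 1)) with hρ3
  have hρ30 : 0 < ρ3 := by positivity
  set ρ := min (min ρ1 ρ2) (min (1 / κ) ρ3) with hρ
  have hρ0 : 0 < ρ := by
    rw [hρ]
    exact lt_min (lt_min hρ1 hρ2) (lt_min (by positivity) hρ30)
  have r1 : ρ ≤ ρ1 := (min_le_left _ _).trans (min_le_left _ _)
  have r2 : ρ ≤ ρ2 := (min_le_left _ _).trans (min_le_right _ _)
  have r3 : ρ ≤ 1 / κ := (min_le_right _ _).trans (min_le_left _ _)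
  have r4 : ρ ≤ ρ3 := (min_le_right _ _).trans (min_le_right _ _)
  have hQE : ∀ p ∈ Q, ‖p - z0‖ < ρ → ∀ w : ℂ, ‖w - p‖ < 1 / κ → ‖f w - f p‖ ≤ κ * ‖w - p‖ := by
    intro p hp hp2
    have : (⟨p, hp⟩ : Q) ∈ E k := by
      apply hsub
      rw [mem_ball, Subtype.dist_eq, dist_eq_norm]
      exact lt_of_lt_of_le hp2 r1
    exact this
  apply hz0.2
  refine ⟨ρ / 4, by positivity, max κ (8 / dl0 * (6 * κ)), ?_⟩
  intro z hz
  rw [mem_ball, dist_eq_norm] at hz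
  by_cases hzQ : z ∈ Q
  · refine le_trans ?_ (le_max_left _ _)
    have h1 := hQE z hzQ (by linarith)
    have h2 : ‖fderiv ℝ f z‖ ≤ κ := by
      apply (h.diff z hzQ.1).hasFDerivAt.le_of_lip' hκ0.le
      filter_upwards [Metric.ball_mem_nhds z (show 0 < 1 / κ by positivity)] with w hw
      exact h1 w (by rwa [mem_ball, dist_eq_norm] at hw)
    have h3 := (fderiv ℝ f z).le_of_opNorm_le h2 1
    simpa using h3
  · refine le_trans ?_ (le_max_right _ _)
    have hzU : z ∈ U := hsub2 (by rw [mem_ball, dist_eq_norm]; linarith)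
    have hzg : z ∈ good := by
      by_contra hh
      exact hzQ ⟨hzU, hh⟩
    have hne : Q.Nonempty := ⟨z0, hz0⟩
    set d := infDist z Q with hd
    have hd1 : d < ρ / 4 := by
      have := infDist_le_dist_of_mem (x := z) hz0
      rw [dist_eq_norm] at this
      linarith
    have hd0 : 0 < d := by
      obtain ⟨η, hη, hη2⟩ := Metric.isOpen_iff.1 hgo z hzg
      have : η ≤ d := by
        rw [hd, le_infDist hne]
        intro y hy
        by_contra hlt
        push Not at hlt
        exact hy.2 (hη2 (by rwa [mem_ball, dist_comm]))
      linarith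
    obtain ⟨p, hpQ, hp⟩ := (infDist_lt_iff (x := z) (r := 2 * d) hne).1 (by rw [← hd]; linarith)
    rw [dist_eq_norm] at hp
    have hp2 : ‖p - z0‖ < ρ := by
      have := norm_sub_le_norm_sub_add_norm_sub p z z0
      rw [norm_sub_rev p z] at this
      linarith
    have hpE := hQE p hpQ hp2
    have hballU : ball z d ⊆ U := by
      intro w hw
      apply hsub2
      rw [mem_ball, dist_eq_norm] at *
      have := norm_sub_le_norm_sub_add_norm_sub w z z0
      linarith
    have hballg : ∀ w, ‖w - z‖ < d → w ∈ good := by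
      intro w hw
      by_contra hh
      have hwQ : w ∈ Q := ⟨hballU (by rwa [mem_ball, dist_eq_norm]), hh⟩
      have := infDist_le_dist_of_mem (x := z) hwQ
      rw [dist_comm, dist_eq_norm] at this
      linarith
    have hS : Sol f P ε (ball z d) := ⟨fun ζ hζ => h.diff ζ (hballU hζ), fun ζ hζ => h.eq ζ (hballU hζ),
      fun ζ hζ => h.near ζ (hballU hζ), fun ζ hζ => h.sq ζ (hballU hζ),
      fun ζ hζ ξ hξ => h.lip ζ (hballU hζ) ξ (hballU hξ)⟩
    have key := grad_est (m := 6 * κ * d) hd0 hS (by positivity) (by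
        have h1 : d ≤ ρ3 := by linarith
        have h2 : ε ≤ |ε| + 1 := by linarith [le_abs_self ε]
        calc ε * (6 * κ * d) ≤ (|ε| + 1) * (6 * κ * ρ3) := by gcongr
          _ = dl0 := by rw [hρ3]; field_simp)
      (by
        obtain ⟨B, hB⟩ := bounded_of_locally (isCompact_closedBall z (d / 2)) (fun w => ‖fderiv ℝ f w 1‖) (by
          intro w hw
          exact hballg w (by rw [mem_closedBall, dist_eq_norm] at hw; linarith))
        exact ⟨B, fun w hw => hB w (by rwa [mem_closedBall, dist_eq_norm])⟩)
      (by
        intro w hw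
        have h1 : ‖w - p‖ ≤ 3 * d := by
          have := norm_sub_le_norm_sub_add_norm_sub w z p
          linarith
        have h2 := hpE w (by linarith)
        have h3 := hpE z (by linarith)
        have h4 := norm_sub_le (f w - f p) (f z - f p)
        rw [sub_sub_sub_cancel_right] at h4
        have h5 : κ * ‖w - p‖ ≤ κ * (3 * d) := by gcongr
        have h6 : κ * ‖z - p‖ ≤ κ * (2 * d) := by gcongr
        have : 0 ≤ κ * d := by positivity
        linarith)
    refine key.trans (le_of_eq ?_)
    field_simp

/-- gradient estimate, final form -/
theorem grad_fin {n : ℕ} {f : ℂ → Cn n} {P : ℂ → Cn n →L[ℝ] Cn n} {ε m ρ : ℝ} {z0 : ℂ} (hρ : 0 < ρ) (h : Sol f P ε (ball z0 ρ))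
    (hm : 0 < m) (hε : ε * m ≤ dl0)
    (ho : ∀ z : ℂ, ‖z - z0‖ < ρ → ‖f z - f z0‖ ≤ m) : ‖fderiv ℝ f z0 1‖ ≤ 8 / dl0 * m / ρ := by
  apply grad_est hρ h hm hε _ ho
  have := locally_bounded_deriv isOpen_ball h
  obtain ⟨B, hB⟩ := bounded_of_locally (isCompact_closedBall z0 (ρ / 2)) (fun w => ‖fderiv ℝ f w 1‖) (by
    intro w hw
    apply this
    rw [mem_closedBall] at hw; rw [mem_ball]; linarith)
  exact ⟨B, fun w hw => hB w (by rwa [mem_closedBall, dist_eq_norm])⟩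

/-- An almost complex structure close to the standard one on the ball of radius two. -/
structure Good {n : ℕ} (J : Cn n → Cn n →L[ℝ] Cn n) (ε : ℝ) : Prop where
  sq : ∀ x ∈ ball (0 : Cn n) 2, ∀ v, J x (J x v) = -v
  near : ∀ x ∈ ball (0 : Cn n) 2, ‖J x - Jstd n‖ ≤ ε
  diff : ∀ x ∈ ball (0 : Cn n) 2, DifferentiableAt ℝ J x
  lip : ∀ x ∈ ball (0 : Cn n) 2, ∀ y ∈ ball (0 : Cn n) 2, ‖J x - J y‖ ≤ ε * ‖x - y‖
  dlip : ∀ x ∈ ball (0 : Cn n) 2, ∀ y ∈ ball (0 : Cn n) 2, ‖fderiv ℝ J x - fderiv ℝ J y‖ ≤ ε * ‖x - y‖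
  pos : 0 < ε
  le : ε ≤ dl0 / 100

theorem dl0_le : dl0 ≤ 1 / 100 := by unfold dl0; norm_num

theorem Good.le' {n : ℕ} {J : Cn n → Cn n →L[ℝ] Cn n} {ε : ℝ} (hJ : Good J ε) : ε ≤ 1 / 10000 := by
  have := hJ.le; have := dl0_le; linarith

theorem ball12 {n : ℕ} {x : Cn n} (h : x ∈ ball (0 : Cn n) 1) : x ∈ ball (0 : Cn n) 2 :=
  ball_subset_ball (by norm_num) h

theorem JHol_apply {n : ℕ} {J : Cn n → Cn n →L[ℝ] Cn n} {f : ℂ → Cn n} {ζ : ℂ}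
    (h : (fderiv ℝ f ζ).comp JstdC = (J (f ζ)).comp (fderiv ℝ f ζ)) :
    fderiv ℝ f ζ I = J (f ζ) (fderiv ℝ f ζ 1) := by
  have h1 := congrArg (fun L => L 1) h
  simpa [JstdC] using h1

theorem JHol_of_apply {n : ℕ} {P : Cn n →L[ℝ] Cn n} {L : ℂ →L[ℝ] Cn n} (hP : ∀ v, P (P v) = -v)
    (h : L I = P (L 1)) : L.comp JstdC = P.comp L := by
  ext w
  have e1 : (L.comp JstdC) w = L (I * w) := by simp [JstdC]
  rw [e1, ContinuousLinearMap.comp_apply, rlin_apply' L w, rlin_apply' L (I * w), h, map_add, map_smul, map_smul, hP]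
  simp
  abel_nf

theorem disc_sol {n : ℕ} {J : Cn n → Cn n →L[ℝ] Cn n} {ε : ℝ} (hJ : Good J ε) {f : ℂ → Cn n} {D : Set ℂ}
    (hm : MapsTo f D (ball 0 2)) (hf : JHolOn J f D) : Sol f (fun ζ => J (f ζ)) ε D := by
  have := hJ.le'
  exact ⟨fun ζ hζ => (hf ζ hζ).1, fun ζ hζ => JHol_apply (hf ζ hζ).2,
    fun ζ hζ => (hJ.near _ (hm hζ)).trans (by linarith), fun ζ hζ => hJ.sq _ (hm hζ),
    fun ζ hζ ξ hξ => hJ.lip _ (hm hζ) _ (hm hξ)⟩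

theorem Sol.mono {n : ℕ} {f : ℂ → Cn n} {P : ℂ → Cn n →L[ℝ] Cn n} {ε : ℝ} {D D' : Set ℂ} (h : Sol f P ε D)
    (hD : D' ⊆ D) : Sol f P ε D' :=
  ⟨fun ζ hζ => h.diff ζ (hD hζ), fun ζ hζ => h.eq ζ (hD hζ),
      fun ζ hζ => h.near ζ (hD hζ), fun ζ hζ => h.sq ζ (hD hζ),
      fun ζ hζ ξ hξ => h.lip ζ (hD hζ) ξ (hD hξ)⟩

theorem JDisc.sol {n : ℕ} {J : Cn n → Cn n →L[ℝ] Cn n} {ε : ℝ} (hJ : Good J ε) {f : ℂ → Cn n}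
    (hf : JDisc J (ball 0 1) f) : Sol f (fun ζ => J (f ζ)) ε (ball 0 1) :=
  disc_sol hJ (fun _ hζ => ball12 (hf.1 hζ)) hf.2

noncomputable def Cg : ℝ := 16 / dl0

theorem Cg_pos : 0 < Cg := div_pos (by norm_num) dl0_pos

theorem ball_sub_unit {z0 : ℂ} {d : ℝ} (h : ‖z0‖ + d ≤ 1) : ball z0 d ⊆ ball (0:ℂ) 1 := by
  apply ball_subset_ball'
  rw [dist_zero_right]; linarith

theorem norm_sub_lt_two {n : ℕ} {x y : Cn n} (hx : x ∈ ball (0 : Cn n) 1) (hy : y ∈ ball (0 : Cn n) 1) : ‖x - y‖ ≤ 2 := by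
  have := norm_sub_le x y
  rw [mem_ball, dist_zero_right] at hx hy
  linarith

theorem disc_grad {n : ℕ} {J : Cn n → Cn n →L[ℝ] Cn n} {ε : ℝ} (hJ : Good J ε) {f : ℂ → Cn n}
    (hf : JDisc J (ball 0 1) f) {z0 : ℂ} {d : ℝ} (hd : 0 < d) (hz : ‖z0‖ + d ≤ 1) :
    ‖fderiv ℝ f z0 1‖ ≤ Cg / d := by
  have hS := (JDisc.sol hJ hf).mono (ball_sub_unit hz)
  have := grad_fin (m := 2) hd hS (by norm_num) (by linarith [hJ.le, dl0_pos]) (by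
    intro z hzz
    apply norm_sub_lt_two
    · apply hf.1
      exact ball_sub_unit hz (by rwa [mem_ball, dist_eq_norm])
    · apply hf.1
      exact ball_sub_unit hz (by simpa using hd))
  refine this.trans (le_of_eq ?_)
  unfold Cg; ring

noncomputable def Cr : ℝ := 1000 * (Cg ^ 2 + Cg)

theorem Cr_pos : 0 < Cr := by
  have := Cg_pos
  unfold Cr; positivity

theorem disc_rem {n : ℕ} {J : Cn n → Cn n →L[ℝ] Cn n} {ε : ℝ} (hJ : Good J ε) {f : ℂ → Cn n}
    (hf : JDisc J (ball 0 1) f) {z0 z : ℂ} {d : ℝ} (hd : 0 < d) (hz : ‖z0‖ + 2 * d ≤ 1) (hzd : ‖z - z0‖ < d) :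
    ‖f z - f z0 - fderiv ℝ f z0 (z - z0)‖ ≤ Cr * (‖z - z0‖ / d * cbrt (‖z - z0‖ / d)) := by
  have hS := (JDisc.sol hJ hf).mono (ball_sub_unit (z0 := z0) (d := d) (by linarith))
  have hin : ∀ ζ ∈ ball (0:ℂ) 1, z0 + (d:ℂ) * ζ ∈ ball z0 d := by
    intro ζ hζ
    have hζ' : ‖ζ‖ < 1 := by simpa using hζ
    rw [mem_ball, dist_eq_norm, add_sub_cancel_left, norm_mul, Complex.norm_real, Real.norm_eq_abs, abs_of_pos hd]
    nlinarith
  have hF := hS.scale (c := 1) (a := d) (z := z0) one_pos hin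
  have hFd : ∀ ζ ∈ ball (0:ℂ) 1, fderiv ℝ (fun ζ : ℂ => (1:ℝ) • f (z0 + (d:ℂ) * ζ)) ζ
      = d • fderiv ℝ f (z0 + (d:ℂ) * ζ) := by
    intro ζ hζ
    rw [(fderiv_scale (hS.diff _ (hin ζ hζ))).fderiv]; simp
  have hzz : ‖(z - z0) / d‖ = ‖z - z0‖ / d := by
    rw [norm_div, Complex.norm_real, Real.norm_eq_abs, abs_of_pos hd]
  have R := reg1 (L := Cg) (z := (z - z0) / d) hF (by simp; linarith [hJ.le']) (by
    intro ζ hζ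
    rw [hFd ζ hζ]
    have hw := hin ζ hζ
    rw [mem_ball, dist_eq_norm] at hw
    have h1 : ‖z0 + (d:ℂ) * ζ‖ ≤ ‖z0‖ + d := by
      have := norm_sub_norm_le (z0 + (d:ℂ) * ζ) z0
      linarith
    have := disc_grad hJ hf hd (z0 := z0 + (d:ℂ) * ζ) (by linarith)
    simp only [ContinuousLinearMap.smul_apply]
    rw [norm_smul, Real.norm_eq_abs, abs_of_pos hd]
    rw [le_div_iff₀ hd] at this
    linarith) (by rw [hzz, div_lt_one hd]; exact hzd)
  have hdc : (d:ℂ) ≠ 0 := by exact_mod_cast hd.ne'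
  have hback : z0 + (d:ℂ) * ((z - z0) / d) = z := by field_simp; ring
  rw [hFd 0 (by simp), hzz] at R
  simp only [hback, one_smul, mul_zero, add_zero, ContinuousLinearMap.smul_apply] at R
  rw [← ContinuousLinearMap.map_smul] at R
  have e : d • ((z - z0) / (d:ℂ)) = z - z0 := by
    rw [Complex.real_smul]; field_simp
  rw [e] at R
  exact R

theorem disc_norm_fderiv {n : ℕ} {J : Cn n → Cn n →L[ℝ] Cn n} {ε : ℝ} (hJ : Good J ε) {f : ℂ → Cn n}
    (hf : JDisc J (ball 0 1) f) {z0 : ℂ} {d : ℝ} (hd : 0 < d) (hz : ‖z0‖ + d ≤ 1) :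
    ‖fderiv ℝ f z0‖ ≤ 3 * (Cg / d) := by
  have hS := JDisc.sol hJ hf
  have hz0 : z0 ∈ ball (0:ℂ) 1 := by rw [mem_ball, dist_zero_right]; linarith
  exact (rlin_norm _ (hS.near z0 hz0) (hS.eq z0 hz0)).trans (by linarith [disc_grad hJ hf hd hz])

theorem ultra_lim {X E : Type*} [NormedAddCommGroup E] [ProperSpace E] (u : Ultrafilter X) (g : X → E) (R : ℝ)
    (h : ∀ᶠ x in (u : Filter X), ‖g x‖ ≤ R) : ∃ l, Tendsto g u (𝓝 l) := by
  obtain ⟨l, -, hl⟩ := (isCompact_closedBall (0:E) R).ultrafilter_le_nhds (u.map g) (by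
    rw [le_principal_iff]
    show g ⁻¹' _ ∈ (u : Filter X)
    filter_upwards [h] with x hx
    simpa using hx)
  exact ⟨l, hl⟩

def discSet {n : ℕ} (J : Cn n → Cn n →L[ℝ] Cn n) (ρ q : ℝ) : Set (Cn n × Cn n) :=
  {x | ∃ f : ℂ → Cn n, JDisc J (ball 0 1) f ∧ (∀ ζ ∈ ball (0:ℂ) 1, ‖f ζ‖ ≤ ρ) ∧ f 0 = x.1 ∧ fderiv ℝ f 0 1 = q⁻¹ • x.2}

theorem discSet_closed {n : ℕ} {J : Cn n → Cn n →L[ℝ] Cn n} {ε : ℝ} (hJ : Good J ε) {ρ q : ℝ} (hρ : ρ < 1) :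
    IsClosed (discSet J ρ q) := by
  haveI : ProperSpace (ℂ →L[ℝ] Cn n) := FiniteDimensional.proper ℝ _
  rw [isClosed_iff_ultrafilter]
  intro x u hu hs
  have hch : ∀ y : Cn n × Cn n, ∃ f : ℂ → Cn n, y ∈ discSet J ρ q → (JDisc J (ball 0 1) f ∧ (∀ ζ ∈ ball (0:ℂ) 1, ‖f ζ‖ ≤ ρ) ∧ f 0 = y.1 ∧ fderiv ℝ f 0 1 = q⁻¹ • y.2) := by
    intro y
    by_cases hy : y ∈ discSet J ρ q
    · obtain ⟨f, hf⟩ := hy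
      exact ⟨f, fun _ => hf⟩
    · exact ⟨0, fun h => absurd h hy⟩
  choose f hf using hch
  have hs' : ∀ᶠ y in (u : Filter (Cn n × Cn n)), y ∈ discSet J ρ q := hs
  have hlim1 : ∀ ζ : ℂ, ∃ l, ζ ∈ ball (0:ℂ) 1 → Tendsto (fun y => f y ζ) u (𝓝 l) := by
    intro ζ
    by_cases hζ : ζ ∈ ball (0:ℂ) 1
    · obtain ⟨l, hl⟩ := ultra_lim u (fun y => f y ζ) ρ (by
        filter_upwards [hs'] with y hy using (hf y hy).2.1 ζ hζ)
      exact ⟨l, fun _ => hl⟩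
    · exact ⟨0, fun h => absurd h hζ⟩
  choose g hg using hlim1
  have hlim2 : ∀ ζ : ℂ, ∃ l, ζ ∈ ball (0:ℂ) 1 → Tendsto (fun y => fderiv ℝ (f y) ζ) u (𝓝 l) := by
    intro ζ
    by_cases hζ : ζ ∈ ball (0:ℂ) 1
    · have hζ' : ‖ζ‖ < 1 := by simpa using hζ
      obtain ⟨l, hl⟩ := ultra_lim u (fun y => fderiv ℝ (f y) ζ) (3 * (Cg / (1 - ‖ζ‖))) (by
        filter_upwards [hs'] with y hy using disc_norm_fderiv hJ (hf y hy).1 (by linarith) (by linarith))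
      exact ⟨l, fun _ => hl⟩
    · exact ⟨0, fun h => absurd h hζ⟩
  choose L hL using hlim2
  have hgρ : ∀ ζ ∈ ball (0:ℂ) 1, ‖g ζ‖ ≤ ρ := by
    intro ζ hζ
    refine le_of_tendsto (hg ζ hζ).norm ?_
    filter_upwards [hs'] with y hy using (hf y hy).2.1 ζ hζ
  have hgm : MapsTo g (ball (0:ℂ) 1) (ball 0 1) := by
    intro ζ hζ
    have := hgρ ζ hζ
    simp; linarith
  have hgd : ∀ ζ ∈ ball (0:ℂ) 1, HasFDerivAt g (L ζ) ζ := by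
    intro z0 hz0
    have hz0' : ‖z0‖ < 1 := by simpa using hz0
    set d := (1 - ‖z0‖) / 2 with hd
    have hdp : 0 < d := by rw [hd]; linarith
    have hdd : ‖z0‖ + 2 * d ≤ 1 := by rw [hd]; linarith
    have key : ∀ z, ‖z - z0‖ < d → ‖g z - g z0 - L z0 (z - z0)‖ ≤ Cr * (‖z - z0‖ / d * cbrt (‖z - z0‖ / d)) := by
      intro z hz
      have hz1 : z ∈ ball (0:ℂ) 1 := ball_sub_unit (z0 := z0) (d := d) (by linarith) (by rwa [mem_ball, dist_eq_norm])
      have ht : Tendsto (fun y => f y z - f y z0 - fderiv ℝ (f y) z0 (z - z0)) u (𝓝 (g z - g z0 - L z0 (z - z0))) := by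
        refine ((hg z hz1).sub (hg z0 hz0)).sub ?_
        exact ((ContinuousLinearMap.apply ℝ (Cn n) (z - z0)).continuous.tendsto _).comp (hL z0 hz0)
      refine le_of_tendsto ht.norm ?_
      filter_upwards [hs'] with y hy using disc_rem hJ (hf y hy).1 hdp hdd hz
    rw [hasFDerivAt_iff_isLittleO, Asymptotics.isLittleO_iff]
    intro c hc
    have hcont : Tendsto (fun z : ℂ => Cr / d * cbrt (‖z - z0‖ / d)) (𝓝 z0) (𝓝 0) := by
      have : Continuous (fun z : ℂ => Cr / d * cbrt (‖z - z0‖ / d)) := by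
        have := continuous_cbrt
        have h2 : Continuous (fun z : ℂ => ‖z - z0‖ / d) := by fun_prop
        exact continuous_const.mul (this.comp h2)
      have h3 := this.tendsto z0
      simpa [cbrt_zero] using h3
    filter_upwards [ball_mem_nhds z0 hdp, hcont.eventually (gt_mem_nhds hc)] with z hz hzc
    rw [mem_ball, dist_eq_norm] at hz
    refine (key z hz).trans ?_
    have : Cr * (‖z - z0‖ / d * cbrt (‖z - z0‖ / d)) = Cr / d * cbrt (‖z - z0‖ / d) * ‖z - z0‖ := by ring
    rw [this]
    exact mul_le_mul_of_nonneg_right hzc.le (norm_nonneg _)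
  have h0 : (0:ℂ) ∈ ball (0:ℂ) 1 := by simp
  refine ⟨g, ⟨hgm, ?_⟩, hgρ, ?_, ?_⟩
  · intro ζ hζ
    have hx2 := ball12 (hgm hζ)
    refine ⟨(hgd ζ hζ).differentiableAt, ?_⟩
    rw [(hgd ζ hζ).fderiv]
    apply JHol_of_apply (hJ.sq _ hx2)
    have hJc : Tendsto (fun y => J (f y ζ)) u (𝓝 (J (g ζ))) :=
      ((hJ.diff _ hx2).continuousAt.tendsto).comp (hg ζ hζ)
    have hA : ∀ w : ℂ, Tendsto (fun y => fderiv ℝ (f y) ζ w) u (𝓝 (L ζ w)) := fun w =>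
      ((ContinuousLinearMap.apply ℝ (Cn n) w).continuous.tendsto _).comp (hL ζ hζ)
    have h1 : Tendsto (fun y => J (f y ζ) (fderiv ℝ (f y) ζ 1)) u (𝓝 (J (g ζ) (L ζ 1))) :=
      ((isBoundedBilinearMap_apply (𝕜 := ℝ) (E := Cn n) (F := Cn n)).continuous.tendsto (J (g ζ), L ζ 1)).comp (hJc.prodMk_nhds (hA 1))
    refine tendsto_nhds_unique (hA I) (h1.congr' ?_)
    filter_upwards [hs'] with y hy using (JHol_apply ((hf y hy).1.2 ζ hζ).2).symm
  · have h1 : Tendsto (fun y : Cn n × Cn n => y.1) u (𝓝 x.1) := (continuous_fst.tendsto x).mono_left hu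
    refine tendsto_nhds_unique (hg 0 h0) (h1.congr' ?_)
    filter_upwards [hs'] with y hy using (hf y hy).2.2.1.symm
  · rw [(hgd 0 h0).fderiv]
    have h1 : Tendsto (fun y : Cn n × Cn n => q⁻¹ • y.2) u (𝓝 (q⁻¹ • x.2)) :=
      ((continuous_snd.const_smul q⁻¹).tendsto x).mono_left hu
    have h2 : Tendsto (fun y => fderiv ℝ (f y) 0 1) u (𝓝 (L 0 1)) :=
      ((ContinuousLinearMap.apply ℝ (Cn n) (1:ℂ)).continuous.tendsto _).comp (hL 0 h0)
    refine tendsto_nhds_unique h2 (h1.congr' ?_)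
    filter_upwards [hs'] with y hy using (hf y hy).2.2.2.symm

theorem JDisc.shrink {n : ℕ} {J : Cn n → Cn n →L[ℝ] Cn n} {D : Set (Cn n)} {f : ℂ → Cn n}
    (hs : ∀ x ∈ D, ∀ v, J x (J x v) = -v)
    (hf : JDisc J D f) {t : ℝ} (ht : 0 < t) (ht1 : t ≤ 1) :
    JDisc J D (fun ζ => f (t * ζ)) ∧ fderiv ℝ (fun ζ : ℂ => f (t * ζ)) 0 1 = t • fderiv ℝ f 0 1 := by
  have hin : ∀ ζ ∈ ball (0:ℂ) 1, (t:ℂ) * ζ ∈ ball (0:ℂ) 1 := by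
    intro ζ hζ
    have hζ' : ‖ζ‖ < 1 := by simpa using hζ
    rw [mem_ball, dist_zero_right, norm_mul, Complex.norm_real, Real.norm_eq_abs, abs_of_pos ht]
    nlinarith [norm_nonneg ζ]
  have hd : ∀ ζ ∈ ball (0:ℂ) 1, HasFDerivAt (fun ζ : ℂ => f (t * ζ)) (t • fderiv ℝ f (t * ζ)) ζ := by
    intro ζ hζ
    have := fderiv_scale (f := f) (z := 0) (a := t) (c := 1) (ζ := ζ) (by rw [zero_add]; exact (hf.2 _ (hin ζ hζ)).1)
    simpa using this
  refine ⟨⟨fun ζ hζ => hf.1 (hin ζ hζ), fun ζ hζ => ⟨(hd ζ hζ).differentiableAt, ?_⟩⟩, ?_⟩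
  · rw [(hd ζ hζ).fderiv]
    have := (hf.2 _ (hin ζ hζ)).2
    rw [ContinuousLinearMap.smul_comp, this, ContinuousLinearMap.comp_smul]
  · rw [(hd 0 (by simp)).fderiv]; simp

def kobSet {n : ℕ} (J : Cn n → Cn n →L[ℝ] Cn n) (D : Set (Cn n)) (p v : Cn n) : Set ℝ :=
  {α : ℝ | 0 < α ∧ ∃ f : ℂ → Cn n, JDisc J D f ∧ f 0 = p ∧ fderiv ℝ f 0 1 = α⁻¹ • v}

theorem kobMetric_measurable {n : ℕ} {J : Cn n → Cn n →L[ℝ] Cn n} {ε : ℝ} (hJ : Good J ε)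
    (hne : ∀ p ∈ ball (0 : Cn n) 1, ∀ v, (kobSet J (ball 0 1) p v).Nonempty) :
    Measurable (fun x : Cn n × Cn n => (ball (0 : Cn n) 1 ×ˢ univ).indicator
      (fun x => kobMetric J (ball 0 1) x.1 x.2) x) := by
  have hbdd : ∀ p v, BddBelow (kobSet J (ball 0 1) p v) := fun p v => ⟨0, fun α hα => hα.1.le⟩
  have hnn : ∀ p v, 0 ≤ kobMetric J (ball 0 1) p v := fun p v => Real.sInf_nonneg fun α hα => hα.1.le
  set B : Set (Cn n × Cn n) := ball (0 : Cn n) 1 ×ˢ univ with hB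
  have hBm : MeasurableSet B := (isOpen_ball.prod isOpen_univ).measurableSet
  apply measurable_of_Iio
  intro c
  have key : (B.indicator (fun x : Cn n × Cn n => kobMetric J (ball 0 1) x.1 x.2)) ⁻¹' (Iio c)
      = (Bᶜ ∩ {x | 0 < c}) ∪ (B ∩ ⋃ (m : ℕ) (q : ℚ) (_ : 0 < (q:ℝ) ∧ (q:ℝ) < c), discSet J (1 - 1 / (m + 1)) q) := by
    ext x
    by_cases hx : x ∈ B
    · simp only [mem_preimage, indicator_of_mem hx, mem_Iio, mem_union, mem_inter_iff, mem_compl_iff, hx, not_true_eq_false, false_and, true_and, false_or, mem_iUnion]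
      constructor
      · intro h
        obtain ⟨α, hα, hαc⟩ := (csInf_lt_iff (hbdd _ _) (hne x.1 hx.1 x.2)).1 h
        obtain ⟨hα0, f, hf, hf0, hf1⟩ := hα
        obtain ⟨q, hq1, hq2⟩ := exists_rat_btwn hαc
        have hq0 : (0:ℝ) < q := hα0.trans hq1
        have ht : 0 < α / q := div_pos hα0 hq0
        have ht1 : α / q < 1 := (div_lt_one hq0).2 hq1
        obtain ⟨hs1, hs2⟩ := JDisc.shrink (fun x hx => hJ.sq x (ball12 hx)) hf ht ht1.le
        have hcpt : IsCompact (closedBall (0:ℂ) (α / q)) := isCompact_closedBall _ _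
        have hsub : closedBall (0:ℂ) (α / q) ⊆ ball 0 1 := closedBall_subset_ball ht1
        have hcont : ContinuousOn (fun z => ‖f z‖) (closedBall (0:ℂ) (α / q)) := fun z hz =>
          ((hf.2 z (hsub hz)).1.continuousAt.norm).continuousWithinAt
        obtain ⟨z, hz, hzmax⟩ := hcpt.exists_isMaxOn ⟨0, by simpa using ht.le⟩ hcont
        have hfz : ‖f z‖ < 1 := by simpa using hf.1 (hsub hz)
        obtain ⟨m, hm⟩ := exists_nat_one_div_lt (sub_pos.2 hfz)
        refine ⟨m, q, ⟨hq0, hq2⟩, _, hs1, ?_, by simpa using hf0, ?_⟩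
        · intro ζ hζ
          have hζ' : ‖ζ‖ < 1 := by simpa using hζ
          have : ((α / q : ℝ) : ℂ) * ζ ∈ closedBall (0:ℂ) (α / q) := by
            rw [mem_closedBall, dist_zero_right, norm_mul, Complex.norm_real, Real.norm_eq_abs, abs_of_pos ht]
            nlinarith [norm_nonneg ζ]
          have h2 : ‖f (((α / q : ℝ) : ℂ) * ζ)‖ ≤ ‖f z‖ := hzmax this
          linarith
        · rw [hs2, hf1, smul_smul]
          congr 1; field_simp
      · rintro ⟨m, q, ⟨hq0, hq2⟩, f, hf, -, hf0, hf1⟩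
        exact (csInf_le (hbdd x.1 x.2) ⟨hq0, f, hf, hf0, hf1⟩).trans_lt hq2
    · simp [hx, indicator_of_notMem hx]
  rw [key]
  refine (hBm.compl.inter (MeasurableSet.const _)).union (hBm.inter ?_)
  refine MeasurableSet.iUnion fun m => MeasurableSet.iUnion fun q => MeasurableSet.iUnion fun _ => ?_
  refine (discSet_closed hJ ?_).measurableSet
  have : (0:ℝ) < 1 / ((m:ℝ) + 1) := by positivity
  linarith

/-- the `P`-complex-linear functional with real part `⟪c, ·⟫` -/
noncomputable def Lam {n : ℕ} (c : Cn n) (P : Cn n →L[ℝ] Cn n) : Cn n →L[ℝ] ℂ :=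
  Complex.ofRealCLM.comp (innerSL ℝ c) - (I • Complex.ofRealCLM.comp ((innerSL ℝ c).comp P))

theorem Lam_apply {n : ℕ} (c : Cn n) (P : Cn n →L[ℝ] Cn n) (w : Cn n) :
    Lam c P w = ((inner ℝ c w : ℝ) : ℂ) - I * ((inner ℝ c (P w) : ℝ) : ℂ) := by
  simp [Lam]

theorem Lam_re {n : ℕ} (c : Cn n) (P : Cn n →L[ℝ] Cn n) (w : Cn n) : (Lam c P w).re = inner ℝ c w := by
  simp [Lam_apply]

theorem Lam_comp {n : ℕ} {c : Cn n} {P : Cn n →L[ℝ] Cn n} (h : ∀ v, P (P v) = -v) (w : Cn n) :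
    Lam c P (P w) = I * Lam c P w := by
  rw [Lam_apply, Lam_apply, h, inner_neg_right]
  push_cast
  linear_combination ((inner ℝ c (P w) : ℝ) : ℂ) * Complex.I_sq

theorem Lam_norm {n : ℕ} {c : Cn n} {P : Cn n →L[ℝ] Cn n} (h : ‖P - Jstd n‖ ≤ 1 / 2) (w : Cn n) :
    ‖Lam c P w‖ ≤ 5 / 2 * ‖c‖ * ‖w‖ := by
  rw [Lam_apply]
  refine (norm_sub_le _ _).trans ?_
  rw [norm_mul, Complex.norm_I, one_mul, Complex.norm_real, Complex.norm_real]
  have h1 := norm_inner_le_norm (𝕜 := ℝ) c w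
  have h2 := norm_inner_le_norm (𝕜 := ℝ) c (P w)
  have h3 := near_norm h w
  have h4 : ‖c‖ * ‖P w‖ ≤ ‖c‖ * ((1 + 1 / 2) * ‖w‖) := by gcongr
  linarith

theorem dbar_lam {n : ℕ} {f : ℂ → Cn n} {P : ℂ → Cn n →L[ℝ] Cn n} {ε : ℝ} {D : Set ℂ} (h : Sol f P ε D)
    {z0 ζ : ℂ} (hz0 : z0 ∈ D) (hζ : ζ ∈ D) (c : Cn n) (hc : ‖c‖ ≤ 2) :
    HasFDerivAt (fun ζ => Lam c (P z0) (f ζ - f z0)) ((Lam c (P z0)).comp (fderiv ℝ f ζ)) ζ ∧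
    ‖dbar (fun ζ => Lam c (P z0) (f ζ - f z0)) ζ‖ ≤ 4 * ε * ‖f ζ - f z0‖ * ‖fderiv ℝ f ζ 1‖ := by
  have hd : HasFDerivAt (fun ζ => Lam c (P z0) (f ζ - f z0)) ((Lam c (P z0)).comp (fderiv ℝ f ζ)) ζ :=
    (Lam c (P z0)).hasFDerivAt.comp ζ ((h.diff ζ hζ).hasFDerivAt.sub_const (f z0))
  refine ⟨hd, ?_⟩
  set v := fderiv ℝ f ζ I with hv
  have hx : fderiv ℝ f ζ 1 = - P ζ v := by
    rw [hv, h.eq ζ hζ, h.sq ζ hζ, neg_neg]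
  have e1 : dbar (fun ζ => Lam c (P z0) (f ζ - f z0)) ζ = (1 / 2 : ℂ) * Lam c (P z0) ((P z0 - P ζ) v) := by
    unfold dbar
    rw [hd.fderiv]
    simp only [ContinuousLinearMap.comp_apply, hx, ← hv, ContinuousLinearMap.sub_apply, map_neg, map_sub]
    rw [← Lam_comp (h.sq z0 hz0)]
    ring
  have e2 : ‖v‖ ≤ 3 / 2 * ‖fderiv ℝ f ζ 1‖ := by
    rw [hv, h.eq ζ hζ]
    have := near_norm (h.near ζ hζ) (fderiv ℝ f ζ 1)
    linarith
  have e3 := h.lip z0 hz0 ζ hζ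
  rw [norm_sub_rev (f z0)] at e3
  have e4 := Lam_norm (c := c) (h.near z0 hz0) ((P z0 - P ζ) v)
  have e5 := (P z0 - P ζ).le_of_opNorm_le e3 v
  have e7 : 0 ≤ ε * ‖f ζ - f z0‖ := (norm_nonneg _).trans e3
  have e6 : 5 / 2 * ‖c‖ * ‖(P z0 - P ζ) v‖ ≤ 5 / 2 * 2 * (ε * ‖f ζ - f z0‖ * (3 / 2 * ‖fderiv ℝ f ζ 1‖)) := by
    gcongr
    exact e5.trans (by gcongr)
  rw [e1, norm_mul]
  have e8 : 0 ≤ ε * ‖f ζ - f z0‖ * ‖fderiv ℝ f ζ 1‖ := by positivity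
  have e9 : ‖(1 / 2 : ℂ)‖ = 1 / 2 := by norm_num
  rw [e9]
  linarith

theorem integral_cs (a b c : ℝ) : ∫ θ in (-Real.pi)..Real.pi, (Real.cos θ ^ 2 * a + Real.cos θ * Real.sin θ * b + Real.sin θ ^ 2 * c)
    = Real.pi * a + Real.pi * c := by
  have h1 : IntervalIntegrable (fun θ => Real.cos θ ^ 2 * a) volume (-Real.pi) Real.pi := by
    apply Continuous.intervalIntegrable; fun_prop
  have h2 : IntervalIntegrable (fun θ => Real.cos θ * Real.sin θ * b) volume (-Real.pi) Real.pi := by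
    apply Continuous.intervalIntegrable; fun_prop
  have h3 : IntervalIntegrable (fun θ => Real.sin θ ^ 2 * c) volume (-Real.pi) Real.pi := by
    apply Continuous.intervalIntegrable; fun_prop
  rw [intervalIntegral.integral_add (h1.add h2) h3, intervalIntegral.integral_add h1 h2]
  have h4 : ∫ θ in (-Real.pi)..Real.pi, Real.cos θ * Real.sin θ = 0 := by
    have : (fun θ => Real.cos θ * Real.sin θ) = fun θ => Real.sin θ * Real.cos θ := by ext; ring
    rw [this, integral_sin_mul_cos₁]; simp
  rw [intervalIntegral.integral_mul_const, intervalIntegral.integral_mul_const, intervalIntegral.integral_mul_const, h4,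
    integral_cos_sq, integral_sin_sq]
  simp

theorem sq_lower {x y t : ℝ} (hx : 0 ≤ x) (hy : 0 ≤ y) (ht : 0 ≤ t) (h : y - t ≤ x) : y ^ 2 - 2 * t * y ≤ x ^ 2 := by
  rcases le_total t y with h1 | h1
  · nlinarith
  · nlinarith

theorem local_mean {n : ℕ} {f : ℂ → Cn n} {P : ℂ → Cn n →L[ℝ] Cn n} {ε : ℝ} {D : Set ℂ} (h : Sol f P ε D)
    (hε0 : 0 ≤ ε) (hε : ε ≤ 1 / 10000) {z0 : ℂ} {r τ M : ℝ} (hr : 0 < r) (hD : closedBall z0 r ⊆ D)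
    (hτ0 : 0 ≤ τ) (hτ1 : τ ≤ 1) (hM : ‖fderiv ℝ f z0 1‖ ≤ M)
    (h1 : ∀ z, ‖z - z0‖ ≤ r → ‖f z - f z0 - fderiv ℝ f z0 (z - z0)‖ ≤ τ * r)
    (h2 : ∀ z, ‖z - z0‖ ≤ r → ‖fderiv ℝ f z 1 - fderiv ℝ f z0 1‖ ≤ τ) (b : Cn n) (hb : ‖f z0 - b‖ ≤ 2) :
    2 * Real.pi * (‖f z0 - b‖ ^ 2 - (10 * M + 1) * τ * r ^ 2) ≤
      ∫ θ in (-Real.pi)..Real.pi, ‖f (circleMap z0 r θ) - b‖ ^ 2 := by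
  have hz0 : z0 ∈ D := hD (by simp [hr.le])
  have hpi := Real.pi_pos
  set v := fderiv ℝ f z0 1 with hv
  set L := fderiv ℝ f z0 with hL
  set c := f z0 - b with hc
  have hM0 : 0 ≤ M := (norm_nonneg _).trans hM
  set G : ℂ → ℂ := fun ζ => Lam c (P z0) (f ζ - f z0) with hG
  have hLn : ‖L‖ ≤ 3 * ‖v‖ := rlin_norm L (h.near z0 hz0) (h.eq z0 hz0)
  have hin : ∀ ζ, ‖ζ - z0‖ ≤ r → ζ ∈ D := fun ζ hζ => hD (by rwa [mem_closedBall, dist_eq_norm])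
  have hLw : ∀ ζ, ‖ζ - z0‖ ≤ r → ‖L (ζ - z0)‖ ≤ 3 * ‖v‖ * r := fun ζ hζ =>
    (L.le_of_opNorm_le hLn _).trans (by gcongr)
  have hfd : ∀ ζ, ‖ζ - z0‖ ≤ r → ‖f ζ - f z0‖ ≤ (3 * ‖v‖ + τ) * r := by
    intro ζ hζ
    have := norm_add_le (f ζ - f z0 - L (ζ - z0)) (L (ζ - z0))
    rw [sub_add_cancel] at this
    linarith [h1 ζ hζ, hLw ζ hζ]
  have hGM : ∀ ζ, ‖ζ - z0‖ ≤ r → ‖dbar G ζ‖ ≤ 4 * ε * (3 * ‖v‖ ^ 2 + (4 * M + 1) * τ) * r := by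
    intro ζ hζ
    refine (dbar_lam h hz0 (hin ζ hζ) c hb).2.trans ?_
    have e1 : ‖fderiv ℝ f ζ 1‖ ≤ ‖v‖ + τ := by
      have := norm_add_le (fderiv ℝ f ζ 1 - v) v
      rw [sub_add_cancel] at this
      linarith [h2 ζ hζ]
    have e2 := hfd ζ hζ
    calc 4 * ε * ‖f ζ - f z0‖ * ‖fderiv ℝ f ζ 1‖ ≤ 4 * ε * ((3 * ‖v‖ + τ) * r) * (‖v‖ + τ) := by gcongr
      _ = 4 * ε * r * (3 * ‖v‖ ^ 2 + (4 * ‖v‖ + τ) * τ) := by ring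
      _ ≤ 4 * ε * r * (3 * ‖v‖ ^ 2 + (4 * M + 1) * τ) := by gcongr
      _ = _ := by ring
  have hGd : ∀ ζ, ‖ζ - z0‖ ≤ r → DifferentiableAt ℝ G ζ := fun ζ hζ =>
    (dbar_lam h hz0 (hin ζ hζ) c hb).1.differentiableAt
  have hpom := pompeiu (z := z0) hr (by simpa using hr) G (fun ζ hζ => hGd ζ hζ.le)
    (fun ζ hζ => (hGd ζ (by rwa [mem_closedBall, dist_eq_norm] at hζ)).continuousAt.continuousWithinAt)
    (fun ζ hζ => hGM ζ hζ.le)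
  have hG0 : G z0 = 0 := by simp [hG]
  have hcm : ∀ θ : ℝ, circleMap z0 r θ - z0 = r * exp (θ * I) := by intro θ; simp [circleMap]
  have hcn : ∀ θ : ℝ, ‖circleMap z0 r θ - z0‖ = r := by intro θ; simp [circleMap, abs_of_pos hr]
  have hci : (∮ ζ in C(z0, r), (ζ - z0)⁻¹ * G ζ) = I * ∫ θ in (-Real.pi)..Real.pi, G (circleMap z0 r θ) := by
    rw [circleIntegral_eq_pi]
    congr 1
    apply intervalIntegral.integral_congr
    intro θ _
    simp only
    have : (r * exp (θ * I)) ≠ 0 := mul_ne_zero (by exact_mod_cast hr.ne') (exp_ne_zero _)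
    rw [hcm, ← mul_assoc, mul_inv_cancel₀ this, one_mul]
  rw [hci, hG0, mul_zero, zero_sub, norm_neg, norm_mul, Complex.norm_I, one_mul] at hpom
  have hcont : Continuous fun θ : ℝ => f (circleMap z0 r θ) := by
    rw [continuous_iff_continuousAt]
    intro θ
    exact ((h.diff _ (hin _ (hcn θ).le)).continuousAt).comp (continuous_circleMap z0 r).continuousAt
  have hGc : Continuous fun θ : ℝ => G (circleMap z0 r θ) :=
    (Lam c (P z0)).continuous.comp (hcont.sub continuous_const)
  have hre : (∫ θ in (-Real.pi)..Real.pi, (inner ℝ c (f (circleMap z0 r θ) - f z0) : ℝ))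
      = (∫ θ in (-Real.pi)..Real.pi, G (circleMap z0 r θ)).re := by
    have := Complex.reCLM.intervalIntegral_comp_comm (hGc.intervalIntegrable (μ := volume) (-Real.pi) Real.pi)
    simp only [Complex.reCLM_apply] at this
    rw [← this]
    simp only [hG, Lam_re]
  have hre2 := (abs_le.1 ((Complex.abs_re_le_norm (∫ θ in (-Real.pi)..Real.pi, G (circleMap z0 r θ))).trans hpom)).1
  rw [← hre] at hre2
  have pt : ∀ θ : ℝ, ‖c‖ ^ 2 - 6 * M * τ * r ^ 2 + 2 * (inner ℝ c (f (circleMap z0 r θ) - f z0) : ℝ)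
      + (Real.cos θ ^ 2 * (r ^ 2 * ‖v‖ ^ 2) + Real.cos θ * Real.sin θ * (2 * r ^ 2 * inner ℝ v (P z0 v)) + Real.sin θ ^ 2 * (r ^ 2 * ‖P z0 v‖ ^ 2))
      ≤ ‖f (circleMap z0 r θ) - b‖ ^ 2 := by
    intro θ
    set ζ := circleMap z0 r θ with hζ
    have e0 : f ζ - b = c + (f ζ - f z0) := by rw [hc]; abel
    rw [e0, norm_add_sq_real]
    have e1 : L (ζ - z0) = (r * Real.cos θ) • v + (r * Real.sin θ) • P z0 v := by
      rw [rlin_apply' L, hL, h.eq z0 hz0, hcm]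
      congr 2
      · simp [exp_ofReal_mul_I_re]
      · simp [exp_ofReal_mul_I_im]
    have e2 : ‖L (ζ - z0)‖ ^ 2 = Real.cos θ ^ 2 * (r ^ 2 * ‖v‖ ^ 2) + Real.cos θ * Real.sin θ * (2 * r ^ 2 * inner ℝ v (P z0 v)) + Real.sin θ ^ 2 * (r ^ 2 * ‖P z0 v‖ ^ 2) := by
      rw [e1, norm_add_sq_real, norm_smul, norm_smul, inner_smul_left, inner_smul_right, mul_pow, mul_pow]
      simp only [Real.norm_eq_abs, sq_abs, conj_trivial]
      ring
    have e3 := h1 ζ (hcn θ).le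
    have e4 : ‖L (ζ - z0)‖ - τ * r ≤ ‖f ζ - f z0‖ := by
      have := norm_sub_norm_le (L (ζ - z0)) (f ζ - f z0)
      rw [norm_sub_rev (L _)] at this
      linarith
    have e5 := sq_lower (norm_nonneg _) (norm_nonneg _) (by positivity) e4
    have e6 := hLw ζ (hcn θ).le
    have e7 : 2 * (τ * r) * ‖L (ζ - z0)‖ ≤ 2 * (τ * r) * (3 * M * r) := by
      gcongr
      exact e6.trans (by gcongr)
    rw [← e2]
    nlinarith
  have hI1 : IntervalIntegrable (fun θ : ℝ => (inner ℝ c (f (circleMap z0 r θ) - f z0) : ℝ)) volume (-Real.pi) Real.pi := by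
    apply Continuous.intervalIntegrable
    exact (continuous_const.inner (hcont.sub continuous_const))
  have hI2 : IntervalIntegrable (fun θ : ℝ => (Real.cos θ ^ 2 * (r ^ 2 * ‖v‖ ^ 2) + Real.cos θ * Real.sin θ * (2 * r ^ 2 * inner ℝ v (P z0 v)) + Real.sin θ ^ 2 * (r ^ 2 * ‖P z0 v‖ ^ 2))) volume (-Real.pi) Real.pi := by
    apply Continuous.intervalIntegrable; fun_prop
  have hI0 : IntervalIntegrable (fun _ : ℝ => ‖c‖ ^ 2 - 6 * M * τ * r ^ 2) volume (-Real.pi) Real.pi := by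
    apply Continuous.intervalIntegrable; fun_prop
  have hI3 : IntervalIntegrable (fun θ : ℝ => ‖f (circleMap z0 r θ) - b‖ ^ 2) volume (-Real.pi) Real.pi := by
    apply Continuous.intervalIntegrable
    exact (hcont.sub continuous_const).norm.pow 2
  have big := intervalIntegral.integral_mono_on (by linarith) ((hI0.add (hI1.const_mul 2)).add hI2) hI3 (fun θ _ => pt θ)
  rw [intervalIntegral.integral_add (hI0.add (hI1.const_mul 2)) hI2, intervalIntegral.integral_add hI0 (hI1.const_mul 2),
    intervalIntegral.integral_const_mul, integral_cs, intervalIntegral.integral_const, smul_eq_mul] at big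
  have q1 : 0 ≤ Real.pi * (r ^ 2 * ‖P z0 v‖ ^ 2) := by positivity
  have q2 : 0 ≤ Real.pi * (r ^ 2 * ‖v‖ ^ 2) := by positivity
  have q3 : 0 ≤ Real.pi * (r ^ 2 * (M * τ)) := by positivity
  have q4 : 0 ≤ Real.pi * (r ^ 2 * τ) := by positivity
  have q5 : 18 * Real.pi * r * (4 * ε * (3 * ‖v‖ ^ 2 + (4 * M + 1) * τ) * r) ≤
      18 * Real.pi * r * (4 * (1 / 10000) * (3 * ‖v‖ ^ 2 + (4 * M + 1) * τ) * r) := by gcongr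
  nlinarith

theorem disc_unif {n : ℕ} {J : Cn n → Cn n →L[ℝ] Cn n} {ε : ℝ} (hJ : Good J ε) {f : ℂ → Cn n}
    (hf : JDisc J (ball 0 1) f) {R τ : ℝ} (hR : R < 1) (hτ : 0 < τ) :
    ∃ r0 > 0, r0 ≤ (1 - R) / 16 ∧ ∀ z0, ‖z0‖ ≤ R → ∀ z, ‖z - z0‖ ≤ r0 →
      ‖f z - f z0 - fderiv ℝ f z0 (z - z0)‖ ≤ τ * ‖z - z0‖ ∧ ‖fderiv ℝ f z 1 - fderiv ℝ f z0 1‖ ≤ τ := by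
  set d := (1 - R) / 4 with hd
  have hdp : 0 < d := by rw [hd]; linarith
  have hcont : Tendsto (fun x : ℝ => 4 * (Cr / d * cbrt (2 * x / d))) (𝓝 0) (𝓝 0) := by
    have : Continuous (fun x : ℝ => 4 * (Cr / d * cbrt (2 * x / d))) := by
      have := continuous_cbrt
      have h2 : Continuous (fun x : ℝ => 2 * x / d) := by fun_prop
      exact continuous_const.mul (continuous_const.mul (this.comp h2))
    have h3 := this.tendsto 0
    simpa [cbrt_zero] using h3
  obtain ⟨δ, hδ, hδ2⟩ := Metric.eventually_nhds_iff.1 (hcont.eventually (gt_mem_nhds hτ))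
  set r0 := min (δ / 2) (d / 4) with hr0
  have hr0p : 0 < r0 := lt_min (by linarith) (by linarith)
  have hr0d : r0 ≤ d / 4 := min_le_right _ _
  have hr0δ : r0 ≤ δ / 2 := min_le_left _ _
  set κ := Cr / d * cbrt (2 * r0 / d) with hκ
  have hκτ : 4 * κ ≤ τ := (hδ2 (by rw [dist_zero_right, Real.norm_eq_abs, abs_of_pos hr0p]; linarith)).le
  have hκ0 : 0 ≤ κ := mul_nonneg (div_nonneg Cr_pos.le hdp.le) (cbrt_nonneg (by positivity))
  have rem : ∀ z0 z : ℂ, ‖z0‖ + 2 * d ≤ 1 → ‖z - z0‖ ≤ 2 * r0 → ‖f z - f z0 - fderiv ℝ f z0 (z - z0)‖ ≤ κ * ‖z - z0‖ := by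
    intro z0 z h0 h1
    refine (disc_rem hJ hf hdp h0 (by linarith)).trans ?_
    have e1 : cbrt (‖z - z0‖ / d) ≤ cbrt (2 * r0 / d) := cbrt_mono (by positivity) (by gcongr)
    calc Cr * (‖z - z0‖ / d * cbrt (‖z - z0‖ / d)) = Cr / d * ‖z - z0‖ * cbrt (‖z - z0‖ / d) := by ring
      _ ≤ Cr / d * ‖z - z0‖ * cbrt (2 * r0 / d) := mul_le_mul_of_nonneg_left e1 (mul_nonneg (div_nonneg Cr_pos.le hdp.le) (norm_nonneg _))
      _ = κ * ‖z - z0‖ := by rw [hκ]; ring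
  refine ⟨r0, hr0p, by linarith, fun z0 hz0 z hz => ⟨?_, ?_⟩⟩
  · refine (rem z0 z (by linarith) (by linarith)).trans ?_
    gcongr; linarith
  · set h := ‖z - z0‖ with hh
    rcases eq_or_lt_of_le (norm_nonneg (z - z0)) with h0 | h0
    · have : z = z0 := by rw [← sub_eq_zero, ← norm_eq_zero]; exact h0.symm
      rw [this]; simp [hτ.le]
    · rw [← hh] at h0
      have hzn : ‖z‖ ≤ R + r0 := by
        have := norm_add_le (z - z0) z0
        rw [sub_add_cancel] at this
        linarith
      have hhn : ‖((h:ℝ):ℂ)‖ = h := by rw [Complex.norm_real, Real.norm_eq_abs, abs_of_pos h0]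
      have n2 : ‖z + h - z0‖ ≤ 2 * h := by
        have := norm_add_le (z - z0) (h:ℂ)
        rw [show z - z0 + (h:ℂ) = z + h - z0 by ring, hhn] at this
        linarith
      have a1 := rem z0 z (by linarith) (by linarith)
      have a2 := rem z (z + h) (by linarith) (by rw [add_sub_cancel_left, hhn]; linarith)
      have a3 := rem z0 (z + h) (by linarith) (by linarith)
      rw [add_sub_cancel_left, hhn] at a2
      have e : (fderiv ℝ f z (h:ℂ)) - fderiv ℝ f z0 (h:ℂ) = (f (z + h) - f z0 - fderiv ℝ f z0 (z + h - z0))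
          - (f (z + h) - f z - fderiv ℝ f z (h:ℂ)) - (f z - f z0 - fderiv ℝ f z0 (z - z0)) := by
        rw [show z + (h:ℂ) - z0 = (z - z0) + h by ring, map_add]
        abel
      have e2 : (fderiv ℝ f z (h:ℂ)) - fderiv ℝ f z0 (h:ℂ) = h • (fderiv ℝ f z 1 - fderiv ℝ f z0 1) := by
        have : (h:ℂ) = h • (1:ℂ) := by simp
        rw [this, ContinuousLinearMap.map_smul, ContinuousLinearMap.map_smul, smul_sub]
      have n := norm_sub_le ((f (z + h) - f z0 - fderiv ℝ f z0 (z + h - z0)) - (f (z + h) - f z - fderiv ℝ f z (h:ℂ))) (f z - f z0 - fderiv ℝ f z0 (z - z0))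
      have n' := norm_sub_le (f (z + h) - f z0 - fderiv ℝ f z0 (z + h - z0)) (f (z + h) - f z - fderiv ℝ f z (h:ℂ))
      rw [← e, e2, norm_smul, Real.norm_eq_abs, abs_of_pos h0] at n
      have n4 : κ * ‖z + h - z0‖ ≤ κ * (2 * h) := by gcongr
      have : h * ‖fderiv ℝ f z 1 - fderiv ℝ f z0 1‖ ≤ h * (4 * κ) := by nlinarith
      exact (le_of_mul_le_mul_left this h0).trans hκτ

theorem disc_cont {n : ℕ} {J : Cn n → Cn n →L[ℝ] Cn n} {D : Set (Cn n)} {f : ℂ → Cn n}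
    (hf : JDisc J D f) : ContinuousOn f (ball 0 1) := fun z hz => (hf.2 z hz).1.continuousAt.continuousWithinAt

/-- uniform local almost-sub-mean-value property -/
theorem disc_local {n : ℕ} {J : Cn n → Cn n →L[ℝ] Cn n} {ε : ℝ} (hJ : Good J ε) {f : ℂ → Cn n}
    (hf : JDisc J (ball 0 1) f) {R η : ℝ} (hR : R < 1) (hη : 0 < η) (b : Cn n) (hb : ‖b‖ ≤ 1) :
    ∃ r0 > 0, r0 ≤ (1 - R) / 16 ∧ ∀ r, 0 < r → r ≤ r0 → ∀ z0, ‖z0‖ ≤ R →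
      2 * Real.pi * (‖f z0 - b‖ ^ 2 - η * r ^ 2) ≤ ∫ θ in (-Real.pi)..Real.pi, ‖f (circleMap z0 r θ) - b‖ ^ 2 := by
  set M := Cg / (1 - R) with hM
  have hMp : 0 < M := div_pos Cg_pos (by linarith)
  set τ := min 1 (η / (10 * M + 1)) with hτ
  have hτp : 0 < τ := lt_min one_pos (by positivity)
  obtain ⟨r0, hr0, hr0R, H⟩ := disc_unif hJ hf hR hτp
  refine ⟨r0, hr0, hr0R, fun r hr hrr z0 hz0 => ?_⟩
  have hsub : closedBall z0 r ⊆ ball (0:ℂ) 1 := by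
    intro z hz
    rw [mem_closedBall, dist_eq_norm] at hz
    have := norm_add_le (z - z0) z0
    rw [sub_add_cancel] at this
    rw [mem_ball, dist_zero_right]; linarith
  have hfz : ‖f z0‖ < 1 := by
    have := hf.1 (hsub (show z0 ∈ closedBall z0 r by simp [hr.le]))
    simpa using this
  have key := local_mean (JDisc.sol hJ hf) hJ.pos.le hJ.le' hr hsub hτp.le (min_le_left _ _)
    (disc_grad hJ hf (sub_pos.2 hR) (by linarith))
    (fun z hz => ((H z0 hz0 z (hz.trans hrr)).1).trans (by gcongr))
    (fun z hz => (H z0 hz0 z (hz.trans hrr)).2) b (by have := norm_sub_le (f z0) b; linarith)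
  refine le_trans ?_ key
  have h1 : (10 * M + 1) * τ ≤ η := by
    have := min_le_right 1 (η / (10 * M + 1))
    rw [← hτ, le_div_iff₀ (by positivity)] at this
    linarith
  have : (10 * M + 1) * τ * r ^ 2 ≤ η * r ^ 2 := by gcongr
  have hpi := Real.pi_pos
  gcongr

theorem periodic_shift {E : Type*} [NormedAddCommGroup E] [NormedSpace ℝ E] {g : ℝ → E} (hg : Function.Periodic g (2 * Real.pi)) (φ : ℝ) :
    ∫ θ in (-Real.pi)..Real.pi, g (θ + φ) = ∫ θ in (-Real.pi)..Real.pi, g θ := by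
  rw [intervalIntegral.integral_comp_add_right]
  have := hg.intervalIntegral_add_eq (-Real.pi + φ) (-Real.pi)
  rw [show -Real.pi + φ + 2 * Real.pi = Real.pi + φ by ring, show -Real.pi + 2 * Real.pi = Real.pi by ring] at this
  exact this

theorem integral_circle_sq (z : ℂ) (r : ℝ) : ∫ θ in (-Real.pi)..Real.pi, ‖circleMap z r θ‖ ^ 2 = 2 * Real.pi * (‖z‖ ^ 2 + r ^ 2) := by
  have h : ∀ θ : ℝ, ‖circleMap z r θ‖ ^ 2 = (‖z‖ ^ 2 + r ^ 2) + (Real.cos θ * (2 * r * z.re) + Real.sin θ * (2 * r * z.im)) := by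
    intro θ
    rw [Complex.sq_norm, Complex.sq_norm, Complex.normSq_apply, Complex.normSq_apply]
    have h1 : (circleMap z r θ).re = z.re + r * Real.cos θ := by simp [circleMap, exp_ofReal_mul_I_re]
    have h2 : (circleMap z r θ).im = z.im + r * Real.sin θ := by simp [circleMap, exp_ofReal_mul_I_im]
    rw [h1, h2]
    linear_combination (r ^ 2) * Real.sin_sq_add_cos_sq θ
  generalize ‖z‖ ^ 2 + r ^ 2 = A at h ⊢
  simp_rw [h]
  rw [intervalIntegral.integral_add, intervalIntegral.integral_add, intervalIntegral.integral_mul_const, intervalIntegral.integral_mul_const, integral_cos, integral_sin, intervalIntegral.integral_const]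
  · rw [Real.sin_neg, Real.cos_neg, Real.sin_pi, smul_eq_mul]; ring
  all_goals apply Continuous.intervalIntegrable; fun_prop

theorem submean_cont {u : ℂ → ℝ} (hu : Continuous u) {R : ℝ} (hR : 0 < R)
    (H : ∀ η > 0, ∃ r0 > 0, ∀ r, 0 < r → r ≤ r0 → ∀ z0, ‖z0‖ ≤ R →
      2 * Real.pi * (u z0 - η * r ^ 2) ≤ ∫ θ in (-Real.pi)..Real.pi, u (circleMap z0 r θ)) :
    2 * Real.pi * u 0 ≤ ∫ θ in (-Real.pi)..Real.pi, u (circleMap 0 R θ) := by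
  have hpi := Real.pi_pos
  set U : ℂ → ℝ := fun z => ∫ φ in (-Real.pi)..Real.pi, u (exp (φ * I) * z) with hU
  have hUc : Continuous U := by
    apply intervalIntegral.continuous_parametric_intervalIntegral_of_continuous'
    unfold Function.uncurry
    fun_prop
  have hper : ∀ (z : ℂ) (r : ℝ), Function.Periodic (fun θ => u (circleMap z r θ)) (2 * Real.pi) := by
    intro z r θ
    simp only [periodic_circleMap z r θ]
  have hUR : ∀ z, ‖z‖ = R → U z = ∫ θ in (-Real.pi)..Real.pi, u (circleMap 0 R θ) := by
    intro z hz
    rw [← periodic_shift (hper 0 R) (arg z)]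
    simp only [hU]
    congr 1
    ext φ
    congr 1
    conv_lhs => rw [← Complex.norm_mul_exp_arg_mul_I z, hz]
    simp only [circleMap]
    push_cast
    rw [add_mul, exp_add]; ring
  have main : ∀ η > 0, 2 * Real.pi * u 0 ≤ (∫ θ in (-Real.pi)..Real.pi, u (circleMap 0 R θ)) + η := by
    intro η0 hη0
    set η := η0 / (2 * Real.pi * R ^ 2) with hη
    have hηp : 0 < η := by positivity
    obtain ⟨r0, hr0, Hr⟩ := H (η / 2) (by linarith)
    set V : ℂ → ℝ := fun z => U z + 2 * Real.pi * η * ‖z‖ ^ 2 with hV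
    have hVc : Continuous V := by fun_prop
    obtain ⟨z1, hz1, hmax⟩ := (isCompact_closedBall (0:ℂ) R).exists_isMaxOn ⟨0, by simp [hR.le]⟩ hVc.continuousOn
    have hz1' : ‖z1‖ ≤ R := by simpa using hz1
    have hz1R : ‖z1‖ = R := by
      by_contra hne
      have hlt : ‖z1‖ < R := lt_of_le_of_ne hz1' hne
      set r := min r0 (R - ‖z1‖) with hr
      have hrp : 0 < r := lt_min hr0 (by linarith)
      have e1 : ∫ θ in (-Real.pi)..Real.pi, V (circleMap z1 r θ) ≤ ∫ θ in (-Real.pi)..Real.pi, V z1 := by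
        apply intervalIntegral.integral_mono_on (by linarith)
        · apply Continuous.intervalIntegrable
          exact hVc.comp (continuous_circleMap _ _)
        · apply Continuous.intervalIntegrable; fun_prop
        · intro θ _
          apply hmax
          have : ‖circleMap z1 r θ - z1‖ = r := by simp [circleMap, abs_of_pos hrp]
          have h2 := norm_add_le (circleMap z1 r θ - z1) z1
          rw [sub_add_cancel] at h2
          have h3 : r ≤ R - ‖z1‖ := min_le_right _ _
          rw [mem_closedBall, dist_zero_right]
          linarith
      have e2 : ∫ θ in (-Real.pi)..Real.pi, U (circleMap z1 r θ) = ∫ φ in (-Real.pi)..Real.pi, ∫ θ in (-Real.pi)..Real.pi, u (circleMap (exp (φ * I) * z1) r θ) := by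
        have s1 : ∫ θ in (-Real.pi)..Real.pi, U (circleMap z1 r θ) = ∫ φ in (-Real.pi)..Real.pi, ∫ θ in (-Real.pi)..Real.pi, u (exp (φ * I) * circleMap z1 r θ) := by
          simp only [hU]
          simp_rw [intervalIntegral.integral_of_le (show -Real.pi ≤ Real.pi by linarith)]
          apply integral_integral_swap
          rw [Measure.prod_restrict, ← IntegrableOn]
          apply IntegrableOn.mono_set _ (Set.prod_mono Ioc_subset_Icc_self Ioc_subset_Icc_self)
          apply ContinuousOn.integrableOn_compact (isCompact_Icc.prod isCompact_Icc)
          apply Continuous.continuousOn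
          unfold Function.uncurry circleMap
          fun_prop
        rw [s1]
        congr 1
        ext φ
        rw [← periodic_shift (hper (exp (φ * I) * z1) r) φ]
        congr 1
        ext θ
        congr 1
        simp only [circleMap]
        push_cast
        rw [add_mul (θ:ℂ), exp_add]; ring
      have e3 : ∫ φ in (-Real.pi)..Real.pi, 2 * Real.pi * (u (exp (φ * I) * z1) - η / 2 * r ^ 2) ≤ ∫ φ in (-Real.pi)..Real.pi, ∫ θ in (-Real.pi)..Real.pi, u (circleMap (exp (φ * I) * z1) r θ) := by
        apply intervalIntegral.integral_mono_on (by linarith)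
        · apply Continuous.intervalIntegrable; fun_prop
        · apply Continuous.intervalIntegrable
          apply intervalIntegral.continuous_parametric_intervalIntegral_of_continuous'
          unfold Function.uncurry circleMap
          fun_prop
        · intro φ _
          apply Hr r hrp (min_le_left _ _)
          rw [norm_mul, Complex.norm_exp_ofReal_mul_I, one_mul]
          exact hz1'
      rw [← e2, intervalIntegral.integral_const_mul, intervalIntegral.integral_sub (by apply Continuous.intervalIntegrable; fun_prop) (by simp), intervalIntegral.integral_const] at e3
      have e4 : ∫ θ in (-Real.pi)..Real.pi, V (circleMap z1 r θ) = (∫ θ in (-Real.pi)..Real.pi, U (circleMap z1 r θ)) + 2 * Real.pi * η * (2 * Real.pi * (‖z1‖ ^ 2 + r ^ 2)) := by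
        simp only [hV]
        rw [intervalIntegral.integral_add, intervalIntegral.integral_const_mul, integral_circle_sq]
        · apply Continuous.intervalIntegrable
          exact hUc.comp (continuous_circleMap _ _)
        · apply Continuous.intervalIntegrable
          have := continuous_circleMap z1 r
          fun_prop
      rw [e4, intervalIntegral.integral_const] at e1
      simp only [smul_eq_mul, hV] at e1 e3
      change 2 * Real.pi * (U z1 - _) ≤ _ at e3
      have : 0 < Real.pi ^ 2 * η * r ^ 2 := by positivity
      nlinarith
    have h0 : V 0 ≤ V z1 := hmax (by simp [hR.le] : (0:ℂ) ∈ closedBall (0:ℂ) R)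
    have hU0 : U 0 = 2 * Real.pi * u 0 := by
      simp only [hU, mul_zero, intervalIntegral.integral_const, smul_eq_mul]; ring
    simp only [hV] at h0
    rw [hUR z1 hz1R, hU0, hz1R] at h0
    have : 2 * Real.pi * η * R ^ 2 = η0 := by rw [hη]; field_simp
    rw [this] at h0
    simpa using h0
  exact le_of_forall_pos_le_add main

/-- the sub-mean value property of squared distances along discs -/
theorem disc_submean0 {n : ℕ} {J : Cn n → Cn n →L[ℝ] Cn n} {ε : ℝ} (hJ : Good J ε) {f : ℂ → Cn n}
    (hf : JDisc J (ball 0 1) f) {R : ℝ} (hR0 : 0 < R) (hR : R < 1) (b : Cn n) (hb : ‖b‖ ≤ 1) :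
    2 * Real.pi * ‖f 0 - b‖ ^ 2 ≤ ∫ θ in (-Real.pi)..Real.pi, ‖f (circleMap 0 R θ) - b‖ ^ 2 := by
  set R1 := (1 + R) / 2 with hR1
  have hsub : closedBall (0:ℂ) R1 ⊆ ball 0 1 := closedBall_subset_ball (by rw [hR1]; linarith)
  have hc : ContinuousOn (fun z => ‖f z - b‖ ^ 2) (closedBall (0:ℂ) R1) :=
    (((disc_cont hf).mono hsub).sub continuousOn_const).norm.pow 2
  obtain ⟨u, hu⟩ := ContinuousMap.exists_restrict_eq (isClosed_closedBall (x := (0:ℂ)) (ε := R1)) ⟨_, hc.restrict⟩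
  have hu' : ∀ z, ‖z‖ ≤ R1 → u z = ‖f z - b‖ ^ 2 := by
    intro z hz
    have := congrArg (fun g => g (⟨z, by simpa using hz⟩ : closedBall (0:ℂ) R1)) hu
    simpa using this
  have hcm : ∀ (z : ℂ) (r θ : ℝ), 0 < r → ‖circleMap z r θ‖ ≤ ‖z‖ + r := by
    intro z r θ hr
    refine (norm_add_le _ _).trans ?_
    simp [abs_of_pos hr]
  have key := submean_cont u.continuous hR0 (by
    intro η hη
    obtain ⟨r0, h1, h2, h3⟩ := disc_local hJ hf hR hη b hb
    refine ⟨r0, h1, fun r hr hrr z0 hz0 => ?_⟩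
    rw [hu' z0 (by rw [hR1]; linarith)]
    have : ∀ θ, u (circleMap z0 r θ) = ‖f (circleMap z0 r θ) - b‖ ^ 2 := by
      intro θ
      apply hu'
      have := hcm z0 r θ hr
      rw [hR1]; linarith
    simp_rw [this]
    exact h3 r hr hrr z0 hz0)
  rw [hu' 0 (by simp [hR1]; linarith)] at key
  have : ∀ θ, u (circleMap 0 R θ) = ‖f (circleMap 0 R θ) - b‖ ^ 2 := by
    intro θ
    apply hu'
    have := hcm 0 R θ hR0
    simp at this
    simp [hR1]; linarith
  simp_rw [this] at key
  exact key

theorem JDisc.reparam {n : ℕ} {J : Cn n → Cn n →L[ℝ] Cn n} {D : Set (Cn n)} {f : ℂ → Cn n}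
    (hf : JDisc J D f) {z : ℂ} {d : ℝ} (hd : 0 < d) (hz : ‖z‖ + d ≤ 1) : JDisc J D (fun ζ => f (z + d * ζ)) := by
  have hin : ∀ ζ ∈ ball (0:ℂ) 1, z + (d:ℂ) * ζ ∈ ball (0:ℂ) 1 := by
    intro ζ hζ
    have hζ' : ‖ζ‖ < 1 := by simpa using hζ
    have := norm_add_le z (d * ζ)
    rw [norm_mul, Complex.norm_real, Real.norm_eq_abs, abs_of_pos hd] at this
    rw [mem_ball, dist_zero_right]
    nlinarith [norm_nonneg ζ]
  have hd : ∀ ζ ∈ ball (0:ℂ) 1, HasFDerivAt (fun ζ : ℂ => f (z + d * ζ)) (d • fderiv ℝ f (z + d * ζ)) ζ := by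
    intro ζ hζ
    have := fderiv_scale (f := f) (z := z) (a := d) (c := 1) (ζ := ζ) (hf.2 _ (hin ζ hζ)).1
    simpa using this
  refine ⟨fun ζ hζ => hf.1 (hin ζ hζ), fun ζ hζ => ⟨(hd ζ hζ).differentiableAt, ?_⟩⟩
  rw [(hd ζ hζ).fderiv]
  have := (hf.2 _ (hin ζ hζ)).2
  rw [ContinuousLinearMap.smul_comp, this, ContinuousLinearMap.comp_smul]

theorem disc_submean {n : ℕ} {J : Cn n → Cn n →L[ℝ] Cn n} {ε : ℝ} (hJ : Good J ε) {f : ℂ → Cn n}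
    (hf : JDisc J (ball 0 1) f) {z : ℂ} {r : ℝ} (hr : 0 < r) (hz : ‖z‖ + r < 1) (b : Cn n) (hb : ‖b‖ ≤ 1) :
    2 * Real.pi * ‖f z - b‖ ^ 2 ≤ ∫ θ in (-Real.pi)..Real.pi, ‖f (circleMap z r θ) - b‖ ^ 2 := by
  have hd : 0 < 1 - ‖z‖ := by linarith
  have key := disc_submean0 hJ (hf.reparam hd (by linarith)) (R := r / (1 - ‖z‖)) (by positivity)
    (by rw [div_lt_one hd]; linarith) b hb
  have e : ∀ θ : ℝ, z + ((1 - ‖z‖ : ℝ) : ℂ) * circleMap 0 (r / (1 - ‖z‖)) θ = circleMap z r θ := by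
    intro θ
    simp only [circleMap, zero_add]
    rw [← mul_assoc, ← Complex.ofReal_mul, mul_div_cancel₀ _ hd.ne']
  simp only [e, mul_zero, add_zero] at key
  exact key

theorem area_polar (c : ℂ) (R : ℝ) (g : ℂ → ℝ) (hg : Measurable g) (hi : IntegrableOn g (ball c R)) :
    IntegrableOn (fun r => r * ∫ θ in (-Real.pi)..Real.pi, g (circleMap c r θ)) (Ioo 0 R) ∧
    ∫ r in Ioo 0 R, r * ∫ θ in (-Real.pi)..Real.pi, g (circleMap c r θ) = ∫ ζ in ball c R, g ζ := by
  have h1 := polar_integrable c R g hg hi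
  have h2 := polar_integral c R g
  have hpi := Real.pi_pos
  have e : ∀ r : ℝ, r * ∫ θ in (-Real.pi)..Real.pi, g (circleMap c r θ) = ∫ θ in Ioo (-Real.pi) Real.pi, r * g (circleMap c r θ) := by
    intro r
    rw [intervalIntegral.integral_of_le (by linarith), integral_Ioc_eq_integral_Ioo, integral_const_mul]
  simp_rw [e]
  rw [IntegrableOn, Measure.volume_eq_prod, ← Measure.prod_restrict] at h1
  refine ⟨h1.integral_prod_left, ?_⟩
  rw [← h2, Measure.volume_eq_prod, ← Measure.prod_restrict]
  simp only [smul_eq_mul]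
  rw [integral_prod _ h1]

theorem integral_id_mul {R : ℝ} (hR : 0 < R) (A : ℝ) : IntegrableOn (fun r => r * A) (Ioo 0 R) ∧ ∫ r in Ioo 0 R, r * A = R ^ 2 / 2 * A := by
  constructor
  · apply IntegrableOn.mono_set _ Ioo_subset_Icc_self
    apply Continuous.integrableOn_Icc; fun_prop
  · rw [← integral_Ioc_eq_integral_Ioo, ← intervalIntegral.integral_of_le hR.le, intervalIntegral.integral_mul_const, integral_id]
    ring

theorem area_ge {c : ℂ} {R A : ℝ} (hR : 0 < R) (g : ℂ → ℝ) (hg : Measurable g) (hi : IntegrableOn g (ball c R))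
    (h : ∀ r, 0 < r → r < R → A ≤ ∫ θ in (-Real.pi)..Real.pi, g (circleMap c r θ)) :
    R ^ 2 / 2 * A ≤ ∫ ζ in ball c R, g ζ := by
  obtain ⟨h1, h2⟩ := area_polar c R g hg hi
  obtain ⟨h3, h4⟩ := integral_id_mul hR A
  rw [← h2, ← h4]
  apply setIntegral_mono_on h3 h1 measurableSet_Ioo
  intro r hr
  exact mul_le_mul_of_nonneg_left (h r hr.1 hr.2) hr.1.le

theorem area_le {c : ℂ} {R A : ℝ} (hR : 0 < R) (g : ℂ → ℝ) (hg : Measurable g) (hi : IntegrableOn g (ball c R))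
    (h : ∀ r, 0 < r → r < R → (∫ θ in (-Real.pi)..Real.pi, g (circleMap c r θ)) ≤ A) :
    ∫ ζ in ball c R, g ζ ≤ R ^ 2 / 2 * A := by
  obtain ⟨h1, h2⟩ := area_polar c R g hg hi
  obtain ⟨h3, h4⟩ := integral_id_mul hR A
  rw [← h2, ← h4]
  apply setIntegral_mono_on h1 h3 measurableSet_Ioo
  intro r hr
  exact mul_le_mul_of_nonneg_left (h r hr.1 hr.2) hr.1.le

theorem disc_circle_cont {n : ℕ} {J : Cn n → Cn n →L[ℝ] Cn n} {D : Set (Cn n)} {f : ℂ → Cn n}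
    (hf : JDisc J D f) {z : ℂ} {r : ℝ} (hr : 0 < r) (hz : ‖z‖ + r < 1) : Continuous fun θ : ℝ => f (circleMap z r θ) := by
  apply (disc_cont hf).comp_continuous (continuous_circleMap z r)
  intro θ
  rw [mem_ball, dist_zero_right]
  refine lt_of_le_of_lt (norm_add_le _ _) ?_
  simp [abs_of_pos hr, hz]

theorem circleMap_mem {z : ℂ} {r : ℝ} (hr : 0 < r) (hz : ‖z‖ + r < 1) (θ : ℝ) : circleMap z r θ ∈ ball (0:ℂ) 1 := by
  rw [mem_ball, dist_zero_right]
  refine lt_of_le_of_lt (norm_add_le _ _) ?_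
  simp [abs_of_pos hr, hz]

theorem disc_mean_a {n : ℕ} {J : Cn n → Cn n →L[ℝ] Cn n} {ε : ℝ} (hJ : Good J ε) {f : ℂ → Cn n}
    (hf : JDisc J (ball 0 1) f) {r : ℝ} (hr : 0 < r) (hr1 : r < 1) :
    ∫ θ in (-Real.pi)..Real.pi, ‖f (circleMap 0 r θ) - f 0‖ ^ 2 ≤ 8 * Real.pi * (1 - ‖f 0‖ ^ 2) := by
  have hpi := Real.pi_pos
  set a := f 0 with ha
  have ha1 : ‖a‖ < 1 := by simpa using hf.1 (show (0:ℂ) ∈ ball (0:ℂ) 1 by simp)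
  have hz : ‖(0:ℂ)‖ + r < 1 := by simpa using hr1
  have hc := disc_circle_cont hf hr hz
  have hbn : ‖-(1/3 : ℝ) • a‖ = 1 / 3 * ‖a‖ := by rw [norm_smul]; simp
  have key := disc_submean hJ hf hr hz (-(1/3 : ℝ) • a) (by rw [hbn]; linarith)
  have e0 : a - (-(1/3 : ℝ) • a) = (4/3 : ℝ) • a := by module
  rw [← ha, e0, norm_smul] at key
  have pt : ∀ θ : ℝ, ‖f (circleMap 0 r θ) - (-(1/3 : ℝ) • a)‖ ^ 2 ≤ 4 / 3 * (1 + ‖a‖ ^ 2 / 3) - (1 / 3) * ‖f (circleMap 0 r θ) - a‖ ^ 2 := by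
    intro θ
    set x := f (circleMap 0 r θ)
    have hx : ‖x‖ < 1 := by simpa using hf.1 (circleMap_mem hr hz θ)
    rw [norm_sub_sq_real, norm_sub_sq_real, hbn, inner_smul_right]
    nlinarith [norm_nonneg x]
  have hI : IntervalIntegrable (fun θ : ℝ => ‖f (circleMap 0 r θ) - a‖ ^ 2) volume (-Real.pi) Real.pi :=
    Continuous.intervalIntegrable ((hc.sub continuous_const).norm.pow 2) _ _
  have hI2 : IntervalIntegrable (fun θ : ℝ => ‖f (circleMap 0 r θ) - (-(1/3 : ℝ) • a)‖ ^ 2) volume (-Real.pi) Real.pi :=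
    Continuous.intervalIntegrable ((hc.sub continuous_const).norm.pow 2) _ _
  obtain ⟨K, hK⟩ : ∃ K : ℝ, K = 4 / 3 * (1 + ‖a‖ ^ 2 / 3) := ⟨_, rfl⟩
  rw [← hK] at pt
  have hI3 : IntervalIntegrable (fun θ : ℝ => K - (1 / 3) * ‖f (circleMap 0 r θ) - a‖ ^ 2) volume (-Real.pi) Real.pi :=
    (continuous_const.intervalIntegrable (μ := volume) (-Real.pi) Real.pi).sub (hI.const_mul (1 / 3))
  have big := intervalIntegral.integral_mono_on (μ := volume) (show -Real.pi ≤ Real.pi by linarith)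
    hI2 hI3 (fun θ _ => pt θ)
  rw [intervalIntegral.integral_sub (continuous_const.intervalIntegrable _ _) (hI.const_mul _), intervalIntegral.integral_const_mul, intervalIntegral.integral_const, smul_eq_mul] at big
  rw [hK] at big
  have : ‖(4/3:ℝ)‖ = 4/3 := by norm_num
  rw [this] at key
  nlinarith

theorem disc_mean_b {n : ℕ} {J : Cn n → Cn n →L[ℝ] Cn n} {ε : ℝ} (hJ : Good J ε) {f : ℂ → Cn n}
    (hf : JDisc J (ball 0 1) f) {r : ℝ} (hr : 0 < r) (hr1 : r < 1) :
    ∫ θ in (-Real.pi)..Real.pi, (1 - ‖f (circleMap 0 r θ)‖ ^ 2) ≤ 2 * Real.pi * (1 - ‖f 0‖ ^ 2) := by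
  have hpi := Real.pi_pos
  have hz : ‖(0:ℂ)‖ + r < 1 := by simpa using hr1
  have hc := disc_circle_cont hf hr hz
  have key := disc_submean hJ hf hr hz 0 (by simp)
  simp only [sub_zero] at key
  have hI : IntervalIntegrable (fun θ : ℝ => ‖f (circleMap 0 r θ)‖ ^ 2) volume (-Real.pi) Real.pi :=
    Continuous.intervalIntegrable (hc.norm.pow 2) _ _
  rw [intervalIntegral.integral_sub (by simp) hI, intervalIntegral.integral_const, smul_eq_mul]
  linarith

theorem disc_half {n : ℕ} {J : Cn n → Cn n →L[ℝ] Cn n} {ε : ℝ} (hJ : Good J ε) {f : ℂ → Cn n}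
    (hf : JDisc J (ball 0 1) f) {z : ℂ} (hz : ‖z‖ ≤ 1 / 2) : ‖f z - f 0‖ ≤ 4 * √(1 - ‖f 0‖ ^ 2) := by
  have hpi := Real.pi_pos
  have ha1 : ‖f 0‖ < 1 := by simpa using hf.1 (show (0:ℂ) ∈ ball (0:ℂ) 1 by simp)
  have hs : 0 < 1 - ‖f 0‖ ^ 2 := by nlinarith [norm_nonneg (f 0)]
  set g : ℂ → ℝ := (ball (0:ℂ) 1).indicator (fun w => ‖f w - f 0‖ ^ 2) with hg
  have hgc : ContinuousOn (fun w => ‖f w - f 0‖ ^ 2) (ball (0:ℂ) 1) := ((disc_cont hf).sub continuousOn_const).norm.pow 2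
  have hgm : Measurable g := by
    classical
    have := hgc.measurable_piecewise (continuousOn_const (c := (0:ℝ)) (s := (ball (0:ℂ) 1)ᶜ)) measurableSet_ball
    change Measurable ((ball (0:ℂ) 1).piecewise (fun w => ‖f w - f 0‖ ^ 2) 0) at this
    rwa [Set.piecewise_eq_indicator] at this
  have hgb : ∀ w, 0 ≤ g w ∧ g w ≤ 4 := by
    intro w
    by_cases hw : w ∈ ball (0:ℂ) 1
    · rw [hg, indicator_of_mem hw]
      have := norm_sub_lt_two (hf.1 hw) (hf.1 (show (0:ℂ) ∈ ball (0:ℂ) 1 by simp))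
      exact ⟨by positivity, by nlinarith [norm_nonneg (f w - f 0)]⟩
    · rw [hg, indicator_of_notMem hw]; norm_num
  have hgi : ∀ (c : ℂ) (R : ℝ), IntegrableOn g (ball c R) := by
    intro c R
    apply Measure.integrableOn_of_bounded (M := 4) measure_ball_lt_top.ne hgm.aestronglyMeasurable
    filter_upwards with w
    rw [Real.norm_eq_abs, abs_of_nonneg (hgb w).1]; exact (hgb w).2
  have e1 := area_ge (c := z) (R := 1 / 2) (A := 2 * Real.pi * ‖f z - f 0‖ ^ 2) (by norm_num) g hgm (hgi _ _) (by
    intro r hr hr1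
    have h1 : ‖z‖ + r < 1 := by linarith
    refine (disc_submean hJ hf hr h1 (f 0) ha1.le).trans (le_of_eq ?_)
    congr 1; ext θ
    rw [hg, indicator_of_mem (circleMap_mem hr h1 θ)])
  have e2 := area_le (c := 0) (R := 1) (A := 8 * Real.pi * (1 - ‖f 0‖ ^ 2)) one_pos g hgm (hgi _ _) (by
    intro r hr hr1
    have h1 : ‖(0:ℂ)‖ + r < 1 := by simpa using hr1
    refine le_trans (le_of_eq ?_) (disc_mean_a hJ hf hr hr1)
    congr 1; ext θ
    rw [hg, indicator_of_mem (circleMap_mem hr h1 θ)])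
  have e3 : ∫ ζ in ball z (1 / 2), g ζ ≤ ∫ ζ in ball 0 1, g ζ := by
    apply setIntegral_mono_set (hgi _ _)
    · filter_upwards with w using (hgb w).1
    · exact (ball_sub_unit (by linarith)).eventuallyLE
  have e4 : ‖f z - f 0‖ ^ 2 ≤ 16 * (1 - ‖f 0‖ ^ 2) := by nlinarith
  have e5 : (4 * √(1 - ‖f 0‖ ^ 2)) ^ 2 = 16 * (1 - ‖f 0‖ ^ 2) := by
    rw [mul_pow, Real.sq_sqrt hs.le]; norm_num
  rw [← e5] at e4
  exact le_of_pow_le_pow_left₀ (n := 2) (by norm_num) (by positivity) e4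

noncomputable def Ch : ℝ := 256 / dl0
theorem Ch_pos : 0 < Ch := div_pos (by norm_num) dl0_pos

theorem disc_quarter {n : ℕ} {J : Cn n → Cn n →L[ℝ] Cn n} {ε : ℝ} (hJ : Good J ε) {f : ℂ → Cn n}
    (hf : JDisc J (ball 0 1) f) {z : ℂ} (hz : ‖z‖ < 1 / 4) : ‖fderiv ℝ f z 1‖ ≤ Ch * √(1 - ‖f 0‖ ^ 2) ∧
      ‖f z - f 0‖ ≤ 3 * Ch * √(1 - ‖f 0‖ ^ 2) * ‖z‖ := by
  have ha1 : ‖f 0‖ < 1 := by simpa using hf.1 (show (0:ℂ) ∈ ball (0:ℂ) 1 by simp)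
  have hs : 0 < 1 - ‖f 0‖ ^ 2 := by nlinarith [norm_nonneg (f 0)]
  have hsq : 0 < √(1 - ‖f 0‖ ^ 2) := Real.sqrt_pos.2 hs
  have hsq1 : √(1 - ‖f 0‖ ^ 2) ≤ 1 := by
    rw [Real.sqrt_le_one]; nlinarith [norm_nonneg (f 0)]
  have hS := JDisc.sol hJ hf
  have gr : ∀ z ∈ ball (0:ℂ) (1 / 4), ‖fderiv ℝ f z 1‖ ≤ Ch * √(1 - ‖f 0‖ ^ 2) := by
    intro z hz
    have hz' : ‖z‖ < 1 / 4 := by simpa using hz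
    have := grad_fin (ρ := 1 / 4) (m := 8 * √(1 - ‖f 0‖ ^ 2)) (z0 := z) (by norm_num)
      (hS.mono (ball_sub_unit (by linarith))) (by positivity) (by
        have h1 := hJ.le; have h2 := hJ.pos; have h3 := dl0_pos
        nlinarith) (by
        intro w hw
        have h1 : ‖w‖ ≤ 1 / 2 := by
          have := norm_add_le (w - z) z
          rw [sub_add_cancel] at this; linarith
        have h2 := disc_half hJ hf h1
        have h3 := disc_half hJ hf (z := z) (by linarith)
        have h4 := norm_sub_le (f w - f 0) (f z - f 0)
        rw [sub_sub_sub_cancel_right] at h4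
        linarith)
    refine this.trans (le_of_eq ?_)
    unfold Ch; ring
  have hzb : z ∈ ball (0:ℂ) (1 / 4) := by simpa using hz
  refine ⟨gr z hzb, ?_⟩
  have := (hS.mono (ball_subset_ball (by norm_num : (1/4:ℝ) ≤ 1))).lipf (convex_ball 0 (1/4)) gr (show (0:ℂ) ∈ ball (0:ℂ) (1/4) by simp) hzb
  rw [sub_zero] at this
  linarith

theorem cauchy_deriv {G : ℂ → ℂ} {ρ M : ℝ} (hρ : 0 < ρ) (hM : 0 ≤ M) (hd : ∀ ζ, ‖ζ‖ ≤ ρ → DifferentiableAt ℝ G ζ)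
    (hG0 : G 0 = 0) (hb : ∀ ζ, ‖ζ‖ ≤ ρ → ‖dbar G ζ‖ ≤ M * ‖ζ‖) :
    ‖(∮ ζ in C(0, ρ), G ζ * (ζ ^ 2)⁻¹) - 2 * Real.pi * I * fderiv ℝ G 0 1‖ ≤ 8 * Real.pi * ρ * M := by
  have hpi := Real.pi_pos
  set A := fderiv ℝ G 0 1 with hA
  have hb0 : dbar G 0 = 0 := by
    have := hb 0 (by simpa using hρ.le)
    simpa using this
  have hL : ∀ w, fderiv ℝ G 0 w = A * w := by
    intro w
    have h1 := fderiv_split (g := G) (z := 0) (w := 1)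
    have h2 := fderiv_split (g := G) (z := 0) (w := w)
    rw [hb0] at h1 h2
    rw [h2, hA]
    simp only [mul_one, zero_mul, add_zero] at h1 ⊢
    rw [← h1]
  apply _root_.le_of_forall_pos_le_add
  intro η hη
  have ho := (hd 0 (by simpa using hρ.le)).hasFDerivAt.isLittleO
  have ho' := ho.def (c := η / (2 * Real.pi)) (by positivity)
  obtain ⟨δ, hδ, hball⟩ := Metric.eventually_nhds_iff_ball.1 ho'
  set r := min (δ / 2) ρ with hr
  have hr0 : 0 < r := lt_min (by linarith) hρ
  have hrρ : r ≤ ρ := min_le_right _ _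
  have hrδ : r < δ := lt_of_le_of_lt (min_le_left _ _) (by linarith)
  have hGc : ∀ ζ, ‖ζ‖ ≤ ρ → ContinuousAt G ζ := fun ζ hζ => (hd ζ hζ).continuousAt
  have hhd : ∀ ζ : ℂ, ζ ≠ 0 → DifferentiableAt ℂ (fun ζ : ℂ => (ζ ^ 2)⁻¹) ζ := by
    intro ζ hζ
    exact (differentiableAt_id.pow 2).fun_inv (pow_ne_zero 2 hζ)
  have hik := inv_kernel_ball 0 0 hρ.le (by simpa using hρ.le)
  have e1 := green_annulus (c := 0) hr0.le hrρ (fun ζ => G ζ * (ζ ^ 2)⁻¹) ∅ countable_empty (by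
      intro ζ hζ
      simp only [sub_zero, mem_setOf_eq] at hζ
      have hne : ζ ≠ 0 := by rintro rfl; simp at hζ; linarith
      exact ((hGc ζ hζ.2).mul (hhd ζ hne).continuousAt).continuousWithinAt) (by
      intro ζ _ h1 h2
      rw [sub_zero] at h1 h2
      have hne : ζ ≠ 0 := by rintro rfl; simp at h1; linarith
      exact (hd ζ h2.le).mul ((hhd ζ hne).restrictScalars ℝ))
    (fun ζ => M * ‖ζ - 0‖⁻¹) (by fun_prop) (hik.1.const_mul _) (by intro ζ; positivity) (by
      intro ζ _ h1 h2
      rw [sub_zero] at h1 h2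
      have hne : ζ ≠ 0 := by rintro rfl; simp at h1; linarith
      rw [dbar_mul_hol (hd ζ h2.le) (hhd ζ hne), norm_mul, norm_inv, norm_pow, sub_zero]
      have hp : 0 < ‖ζ‖ := norm_pos_iff.2 hne
      calc ‖dbar G ζ‖ * (‖ζ‖ ^ 2)⁻¹ ≤ (M * ‖ζ‖) * (‖ζ‖ ^ 2)⁻¹ := by gcongr; exact hb ζ h2.le
        _ = M * ‖ζ‖⁻¹ := by field_simp)
  rw [integral_const_mul] at e1
  have e2 : ‖(∮ ζ in C(0, r), G ζ * (ζ ^ 2)⁻¹) - 2 * Real.pi * I * A‖ ≤ η := by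
    have hsz : ∀ ζ ∈ sphere (0:ℂ) r, ‖ζ‖ = r ∧ ζ ≠ 0 := by
      intro ζ hζ
      have : ‖ζ‖ = r := by simpa using hζ
      exact ⟨this, by rintro rfl; simp at this; linarith⟩
    have i1 : CircleIntegrable (fun ζ => G ζ * (ζ ^ 2)⁻¹) 0 r := by
      apply ContinuousOn.circleIntegrable hr0.le
      intro ζ hζ
      obtain ⟨h1, h2⟩ := hsz ζ hζ
      exact ((hGc ζ (by linarith)).mul (hhd ζ h2).continuousAt).continuousWithinAt
    have i2 : CircleIntegrable (fun ζ => A * (ζ - 0)⁻¹) 0 r := by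
      apply ContinuousOn.circleIntegrable hr0.le
      apply continuousOn_const.mul
      apply ContinuousOn.inv₀ (by fun_prop)
      intro ζ hζ
      simpa using (hsz ζ hζ).2
    have : 2 * Real.pi * I * A = ∮ ζ in C(0, r), A * (ζ - 0)⁻¹ := by
      rw [circleIntegral.integral_const_mul, circleIntegral.integral_sub_inv_of_mem_ball (by simpa using hr0)]
      ring
    rw [this, ← circleIntegral.integral_sub i1 i2]
    refine (circleIntegral.norm_integral_le_of_norm_le_const (C := η / (2 * Real.pi) * r⁻¹) hr0.le ?_).trans (le_of_eq ?_)
    · intro ζ hζ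
      obtain ⟨h1, h2⟩ := hsz ζ hζ
      have h3 := hball ζ (by rw [mem_ball, dist_zero_right]; linarith)
      rw [hG0, sub_zero, sub_zero, hL, h1] at h3
      have : G ζ * (ζ ^ 2)⁻¹ - A * (ζ - 0)⁻¹ = (G ζ - A * ζ) * (ζ ^ 2)⁻¹ := by
        rw [sub_zero]; field_simp
      rw [this, norm_mul, norm_inv, norm_pow, h1]
      calc ‖G ζ - A * ζ‖ * (r ^ 2)⁻¹ ≤ (η / (2 * Real.pi) * r) * (r ^ 2)⁻¹ := by gcongr
        _ = _ := by field_simp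
    · field_simp
  have := norm_add_le ((∮ ζ in C(0, ρ), G ζ * (ζ ^ 2)⁻¹) - (∮ ζ in C(0, r), G ζ * (ζ ^ 2)⁻¹)) ((∮ ζ in C(0, r), G ζ * (ζ ^ 2)⁻¹) - 2 * Real.pi * I * A)
  rw [sub_add_sub_cancel] at this
  have h5 := mul_le_mul_of_nonneg_left hik.2 (by positivity : 0 ≤ 2 * M)
  nlinarith

theorem grad_re {G : ℂ → ℂ} {ρ M : ℝ} (hρ : 0 < ρ) (hM : 0 ≤ M) (hd : ∀ ζ, ‖ζ‖ ≤ ρ → DifferentiableAt ℝ G ζ)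
    (hG0 : G 0 = 0) (hb : ∀ ζ, ‖ζ‖ ≤ ρ → ‖dbar G ζ‖ ≤ M * ‖ζ‖) :
    2 * Real.pi * ‖fderiv ℝ G 0 1‖ ≤ 10 * Real.pi * ρ * M + 2 / ρ * ∫ θ in (-Real.pi)..Real.pi, |(G (circleMap 0 ρ θ)).re| := by
  have hpi := Real.pi_pos
  have h1 := cauchy_deriv hρ hM hd hG0 hb
  have hball : {ζ : ℂ | 0 ≤ ‖ζ - 0‖ ∧ ‖ζ - 0‖ ≤ ρ} = {ζ | ‖ζ‖ ≤ ρ} := by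
    ext ζ; simp
  have h2 := green_annulus (c := 0) le_rfl hρ.le G ∅ countable_empty
    (by rw [hball]; exact fun ζ hζ => (hd ζ hζ).continuousAt.continuousWithinAt)
    (by intro ζ _ _ h; rw [sub_zero] at h; exact hd ζ h.le)
    (fun _ => M * ρ) measurable_const (integrableOn_const measure_ball_lt_top.ne) (by intro ζ; positivity)
    (by
      intro ζ _ _ h; rw [sub_zero] at h
      exact (hb ζ h.le).trans (by gcongr))
  rw [circleIntegral.integral_radius_zero, sub_zero, setIntegral_const, smul_eq_mul, measureReal_def, Complex.volume_ball, circleIntegral_eq_pi] at h2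
  rw [circleIntegral_eq_pi] at h1
  have hv : (ENNReal.ofReal ρ ^ 2 * (NNReal.pi : ℝ≥0∞)).toReal = ρ ^ 2 * Real.pi := by
    rw [ENNReal.toReal_mul, ENNReal.toReal_pow, ENNReal.toReal_ofReal hρ.le]; rfl
  rw [hv] at h2
  have hGc : Continuous (fun θ : ℝ => G (circleMap 0 ρ θ)) := by
    rw [continuous_iff_continuousAt]
    intro θ
    exact ContinuousAt.comp (f := fun θ : ℝ => circleMap 0 ρ θ) (g := G) (hd _ (by simp [abs_of_pos hρ])).continuousAt (continuous_circleMap 0 ρ).continuousAt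
  set X := ∫ θ in (-Real.pi)..Real.pi, exp (-(θ * I)) * G (circleMap 0 ρ θ) with hX
  set Y := ∫ θ in (-Real.pi)..Real.pi, exp (θ * I) * G (circleMap 0 ρ θ) with hY
  have eX : ∀ θ : ℝ, (ρ * exp (θ * I)) * (G (circleMap 0 ρ θ) * ((circleMap 0 ρ θ) ^ 2)⁻¹) = (ρ : ℂ)⁻¹ * (exp (-(θ * I)) * G (circleMap 0 ρ θ)) := by
    intro θ
    have : (ρ : ℂ) ≠ 0 := by exact_mod_cast hρ.ne'
    rw [Complex.exp_neg, circleMap, zero_add]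
    have := Complex.exp_ne_zero (θ * I)
    field_simp
  simp_rw [eX] at h1
  simp_rw [mul_assoc (ρ : ℂ)] at h2
  rw [intervalIntegral.integral_const_mul, ← hX] at h1
  rw [intervalIntegral.integral_const_mul, ← hY] at h2
  rw [norm_mul, norm_mul, norm_I, Complex.norm_real, Real.norm_eq_abs, abs_of_pos hρ, one_mul] at h2
  have cY : (starRingEnd ℂ) Y = ∫ θ in (-Real.pi)..Real.pi, exp (-(θ * I)) * (starRingEnd ℂ) (G (circleMap 0 ρ θ)) := by
    rw [hY, intervalIntegral.integral_of_le (by linarith), intervalIntegral.integral_of_le (by linarith), ← integral_conj]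
    congr 1; ext θ
    rw [map_mul, ← Complex.exp_conj]
    simp
  have hex : Continuous (fun θ : ℝ => exp (-(θ * I))) := by fun_prop
  have iX : IntervalIntegrable (fun θ : ℝ => exp (-(θ * I)) * G (circleMap 0 ρ θ)) volume (-Real.pi) Real.pi :=
    Continuous.intervalIntegrable (hex.mul hGc) _ _
  have iY : IntervalIntegrable (fun θ : ℝ => exp (-(θ * I)) * (starRingEnd ℂ) (G (circleMap 0 ρ θ))) volume (-Real.pi) Real.pi :=
    Continuous.intervalIntegrable (hex.mul (Complex.continuous_conj.comp hGc)) _ _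
  have XY : ‖X + (starRingEnd ℂ) Y‖ ≤ 2 * ∫ θ in (-Real.pi)..Real.pi, |(G (circleMap 0 ρ θ)).re| := by
    rw [cY, hX, ← intervalIntegral.integral_add iX iY, ← intervalIntegral.integral_const_mul]
    apply intervalIntegral.norm_integral_le_of_norm_le (by linarith)
    · filter_upwards with θ _
      rw [← mul_add, Complex.add_conj, norm_mul, Complex.norm_real, Real.norm_eq_abs, abs_mul]
      have : ‖exp (-(θ * I))‖ = 1 := by
        have := Complex.norm_exp_ofReal_mul_I (-θ)
        simpa using this
      rw [this, abs_two, one_mul]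
    · exact Continuous.intervalIntegrable (continuous_const.mul (Complex.continuous_re.comp hGc).abs) _ _
  have hYn : ‖Y‖ ≤ 2 * Real.pi * ρ ^ 2 * M := by
    have : ρ * ‖Y‖ ≤ ρ * (2 * Real.pi * ρ ^ 2 * M) := by linarith
    exact le_of_mul_le_mul_left this hρ
  have hXn : ‖X‖ ≤ 2 * Real.pi * ρ ^ 2 * M + 2 * ∫ θ in (-Real.pi)..Real.pi, |(G (circleMap 0 ρ θ)).re| := by
    have := norm_sub_le (X + (starRingEnd ℂ) Y) ((starRingEnd ℂ) Y)
    rw [add_sub_cancel_right, RCLike.norm_conj] at this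
    linarith
  have hfin := norm_sub_le (I * ((ρ : ℂ)⁻¹ * X)) (I * ((ρ : ℂ)⁻¹ * X) - 2 * Real.pi * I * fderiv ℝ G 0 1)
  rw [_root_.sub_sub_cancel, norm_mul, norm_mul, norm_mul, norm_mul, norm_mul, norm_inv, norm_I, Complex.norm_real, Complex.norm_real, Real.norm_eq_abs, Real.norm_eq_abs, abs_of_pos hρ, abs_of_pos hpi] at hfin
  have e2 : ‖(2:ℂ)‖ = 2 := by simp
  rw [e2] at hfin
  have : ρ⁻¹ * ‖X‖ ≤ ρ⁻¹ * (2 * Real.pi * ρ ^ 2 * M + 2 * ∫ θ in (-Real.pi)..Real.pi, |(G (circleMap 0 ρ θ)).re|) := by gcongr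
  have e3 : ρ⁻¹ * (2 * Real.pi * ρ ^ 2 * M + 2 * ∫ θ in (-Real.pi)..Real.pi, |(G (circleMap 0 ρ θ)).re|) = 2 * Real.pi * ρ * M + 2 / ρ * ∫ θ in (-Real.pi)..Real.pi, |(G (circleMap 0 ρ θ)).re| := by
    field_simp
  rw [e3] at this
  linarith

noncomputable def Cn2 : ℝ := 12 * Ch ^ 2 + 30
theorem Cn2_pos : 0 < Cn2 := by unfold Cn2; positivity

theorem disc_normal {n : ℕ} {J : Cn n → Cn n →L[ℝ] Cn n} {ε : ℝ} (hJ : Good J ε) {f : ℂ → Cn n}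
    (hf : JDisc J (ball 0 1) f) : |inner ℝ (f 0) (fderiv ℝ f 0 1)| ≤ Cn2 * (1 - ‖f 0‖ ^ 2) := by
  have hpi := Real.pi_pos
  have h0 : (0:ℂ) ∈ ball (0:ℂ) 1 := by simp
  have ha1 : ‖f 0‖ < 1 := by simpa using hf.1 h0
  have hs : 0 < 1 - ‖f 0‖ ^ 2 := by nlinarith [norm_nonneg (f 0)]
  have hS := JDisc.sol hJ hf
  have hin : ∀ ζ : ℂ, ‖ζ‖ ≤ 1 / 5 → ζ ∈ ball (0:ℂ) 1 := by
    intro ζ hζ; rw [mem_ball, dist_zero_right]; linarith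
  have key := grad_re (G := fun ζ => Lam (f 0) (J (f 0)) (f ζ - f 0)) (ρ := 1 / 5) (M := 12 * Ch ^ 2 * (1 - ‖f 0‖ ^ 2))
    (by norm_num) (by positivity)
    (fun ζ hζ => (dbar_lam hS h0 (hin ζ hζ) (f 0) (by linarith)).1.differentiableAt) (by simp) (by
      intro ζ hζ
      refine (dbar_lam hS h0 (hin ζ hζ) (f 0) (by linarith)).2.trans ?_
      obtain ⟨h1, h2⟩ := disc_quarter hJ hf (z := ζ) (by linarith)
      have h3 := Real.sq_sqrt hs.le
      have h4 := hJ.le'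
      have h5 := hJ.pos
      have h6 := Ch_pos
      calc 4 * ε * ‖f ζ - f 0‖ * ‖fderiv ℝ f ζ 1‖ ≤ 4 * 1 * (3 * Ch * √(1 - ‖f 0‖ ^ 2) * ‖ζ‖) * (Ch * √(1 - ‖f 0‖ ^ 2)) := by
            gcongr; linarith
        _ = 12 * Ch ^ 2 * (√(1 - ‖f 0‖ ^ 2) ^ 2) * ‖ζ‖ := by ring
        _ = _ := by rw [h3])
  have hfd := (dbar_lam hS h0 h0 (f 0) (by linarith)).1.fderiv
  rw [hfd] at key
  have hz : ‖(0:ℂ)‖ + 1 / 5 < 1 := by norm_num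
  have hc := disc_circle_cont hf (show (0:ℝ) < 1 / 5 by norm_num) hz
  have hI1 : IntervalIntegrable (fun θ : ℝ => ‖f (circleMap 0 (1 / 5) θ) - f 0‖ ^ 2) volume (-Real.pi) Real.pi :=
    Continuous.intervalIntegrable ((hc.sub continuous_const).norm.pow 2) _ _
  have hI2 : IntervalIntegrable (fun θ : ℝ => 1 - ‖f (circleMap 0 (1 / 5) θ)‖ ^ 2) volume (-Real.pi) Real.pi :=
    Continuous.intervalIntegrable (continuous_const.sub (hc.norm.pow 2)) _ _
  have hI3 : IntervalIntegrable (fun _ : ℝ => (1 - ‖f 0‖ ^ 2)) volume (-Real.pi) Real.pi := continuous_const.intervalIntegrable _ _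
  have hI4 : IntervalIntegrable (fun θ : ℝ => |(Lam (f 0) (J (f 0)) (f (circleMap 0 (1 / 5) θ) - f 0)).re|) volume (-Real.pi) Real.pi := by
    apply Continuous.intervalIntegrable
    exact (Complex.continuous_re.comp ((Lam (f 0) (J (f 0))).continuous.comp (hc.sub continuous_const))).abs
  have hbd : ∫ θ in (-Real.pi)..Real.pi, |(Lam (f 0) (J (f 0)) (f (circleMap 0 (1 / 5) θ) - f 0)).re| ≤ 6 * Real.pi * (1 - ‖f 0‖ ^ 2) := by
    have hm := intervalIntegral.integral_mono_on (μ := volume) (show -Real.pi ≤ Real.pi by linarith) hI4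
      (((hI2.add hI3).add hI1).const_mul (1 / 2)) (by
        intro θ _
        rw [Lam_re]
        set x := f (circleMap 0 (1 / 5) θ)
        have hx : ‖x‖ < 1 := mem_ball_zero_iff.1 (hf.1 (circleMap_mem (by norm_num) hz θ))
        have e := norm_add_sq_real (f 0) (x - f 0)
        rw [add_sub_cancel] at e
        have h1 : ‖x‖ ^ 2 < 1 := by nlinarith [norm_nonneg x]
        rw [abs_le]
        constructor <;> nlinarith [sq_nonneg ‖x - f 0‖])
    rw [intervalIntegral.integral_const_mul, intervalIntegral.integral_add (hI2.add hI3) hI1, intervalIntegral.integral_add hI2 hI3] at hm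
    have h1 := disc_mean_a hJ hf (r := 1 / 5) (by norm_num) (by norm_num)
    have h2 := disc_mean_b hJ hf (r := 1 / 5) (by norm_num) (by norm_num)
    rw [intervalIntegral.integral_const, smul_eq_mul] at hm
    linarith
  have hre : |inner ℝ (f 0) (fderiv ℝ f 0 1)| ≤ ‖((Lam (f 0) (J (f 0))).comp (fderiv ℝ f 0)) 1‖ := by
    rw [← Lam_re (f 0) (J (f 0))]
    exact Complex.abs_re_le_norm _
  have : 2 * Real.pi * |inner ℝ (f 0) (fderiv ℝ f 0 1)| ≤ 2 * Real.pi * (Cn2 * (1 - ‖f 0‖ ^ 2)) := by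
    have h1 := mul_le_mul_of_nonneg_left hre (by positivity : 0 ≤ 2 * Real.pi)
    unfold Cn2
    have e5 : (2:ℝ) / (1 / 5) = 10 := by norm_num
    rw [e5] at key
    linarith
  exact le_of_mul_le_mul_left this (by positivity)

theorem kob_lower {n : ℕ} {J : Cn n → Cn n →L[ℝ] Cn n} {ε : ℝ} (hJ : Good J ε) {p v : Cn n} {α : ℝ}
    (hα : α ∈ kobSet J (ball 0 1) p v) : ‖v‖ ≤ Cg * α ∧ |inner ℝ p v| ≤ Cn2 * (1 - ‖p‖ ^ 2) * α := by
  obtain ⟨hα, f, hf, h0, h1⟩ := hα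
  have hv : v = α • fderiv ℝ f 0 1 := by rw [h1, smul_smul, mul_inv_cancel₀ hα.ne', one_smul]
  have g1 := disc_grad hJ hf (z0 := 0) (d := 1) one_pos (by simp)
  have g2 := disc_normal hJ hf
  rw [h0] at g2
  rw [hv, norm_smul, Real.norm_eq_abs, abs_of_pos hα, inner_smul_right, abs_mul, abs_of_pos hα]
  rw [div_one] at g1
  exact ⟨by nlinarith, by nlinarith⟩

theorem kern {z z0 : ℂ} (hne : z ≠ z0) :
    Integrable (fun ζ : ℂ => ‖ζ - z‖⁻¹ * ‖ζ - z0‖ ^ (-(3/2) : ℝ)) ∧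
    ∫ ζ, ‖ζ - z‖⁻¹ * ‖ζ - z0‖ ^ (-(3/2) : ℝ) ≤ 30 * Real.pi * (√‖z - z0‖)⁻¹ := by
  have hpi := Real.pi_pos
  obtain ⟨h, hh⟩ : ∃ h : ℝ, h = ‖z - z0‖ / 2 := ⟨_, rfl⟩
  have hd : ‖z - z0‖ = 2 * h := by linarith
  have h0 : 0 < h := by rw [hh]; have := norm_pos_iff.2 (sub_ne_zero.2 hne); linarith
  have k1 := rpow_ball z (R := h) (a := -1) h0.le (by norm_num)
  have k2 := rpow_ball z0 (R := 2 * h) (a := -(3/2)) (by linarith) (by norm_num)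
  have k3 := rpow_ext z0 (R := h) (a := -(5/2)) h0 (by norm_num)
  have m3 : MeasurableSet {ζ : ℂ | h < ‖ζ - z0‖} := by
    apply measurableSet_lt <;> fun_prop
  set A : ℂ → ℝ := (ball z h).indicator (fun ζ => h ^ (-(3/2) : ℝ) * ‖ζ - z‖ ^ (-1 : ℝ)) with hA
  set B : ℂ → ℝ := (ball z0 (2 * h)).indicator (fun ζ => h⁻¹ * ‖ζ - z0‖ ^ (-(3/2) : ℝ)) with hB
  set C : ℂ → ℝ := {ζ : ℂ | h < ‖ζ - z0‖}.indicator (fun ζ => 3 * ‖ζ - z0‖ ^ (-(5/2) : ℝ)) with hC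
  have iA : Integrable A := (integrable_indicator_iff measurableSet_ball).2 (k1.1.const_mul _)
  have iB : Integrable B := (integrable_indicator_iff measurableSet_ball).2 (k2.1.const_mul _)
  have iC : Integrable C := (integrable_indicator_iff m3).2 (k3.1.const_mul _)
  have vA : ∫ ζ, A ζ = h ^ (-(3/2) : ℝ) * (2 * Real.pi * (h ^ ((-1:ℝ) + 2) / (-1 + 2))) := by
    rw [hA, integral_indicator measurableSet_ball, integral_const_mul, k1.2]
  have vB : ∫ ζ, B ζ = h⁻¹ * (2 * Real.pi * ((2 * h) ^ (-(3/2) + 2 : ℝ) / (-(3/2) + 2))) := by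
    rw [hB, integral_indicator measurableSet_ball, integral_const_mul, k2.2]
  have vC : ∫ ζ, C ζ = 3 * (2 * Real.pi * (-h ^ (-(5/2) + 2 : ℝ) / (-(5/2) + 2))) := by
    rw [hC, integral_indicator m3, integral_const_mul, k3.2]
  have nA : ∀ ζ, 0 ≤ A ζ := fun ζ => indicator_nonneg (fun _ _ => by positivity) _
  have nB : ∀ ζ, 0 ≤ B ζ := fun ζ => indicator_nonneg (fun _ _ => by positivity) _
  have nC : ∀ ζ, 0 ≤ C ζ := fun ζ => indicator_nonneg (fun _ _ => by positivity) _
  have pt : ∀ ζ : ℂ, ‖ζ - z‖⁻¹ * ‖ζ - z0‖ ^ (-(3/2) : ℝ) ≤ A ζ + B ζ + C ζ := by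
    intro ζ
    have tri : 2 * h ≤ ‖ζ - z‖ + ‖ζ - z0‖ := by
      rw [← hd]
      have := norm_sub_le (ζ - z0) (ζ - z)
      rw [show ζ - z0 - (ζ - z) = z - z0 by ring] at this
      linarith
    have tri2 : ‖ζ - z0‖ ≤ ‖ζ - z‖ + 2 * h := by
      rw [← hd]
      have := norm_add_le (ζ - z) (z - z0)
      rwa [sub_add_sub_cancel] at this
    by_cases c1 : ‖ζ - z‖ < h
    · have : A ζ = h ^ (-(3/2) : ℝ) * ‖ζ - z‖ ^ (-1 : ℝ) := by
        rw [hA, indicator_of_mem]; rwa [mem_ball, dist_eq_norm]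
      rw [Real.rpow_neg_one] at this
      have h2 : ‖ζ - z0‖ ^ (-(3/2) : ℝ) ≤ h ^ (-(3/2) : ℝ) :=
        Real.rpow_le_rpow_of_nonpos h0 (by linarith) (by norm_num)
      have h3 : ‖ζ - z‖⁻¹ * ‖ζ - z0‖ ^ (-(3/2) : ℝ) ≤ ‖ζ - z‖⁻¹ * h ^ (-(3/2) : ℝ) := by gcongr
      linarith [nB ζ, nC ζ]
    · push Not at c1
      by_cases c2 : ‖ζ - z0‖ < 2 * h
      · have : B ζ = h⁻¹ * ‖ζ - z0‖ ^ (-(3/2) : ℝ) := by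
          rw [hB, indicator_of_mem]; rwa [mem_ball, dist_eq_norm]
        have h3 : ‖ζ - z‖⁻¹ * ‖ζ - z0‖ ^ (-(3/2) : ℝ) ≤ h⁻¹ * ‖ζ - z0‖ ^ (-(3/2) : ℝ) := by gcongr
        linarith [nA ζ, nC ζ]
      · push Not at c2
        have b0 : 0 < ‖ζ - z0‖ := by linarith
        have : C ζ = 3 * ‖ζ - z0‖ ^ (-(5/2) : ℝ) := by
          rw [hC, indicator_of_mem]; simp only [mem_setOf_eq]; linarith
        have e : ‖ζ - z0‖ ^ (-(5/2) : ℝ) = ‖ζ - z0‖⁻¹ * ‖ζ - z0‖ ^ (-(3/2) : ℝ) := by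
          rw [← Real.rpow_neg_one, ← Real.rpow_add b0]; norm_num
        have h4 : ‖ζ - z‖⁻¹ ≤ 3 * ‖ζ - z0‖⁻¹ := by
          rw [inv_le_comm₀ (by linarith) (by positivity), mul_inv, inv_inv]
          linarith
        have h3 : ‖ζ - z‖⁻¹ * ‖ζ - z0‖ ^ (-(3/2) : ℝ) ≤ 3 * ‖ζ - z0‖⁻¹ * ‖ζ - z0‖ ^ (-(3/2) : ℝ) := by gcongr
        linarith [nA ζ, nB ζ]
  have hIntg : Integrable (fun ζ : ℂ => ‖ζ - z‖⁻¹ * ‖ζ - z0‖ ^ (-(3/2) : ℝ)) := by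
    apply ((iA.add iB).add iC).mono'
    · apply Measurable.aestronglyMeasurable
      fun_prop
    · filter_upwards with ζ
      rw [Real.norm_eq_abs, abs_of_nonneg (by positivity)]
      exact pt ζ
  refine ⟨hIntg, ?_⟩
  have hm := integral_mono hIntg ((iA.add iB).add iC) pt
  have hs : ∫ ζ, ((A + B) + C) ζ = (∫ ζ, A ζ) + (∫ ζ, B ζ) + ∫ ζ, C ζ := by
    rw [integral_add' (iA.add iB) iC, integral_add' iA iB]
  rw [hs, vA, vB, vC] at hm
  refine hm.trans ?_
  have s0 : 0 < √h := Real.sqrt_pos.2 h0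
  have ss : √h ^ 2 = h := Real.sq_sqrt h0.le
  have e1 : h ^ (-(3/2) : ℝ) = (√h)⁻¹ * h⁻¹ := by
    rw [Real.sqrt_eq_rpow, ← Real.rpow_neg h0.le, ← Real.rpow_neg_one h, ← Real.rpow_add h0]; norm_num
  have e2 : h ^ ((-1:ℝ) + 2) = h := by norm_num
  have e3 : (2 * h) ^ (-(3/2) + 2 : ℝ) = √2 * √h := by
    rw [← Real.sqrt_mul (by norm_num), Real.sqrt_eq_rpow]; norm_num
  have e4 : h ^ (-(5/2) + 2 : ℝ) = (√h)⁻¹ := by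
    rw [Real.sqrt_eq_rpow, ← Real.rpow_neg h0.le]; norm_num
  rw [e1, e2, e3, e4, hd, Real.sqrt_mul (by norm_num)]
  have q1 : √2 ^ 2 = 2 := Real.sq_sqrt (by norm_num)
  have q0 : 0 < √2 := by positivity
  have q2 : √2 ≤ 3 / 2 := by
    rw [Real.sqrt_le_left (by norm_num)]; norm_num
  have E1 : (√h)⁻¹ * h⁻¹ * (2 * Real.pi * (h / (-1 + 2))) + h⁻¹ * (2 * Real.pi * (√2 * √h / (-(3/2) + 2))) + 3 * (2 * Real.pi * (-(√h)⁻¹ / (-(5/2) + 2)))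
     = (√h)⁻¹ * (Real.pi * (14 + 4 * √2)) := by
    have : h⁻¹ * √h = (√h)⁻¹ := by
      nth_rewrite 1 [← ss]; field_simp
    have t1 : h⁻¹ * (2 * Real.pi * (√2 * √h / (-(3/2) + 2))) = 4 * Real.pi * √2 * (h⁻¹ * √h) := by ring
    rw [t1, this]
    field_simp
    ring
  rw [E1, mul_inv]
  have : Real.pi * (14 + 4 * √2) ≤ 30 * Real.pi * (√2)⁻¹ := by
    rw [← div_eq_mul_inv, le_div_iff₀ q0]
    nlinarith
  calc (√h)⁻¹ * (Real.pi * (14 + 4 * √2)) ≤ (√h)⁻¹ * (30 * Real.pi * (√2)⁻¹) := by gcongr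
    _ = _ := by ring

theorem circle_inv {z : ℂ} {r : ℝ} (hr : 0 < r) (hne : ‖z‖ ≠ r) :
    ∫ θ in (-Real.pi)..Real.pi, (circleMap 0 r θ - z)⁻¹ = if r < ‖z‖ then -(2 * Real.pi) / z else 0 := by
  have hpi := Real.pi_pos
  have hs : ∀ ζ ∈ sphere (0:ℂ) r, ζ ≠ 0 ∧ ζ - z ≠ 0 := by
    intro ζ hζ
    have h1 : ‖ζ‖ = r := by simpa using hζ
    constructor
    · rintro rfl; simp at h1; linarith
    · intro h; rw [sub_eq_zero.1 h] at h1; exact hne h1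
  have e1 := circleIntegral_eq_pi (fun ζ => (ζ - z)⁻¹ * ζ⁻¹) 0 r
  have e2 : ∀ θ : ℝ, (r * exp (θ * I)) * ((circleMap 0 r θ - z)⁻¹ * (circleMap 0 r θ)⁻¹) = (circleMap 0 r θ - z)⁻¹ := by
    intro θ
    have : circleMap 0 r θ = r * exp (θ * I) := by simp [circleMap]
    rw [← this]
    have h0 : circleMap 0 r θ ≠ 0 := circleMap_ne_center hr.ne'
    field_simp
  simp_rw [e2] at e1
  have ci1 : CircleIntegrable (fun ζ : ℂ => (ζ - z)⁻¹) 0 r := by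
    apply ContinuousOn.circleIntegrable hr.le
    exact ContinuousOn.inv₀ (by fun_prop) (fun ζ hζ => (hs ζ hζ).2)
  have ci2 : CircleIntegrable (fun ζ : ℂ => (ζ - 0)⁻¹) 0 r := by
    apply ContinuousOn.circleIntegrable hr.le
    exact ContinuousOn.inv₀ (by fun_prop) (fun ζ hζ => by simpa using (hs ζ hζ).1)
  have c0 : (∮ ζ in C(0, r), (ζ - 0)⁻¹) = 2 * Real.pi * I := circleIntegral.integral_sub_inv_of_mem_ball (by simpa using hr)
  have key : z ≠ 0 → (∮ ζ in C(0, r), (ζ - z)⁻¹ * ζ⁻¹) = z⁻¹ * ((∮ ζ in C(0, r), (ζ - z)⁻¹) - 2 * Real.pi * I) := by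
    intro hz
    rw [← c0, ← circleIntegral.integral_sub ci1 ci2, ← circleIntegral.integral_const_mul]
    apply circleIntegral.integral_congr hr.le
    intro ζ hζ
    obtain ⟨h1, h2⟩ := hs ζ hζ
    simp only [sub_zero]
    field_simp
    ring
  have hI : I ≠ 0 := Complex.I_ne_zero
  split_ifs with hlt
  · have hz : z ≠ 0 := by rintro rfl; simp at hlt; linarith
    have c1 : (∮ ζ in C(0, r), (ζ - z)⁻¹) = 0 := by
      apply circleIntegral_eq_zero_of_differentiable_on_off_countable hr.le countable_empty
      · apply ContinuousOn.inv₀ (by fun_prop)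
        intro ζ hζ h
        rw [sub_eq_zero.1 h] at hζ
        simp at hζ; linarith
      · intro ζ hζ
        apply DifferentiableAt.fun_inv (by fun_prop)
        intro h
        rw [sub_eq_zero.1 h] at hζ
        simp at hζ; linarith
    rw [key hz, c1] at e1
    apply mul_left_cancel₀ hI
    rw [← e1]
    field_simp
    ring
  · have hlt' : ‖z‖ < r := lt_of_le_of_ne (not_lt.1 hlt) hne
    apply mul_left_cancel₀ hI
    rw [← e1, mul_zero]
    by_cases hz : z = 0
    · subst hz
      have : ∀ ζ : ℂ, (ζ - 0)⁻¹ * ζ⁻¹ = (ζ - 0) ^ (-2 : ℤ) := by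
        intro ζ
        rw [sub_zero, zpow_neg, ← mul_inv]; norm_cast; rw [pow_two]
      simp_rw [this]
      exact circleIntegral.integral_sub_zpow_of_ne (by norm_num) 0 0 r
    · rw [key hz, circleIntegral.integral_sub_inv_of_mem_ball (by simpa using hlt'), sub_self, mul_zero]

theorem T_one {z : ℂ} (hz : ‖z‖ < 1) : ∫ ζ in ball (0:ℂ) 1, (ζ - z)⁻¹ = -(Real.pi * (starRingEnd ℂ) z) := by
  have hpi := Real.pi_pos
  have hk := inv_kernel_ball 0 z zero_le_one (by simpa using hz.le)
  have hi := polar_integrable 0 1 (fun ζ => ‖ζ - z‖⁻¹) (by fun_prop) hk.1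
  have h2 := polar_integral 0 1 (fun ζ => (ζ - z)⁻¹)
  have hi2 : IntegrableOn (fun x : ℝ × ℝ => x.1 • (circleMap 0 x.1 x.2 - z)⁻¹) (Ioo (0:ℝ) 1 ×ˢ Ioo (-Real.pi) Real.pi) := by
    have hm := measurable_circleMap2 0
    apply Integrable.mono' (Integrable.norm hi)
    · apply Measurable.aestronglyMeasurable
      exact measurable_fst.smul (hm.sub_const z).inv
    · filter_upwards with x
      rw [norm_smul, norm_mul, norm_inv, norm_inv, norm_norm]
  rw [← h2, Measure.volume_eq_prod, ← Measure.prod_restrict]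
  rw [IntegrableOn, Measure.volume_eq_prod, ← Measure.prod_restrict] at hi2
  rw [integral_prod _ hi2]
  have e : ∀ r ∈ Ioo (0:ℝ) 1, r ≠ ‖z‖ → (∫ θ in Ioo (-Real.pi) Real.pi, r • (circleMap 0 r θ - z)⁻¹) = (Ioo 0 ‖z‖).indicator (fun r : ℝ => (r:ℂ) * (-(2 * Real.pi) / z)) r := by
    intro r hr hrz
    rw [integral_smul, ← integral_Ioc_eq_integral_Ioo, ← intervalIntegral.integral_of_le (by linarith), circle_inv hr.1 hrz.symm]
    by_cases h : r < ‖z‖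
    · rw [if_pos h, indicator_of_mem (show r ∈ Ioo 0 ‖z‖ from ⟨hr.1, h⟩)]; simp
    · rw [if_neg h, indicator_of_notMem (fun h' => h h'.2)]; simp
  have e' : (∫ r in Ioo (0:ℝ) 1, ∫ θ in Ioo (-Real.pi) Real.pi, r • (circleMap 0 r θ - z)⁻¹) = ∫ r in Ioo (0:ℝ) 1, (Ioo 0 ‖z‖).indicator (fun r : ℝ => (r:ℂ) * (-(2 * Real.pi) / z)) r := by
    apply setIntegral_congr_ae measurableSet_Ioo
    have : ∀ᵐ r : ℝ, r ≠ ‖z‖ := by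
      have := measure_singleton (μ := (volume : Measure ℝ)) ‖z‖
      exact measure_eq_zero_iff_ae_notMem.1 this
    filter_upwards [this] with r h1 h2 using e r h2 h1
  rw [e', setIntegral_indicator measurableSet_Ioo, Ioo_inter_Ioo, max_self, min_eq_right hz.le, ← integral_Ioc_eq_integral_Ioo,
    ← intervalIntegral.integral_of_le (norm_nonneg z), intervalIntegral.integral_mul_const, intervalIntegral.integral_ofReal, integral_id]
  by_cases h : z = 0
  · simp [h]
  · have : ((‖z‖ : ℂ)) ^ 2 = z * (starRingEnd ℂ) z := by
      rw [Complex.mul_conj, Complex.normSq_eq_norm_sq]; push_cast; rfl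
    push_cast
    rw [this]
    field_simp
    ring

/-- the Hoelder-1/2 predicate on the unit disc -/
def Hol {n : ℕ} (g : ℂ → Cn n) (M : ℝ) : Prop :=
  (∀ z ∈ ball (0:ℂ) 1, ‖g z‖ ≤ M) ∧ ∀ z ∈ ball (0:ℂ) 1, ∀ w ∈ ball (0:ℂ) 1, ‖g z - g w‖ ≤ M * √‖z - w‖

noncomputable def TT {n : ℕ} (g : ℂ → Cn n) (z : ℂ) : Cn n := ∫ ζ in ball (0:ℂ) 1, (ζ - z)⁻¹ • g ζ
noncomputable def PP {n : ℕ} (g : ℂ → Cn n) (z : ℂ) : Cn n := ∫ ζ in ball (0:ℂ) 1, ((ζ - z) ^ 2)⁻¹ • (g ζ - g z)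

theorem Hol.nonneg {n : ℕ} {g : ℂ → Cn n} {M : ℝ} (h : Hol g M) : 0 ≤ M :=
  (norm_nonneg _).trans (h.1 0 (by simp))

theorem Hol.cont {n : ℕ} {g : ℂ → Cn n} {M : ℝ} (h : Hol g M) : ContinuousOn g (ball (0:ℂ) 1) := by
  intro z hz
  rw [ContinuousWithinAt, tendsto_iff_norm_sub_tendsto_zero]
  have ht : Tendsto (fun w : ℂ => M * √‖w - z‖) (𝓝[ball (0:ℂ) 1] z) (𝓝 0) := by
    have : Continuous (fun w : ℂ => M * √‖w - z‖) := by fun_prop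
    have := this.tendsto z
    simp only [sub_self, norm_zero, Real.sqrt_zero, mul_zero] at this
    exact this.mono_left nhdsWithin_le_nhds
  refine squeeze_zero' (Eventually.of_forall fun _ => norm_nonneg _) ?_ ht
  filter_upwards [self_mem_nhdsWithin] with w hw using h.2 w hw z hz

theorem Hol.meas {n : ℕ} {g : ℂ → Cn n} {M : ℝ} (h : Hol g M) :
    AEStronglyMeasurable g (volume.restrict (ball (0:ℂ) 1)) :=
  h.cont.aestronglyMeasurable measurableSet_ball

theorem sqrt_sq_inv {b : ℝ} (hb : 0 ≤ b) : √b * (b ^ 2)⁻¹ = b ^ (-(3/2) : ℝ) := by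
  rcases hb.eq_or_lt with h | h
  · rw [← h, Real.zero_rpow (by norm_num)]; simp
  · rw [Real.sqrt_eq_rpow, ← Real.rpow_natCast, ← Real.rpow_neg h.le, ← Real.rpow_add h]; norm_num

theorem int_T {n : ℕ} {g : ℂ → Cn n} {M : ℝ} (h : Hol g M) {z : ℂ} (hz : z ∈ ball (0:ℂ) 1) :
    IntegrableOn (fun ζ => (ζ - z)⁻¹ • g ζ) (ball (0:ℂ) 1) := by
  have hk := inv_kernel_ball 0 z zero_le_one (by simpa using (mem_ball_zero_iff.1 hz).le)
  apply Integrable.mono' (hk.1.mul_const M)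
  · have hm : AEStronglyMeasurable (fun ζ : ℂ => (ζ - z)⁻¹) (volume.restrict (ball (0:ℂ) 1)) := by
      apply Measurable.aestronglyMeasurable; fun_prop
    exact hm.smul h.meas
  · filter_upwards [self_mem_ae_restrict measurableSet_ball] with ζ hζ
    rw [norm_smul, norm_inv]
    gcongr
    exact h.1 ζ hζ

theorem kern32 {z : ℂ} (hz : z ∈ ball (0:ℂ) 1) : IntegrableOn (fun ζ : ℂ => ‖ζ - z‖ ^ (-(3/2) : ℝ)) (ball 0 1) ∧
    ∫ ζ in ball (0:ℂ) 1, ‖ζ - z‖ ^ (-(3/2) : ℝ) ≤ 6 * Real.pi := by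
  have hpi := Real.pi_pos
  have k := rpow_ball z (R := 2) (a := -(3/2)) (by norm_num) (by norm_num)
  have hsub : ball (0:ℂ) 1 ⊆ ball z 2 := by
    apply ball_subset_ball'
    rw [dist_zero_left]; linarith [mem_ball_zero_iff.1 hz]
  refine ⟨k.1.mono_set hsub, ?_⟩
  have := setIntegral_mono_set k.1 (by filter_upwards with ζ using by positivity) hsub.eventuallyLE
  refine this.trans ?_
  rw [k.2]
  have : (2:ℝ) ^ (-(3/2) + 2 : ℝ) ≤ 3 / 2 := by
    have : (2:ℝ) ^ (-(3/2) + 2 : ℝ) = √2 := by rw [Real.sqrt_eq_rpow]; norm_num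
    rw [this, Real.sqrt_le_left (by norm_num)]; norm_num
  have e : 2 * Real.pi * ((2:ℝ) ^ (-(3/2) + 2 : ℝ) / (-(3/2) + 2)) = 4 * Real.pi * (2:ℝ) ^ (-(3/2) + 2 : ℝ) := by ring
  rw [e]
  nlinarith

theorem P_bound_pt {n : ℕ} {g : ℂ → Cn n} {M : ℝ} (h : Hol g M) {z ζ : ℂ} (hz : z ∈ ball (0:ℂ) 1) (hζ : ζ ∈ ball (0:ℂ) 1) :
    ‖((ζ - z) ^ 2)⁻¹ • (g ζ - g z)‖ ≤ M * ‖ζ - z‖ ^ (-(3/2) : ℝ) := by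
  rw [norm_smul, norm_inv, norm_pow, ← sqrt_sq_inv (norm_nonneg _), ← mul_assoc, mul_comm]
  gcongr
  exact h.2 ζ hζ z hz

theorem int_P {n : ℕ} {g : ℂ → Cn n} {M : ℝ} (h : Hol g M) {z : ℂ} (hz : z ∈ ball (0:ℂ) 1) :
    IntegrableOn (fun ζ => ((ζ - z) ^ 2)⁻¹ • (g ζ - g z)) (ball (0:ℂ) 1) := by
  apply Integrable.mono' ((kern32 hz).1.const_mul M)
  · have hm : AEStronglyMeasurable (fun ζ : ℂ => ((ζ - z) ^ 2)⁻¹) (volume.restrict (ball (0:ℂ) 1)) := by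
      apply Measurable.aestronglyMeasurable; fun_prop
    exact hm.smul (h.meas.sub aestronglyMeasurable_const)
  · filter_upwards [self_mem_ae_restrict measurableSet_ball] with ζ hζ using P_bound_pt h hz hζ

theorem P_bound {n : ℕ} {g : ℂ → Cn n} {M : ℝ} (h : Hol g M) {z : ℂ} (hz : z ∈ ball (0:ℂ) 1) : ‖PP g z‖ ≤ 6 * Real.pi * M := by
  refine (norm_integral_le_of_norm_le ((kern32 hz).1.const_mul M) ?_).trans ?_
  · filter_upwards [self_mem_ae_restrict measurableSet_ball] with ζ hζ using P_bound_pt h hz hζ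
  · rw [integral_const_mul]
    have := mul_le_mul_of_nonneg_left (kern32 hz).2 h.nonneg
    linarith

theorem T_rem {n : ℕ} {g : ℂ → Cn n} {M : ℝ} (h : Hol g M) {z z0 : ℂ} (hz : z ∈ ball (0:ℂ) 1) (hz0 : z0 ∈ ball (0:ℂ) 1) :
    ‖TT g z - TT g z0 + ((Real.pi : ℂ) * (starRingEnd ℂ) (z - z0)) • g z0 - (z - z0) • PP g z0‖ ≤
      30 * Real.pi * M * (‖z - z0‖ * √‖z - z0‖) := by
  by_cases hne : z = z0
  · subst hne; simp
  have hM := h.nonneg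
  have hc : ∀ w ∈ ball (0:ℂ) 1, IntegrableOn (fun ζ => (ζ - w)⁻¹ • g z0) (ball (0:ℂ) 1) ∧
      ∫ ζ in ball (0:ℂ) 1, (ζ - w)⁻¹ • g z0 = -((Real.pi * (starRingEnd ℂ) w) • g z0) := by
    intro w hw
    have h1 : IntegrableOn (fun ζ : ℂ => (ζ - w)⁻¹) (ball (0:ℂ) 1) := by
      have hk := inv_kernel_ball 0 w zero_le_one (by simpa using (mem_ball_zero_iff.1 hw).le)
      apply Integrable.mono' hk.1
      · apply Measurable.aestronglyMeasurable; fun_prop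
      · filter_upwards with ζ; rw [norm_inv]
    refine ⟨h1.smul_const _, ?_⟩
    rw [integral_smul_const, T_one (mem_ball_zero_iff.1 hw), neg_smul]
  have i1 : ∀ w ∈ ball (0:ℂ) 1, IntegrableOn (fun ζ => (ζ - w)⁻¹ • (g ζ - g z0)) (ball (0:ℂ) 1) ∧
      ∫ ζ in ball (0:ℂ) 1, (ζ - w)⁻¹ • (g ζ - g z0) = TT g w + (Real.pi * (starRingEnd ℂ) w) • g z0 := by
    intro w hw
    have e : (fun ζ => (ζ - w)⁻¹ • (g ζ - g z0)) = fun ζ => (ζ - w)⁻¹ • g ζ - (ζ - w)⁻¹ • g z0 := by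
      ext1 ζ; rw [smul_sub]
    rw [e]
    refine ⟨(int_T h hw).sub (hc w hw).1, ?_⟩
    rw [integral_sub (int_T h hw) (hc w hw).1, (hc w hw).2, sub_neg_eq_add]; rfl
  have E : TT g z - TT g z0 + ((Real.pi : ℂ) * (starRingEnd ℂ) (z - z0)) • g z0 - (z - z0) • PP g z0
      = ∫ ζ in ball (0:ℂ) 1, ((ζ - z)⁻¹ • (g ζ - g z0) - (ζ - z0)⁻¹ • (g ζ - g z0) - (z - z0) • (((ζ - z0) ^ 2)⁻¹ • (g ζ - g z0))) := by
    have j1 : IntegrableOn (fun ζ => (ζ - z)⁻¹ • (g ζ - g z0) - (ζ - z0)⁻¹ • (g ζ - g z0)) (ball (0:ℂ) 1) :=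
      (i1 z hz).1.sub (i1 z0 hz0).1
    have j2 : IntegrableOn (fun ζ => (z - z0) • (((ζ - z0) ^ 2)⁻¹ • (g ζ - g z0))) (ball (0:ℂ) 1) :=
      (int_P h hz0).smul (z - z0)
    rw [integral_sub j1 j2, integral_sub (i1 z hz).1 (i1 z0 hz0).1, (i1 z hz).2, (i1 z0 hz0).2, integral_smul]
    rw [map_sub, PP]
    module
  rw [E]
  have hk := kern hne
  have hbd := norm_integral_le_of_norm_le (μ := volume.restrict (ball (0:ℂ) 1))
    (f := fun ζ => ((ζ - z)⁻¹ • (g ζ - g z0) - (ζ - z0)⁻¹ • (g ζ - g z0) - (z - z0) • (((ζ - z0) ^ 2)⁻¹ • (g ζ - g z0))))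
    ((hk.1.integrableOn (s := ball (0:ℂ) 1)).const_mul (‖z - z0‖ ^ 2 * M)) (by
      have hz' : ∀ᵐ ζ ∂(volume.restrict (ball (0:ℂ) 1)), ζ ≠ z := by
        apply ae_restrict_of_ae
        exact measure_eq_zero_iff_ae_notMem.1 (measure_singleton z)
      filter_upwards [hz', self_mem_ae_restrict measurableSet_ball] with ζ hζz hζ
      by_cases hζ0 : ζ = z0
      · rw [hζ0]; simp only [sub_self, smul_zero, norm_zero]; positivity
      have a1 : ζ - z ≠ 0 := sub_ne_zero.2 hζz
      have a2 : ζ - z0 ≠ 0 := sub_ne_zero.2 hζ0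
      have e : (ζ - z)⁻¹ • (g ζ - g z0) - (ζ - z0)⁻¹ • (g ζ - g z0) - (z - z0) • (((ζ - z0) ^ 2)⁻¹ • (g ζ - g z0))
          = ((z - z0) ^ 2 * (ζ - z)⁻¹) • (((ζ - z0) ^ 2)⁻¹ • (g ζ - g z0)) := by
        rw [smul_smul, smul_smul, ← sub_smul, ← sub_smul]
        congr 1
        field_simp
        ring
      rw [e, norm_smul, norm_mul, norm_pow, norm_inv]
      have := P_bound_pt h hz0 hζ
      calc ‖z - z0‖ ^ 2 * ‖ζ - z‖⁻¹ * ‖((ζ - z0) ^ 2)⁻¹ • (g ζ - g z0)‖ ≤ ‖z - z0‖ ^ 2 * ‖ζ - z‖⁻¹ * (M * ‖ζ - z0‖ ^ (-(3/2) : ℝ)) := by gcongr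
        _ = _ := by ring)
  refine hbd.trans ?_
  rw [integral_const_mul]
  have h2 : ∫ ζ in ball (0:ℂ) 1, ‖ζ - z‖⁻¹ * ‖ζ - z0‖ ^ (-(3/2) : ℝ) ≤ 30 * Real.pi * (√‖z - z0‖)⁻¹ :=
    (setIntegral_le_integral hk.1 (by filter_upwards with ζ using by positivity)).trans hk.2
  have hd : 0 < ‖z - z0‖ := norm_pos_iff.2 (sub_ne_zero.2 hne)
  have hs : 0 < √‖z - z0‖ := Real.sqrt_pos.2 hd
  have hss : √‖z - z0‖ ^ 2 = ‖z - z0‖ := Real.sq_sqrt hd.le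
  calc _ ≤ ‖z - z0‖ ^ 2 * M * (30 * Real.pi * (√‖z - z0‖)⁻¹) := by gcongr
    _ = 30 * Real.pi * M * (‖z - z0‖ * (‖z - z0‖ * (√‖z - z0‖)⁻¹)) := by ring
    _ = _ := by
      congr 2
      nth_rewrite 1 [← hss]
      field_simp

theorem P_hol {n : ℕ} {g : ℂ → Cn n} {M : ℝ} (h : Hol g M) {z w : ℂ} (hz : z ∈ ball (0:ℂ) 1) (hw : w ∈ ball (0:ℂ) 1) :
    ‖PP g z - PP g w‖ ≤ 61 * Real.pi * M * √‖z - w‖ := by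
  have hpi := Real.pi_pos
  by_cases hne : z = w
  · subst hne; simp
  have hd : 0 < ‖z - w‖ := norm_pos_iff.2 (sub_ne_zero.2 hne)
  have r1 := T_rem h hz hw
  have r2 := T_rem h hw hz
  rw [norm_sub_rev w z] at r2
  have r3 := h.2 z hz w hw
  have e : (z - w) • (PP g z - PP g w) = (TT g z - TT g w + ((Real.pi : ℂ) * (starRingEnd ℂ) (z - w)) • g w - (z - w) • PP g w)
    + (TT g w - TT g z + ((Real.pi : ℂ) * (starRingEnd ℂ) (w - z)) • g z - (w - z) • PP g z) + ((Real.pi : ℂ) * (starRingEnd ℂ) (z - w)) • (g z - g w) := by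
    rw [map_sub, map_sub]
    module
  have n1 : ‖((Real.pi : ℂ) * (starRingEnd ℂ) (z - w)) • (g z - g w)‖ ≤ Real.pi * ‖z - w‖ * (M * √‖z - w‖) := by
    rw [norm_smul, norm_mul, RCLike.norm_conj, Complex.norm_real, Real.norm_eq_abs, abs_of_pos hpi]
    gcongr
  have n2 : ‖z - w‖ * ‖PP g z - PP g w‖ ≤ ‖z - w‖ * (61 * Real.pi * M * √‖z - w‖) := by
    rw [← norm_smul, e]
    refine (norm_add_le _ _).trans ((add_le_add ((norm_add_le _ _).trans (add_le_add r1 r2)) n1).trans (le_of_eq ?_))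
    ring
  exact le_of_mul_le_mul_left n2 hd

theorem T_sub {n : ℕ} {g g' : ℂ → Cn n} {M M' : ℝ} (h : Hol g M) (h' : Hol g' M') {z : ℂ} (hz : z ∈ ball (0:ℂ) 1) :
    TT (fun ζ => g ζ - g' ζ) z = TT g z - TT g' z := by
  unfold TT
  rw [← integral_sub (int_T h hz) (int_T h' hz)]
  congr 1; ext1 ζ; rw [smul_sub]

theorem P_sub {n : ℕ} {g g' : ℂ → Cn n} {M M' : ℝ} (h : Hol g M) (h' : Hol g' M') {z : ℂ} (hz : z ∈ ball (0:ℂ) 1) :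
    PP (fun ζ => g ζ - g' ζ) z = PP g z - PP g' z := by
  unfold PP
  rw [← integral_sub (int_P h hz) (int_P h' hz)]
  congr 1; ext1 ζ; rw [← smul_sub]; congr 1; exact sub_sub_sub_comm _ _ _ _

noncomputable def Sx {n : ℕ} (g : ℂ → Cn n) (z : ℂ) : Cn n := g z - (Real.pi : ℂ)⁻¹ • PP g z
noncomputable def Uf {n : ℕ} (g : ℂ → Cn n) (z : ℂ) : Cn n := -((Real.pi : ℂ)⁻¹ • (TT g z - TT g 0)) - z • Sx g 0

theorem pi_inv_smul {n : ℕ} {x : Cn n} {c : ℝ} (h : ‖x‖ ≤ Real.pi * c) : ‖(Real.pi : ℂ)⁻¹ • x‖ ≤ c := by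
  have hpi := Real.pi_pos
  rw [norm_smul, norm_inv, Complex.norm_real, Real.norm_eq_abs, abs_of_pos hpi, inv_mul_le_iff₀ hpi]
  exact h

theorem Sx_hol {n : ℕ} {g : ℂ → Cn n} {M : ℝ} (h : Hol g M) : Hol (Sx g) (62 * M) := by
  have hM := h.nonneg
  constructor
  · intro z hz
    have h1 := pi_inv_smul (x := PP g z) (c := 6 * M) (by linarith [P_bound h hz])
    exact (norm_sub_le _ _).trans (by linarith [h.1 z hz])
  · intro z hz w hw
    have h1 := pi_inv_smul (x := PP g z - PP g w) (c := 61 * M * √‖z - w‖) (by linarith [P_hol h hz hw])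
    have e : Sx g z - Sx g w = (g z - g w) - (Real.pi : ℂ)⁻¹ • (PP g z - PP g w) := by
      unfold Sx; module
    rw [e]
    exact (norm_sub_le _ _).trans (by linarith [h.2 z hz w hw])

theorem Sx_sub {n : ℕ} {g g' : ℂ → Cn n} {M M' : ℝ} (h : Hol g M) (h' : Hol g' M') {z : ℂ} (hz : z ∈ ball (0:ℂ) 1) :
    Sx (fun ζ => g ζ - g' ζ) z = Sx g z - Sx g' z := by
  unfold Sx
  rw [P_sub h h' hz]; module

theorem Uf_sub {n : ℕ} {g g' : ℂ → Cn n} {M M' : ℝ} (h : Hol g M) (h' : Hol g' M') {z : ℂ} (hz : z ∈ ball (0:ℂ) 1) :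
    Uf (fun ζ => g ζ - g' ζ) z = Uf g z - Uf g' z := by
  unfold Uf
  rw [T_sub h h' hz, T_sub h h' (by simp), Sx_sub h h' (by simp)]; module

noncomputable def Ud {n : ℕ} (g : ℂ → Cn n) (z : ℂ) : ℂ →L[ℝ] Cn n :=
  (Complex.conjCLE : ℂ →L[ℝ] ℂ).smulRight (g z) - (ContinuousLinearMap.id ℝ ℂ).smulRight ((Real.pi : ℂ)⁻¹ • PP g z + Sx g 0)

theorem Ud_apply {n : ℕ} (g : ℂ → Cn n) (z w : ℂ) : Ud g z w = (starRingEnd ℂ) w • g z - w • ((Real.pi : ℂ)⁻¹ • PP g z + Sx g 0) := by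
  simp [Ud]

theorem Ud_one {n : ℕ} (g : ℂ → Cn n) (z : ℂ) : Ud g z 1 = Sx g z - Sx g 0 := by
  rw [Ud_apply, Sx, Sx]; simp only [map_one, one_smul]; abel

theorem Ud_I {n : ℕ} (g : ℂ → Cn n) (z : ℂ) : Ud g z I = I • (Sx g z - Sx g 0) - I • ((2:ℂ) • g z) := by
  have e : Sx g z = g z - (Real.pi : ℂ)⁻¹ • PP g z := rfl
  rw [Ud_apply, e, Complex.conj_I]; module

theorem Ud_norm {n : ℕ} {g : ℂ → Cn n} {M : ℝ} (h : Hol g M) {z : ℂ} (hz : z ∈ ball (0:ℂ) 1) : ‖Ud g z‖ ≤ 14 * M := by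
  have hM := h.nonneg
  apply ContinuousLinearMap.opNorm_le_bound _ (by positivity)
  intro w
  rw [Ud_apply]
  have h1 : ∀ z ∈ ball (0:ℂ) 1, ‖(Real.pi : ℂ)⁻¹ • PP g z‖ ≤ 6 * M := fun z hz =>
    pi_inv_smul (x := PP g z) (c := 6 * M) (by linarith [P_bound h hz])
  have h2 : ‖Sx g 0‖ ≤ 7 * M := (norm_sub_le _ _).trans (by linarith [h.1 0 (by simp), h1 0 (by simp)])
  have h3 := norm_add_le ((Real.pi : ℂ)⁻¹ • PP g z) (Sx g 0)
  refine (norm_sub_le _ _).trans ?_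
  rw [norm_smul, norm_smul, RCLike.norm_conj]
  have h4 := h.1 z hz
  have h5 := h1 z hz
  nlinarith [norm_nonneg w]

theorem Uf_deriv {n : ℕ} {g : ℂ → Cn n} {M : ℝ} (h : Hol g M) {z0 : ℂ} (hz0 : z0 ∈ ball (0:ℂ) 1) :
    HasFDerivAt (Uf g) (Ud g z0) z0 := by
  have hM := h.nonneg
  rw [hasFDerivAt_iff_isLittleO, Asymptotics.isLittleO_iff]
  intro c hc
  have ht : Tendsto (fun w : ℂ => 30 * M * √‖w - z0‖) (𝓝 z0) (𝓝 0) := by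
    have : Continuous (fun w : ℂ => 30 * M * √‖w - z0‖) := by fun_prop
    have := this.tendsto z0
    simpa only [sub_self, norm_zero, Real.sqrt_zero, mul_zero] using this
  filter_upwards [isOpen_ball.mem_nhds hz0, ht.eventually (gt_mem_nhds hc)] with z hz hz2
  have e : Uf g z - Uf g z0 - Ud g z0 (z - z0) = -((Real.pi : ℂ)⁻¹ • (TT g z - TT g z0 + ((Real.pi : ℂ) * (starRingEnd ℂ) (z - z0)) • g z0 - (z - z0) • PP g z0)) := by
    have hp : (Real.pi : ℂ) ≠ 0 := by exact_mod_cast Real.pi_pos.ne'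
    rw [Ud_apply, Uf, Uf]
    have : (starRingEnd ℂ) (z - z0) • g z0 = (Real.pi : ℂ)⁻¹ • (((Real.pi : ℂ) * (starRingEnd ℂ) (z - z0)) • g z0) := by
      rw [smul_smul, ← mul_assoc, inv_mul_cancel₀ hp, one_mul]
    rw [this]
    module
  rw [e, norm_neg]
  refine (pi_inv_smul (c := 30 * M * (‖z - z0‖ * √‖z - z0‖)) (by linarith [T_rem h hz hz0])).trans ?_
  nlinarith [norm_nonneg (z - z0)]

theorem Uf_zero {n : ℕ} (g : ℂ → Cn n) : Uf g 0 = 0 := by simp [Uf]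

theorem Uf_bound {n : ℕ} {g : ℂ → Cn n} {M : ℝ} (h : Hol g M) {z : ℂ} (hz : z ∈ ball (0:ℂ) 1) : ‖Uf g z‖ ≤ 14 * M * ‖z‖ := by
  have := (convex_ball (0:ℂ) 1).norm_image_sub_le_of_norm_hasFDerivWithin_le (𝕜 := ℝ) (f := Uf g) (f' := Ud g) (C := 14 * M)
    (fun x hx => (Uf_deriv h hx).hasFDerivWithinAt) (fun x hx => Ud_norm h hx) (show (0:ℂ) ∈ ball (0:ℂ) 1 by simp) hz
  rwa [Uf_zero, sub_zero, sub_zero] at this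

noncomputable def Xf {n : ℕ} (v : Cn n) (g : ℂ → Cn n) (z : ℂ) : Cn n := v + (Sx g z - Sx g 0)
noncomputable def ff {n : ℕ} (p v : Cn n) (g : ℂ → Cn n) (z : ℂ) : Cn n := p + z • v + Uf g z
noncomputable def dff {n : ℕ} (v : Cn n) (g : ℂ → Cn n) (z : ℂ) : ℂ →L[ℝ] Cn n :=
  (ContinuousLinearMap.id ℝ ℂ).smulRight v + Ud g z
noncomputable def FF {n : ℕ} (J : Cn n → Cn n →L[ℝ] Cn n) (p v : Cn n) (g : ℂ → Cn n) (z : ℂ) : Cn n :=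
  (I / 2) • ((J (ff p v g z) - Jstd n) (Xf v g z))

theorem ff_deriv {n : ℕ} {g : ℂ → Cn n} {M : ℝ} (h : Hol g M) (p v : Cn n) {z : ℂ} (hz : z ∈ ball (0:ℂ) 1) :
    HasFDerivAt (ff p v g) (dff v g z) z := by
  have h1 : HasFDerivAt (fun z : ℂ => z • v) ((ContinuousLinearMap.id ℝ ℂ).smulRight v) z :=
    (hasFDerivAt_id (𝕜 := ℝ) z).smul_const v
  exact (h1.const_add p).add (Uf_deriv h hz)

theorem dff_one {n : ℕ} (v : Cn n) (g : ℂ → Cn n) (z : ℂ) : dff v g z 1 = Xf v g z := by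
  simp [dff, Ud_one, Xf]

theorem dff_I {n : ℕ} (v : Cn n) (g : ℂ → Cn n) (z : ℂ) : dff v g z I = I • Xf v g z - I • ((2:ℂ) • g z) := by
  have : dff v g z I = I • v + Ud g z I := by simp [dff]
  rw [this, Ud_I, Xf]; module

theorem dff_norm {n : ℕ} {g : ℂ → Cn n} {v : Cn n} (hv : ‖v‖ ≤ 1/10) (h : Hol g (1/1000)) {z : ℂ} (hz : z ∈ ball (0:ℂ) 1) :
    ‖dff v g z‖ ≤ 1 := by
  refine (norm_add_le _ _).trans ?_
  have h1 := Ud_norm h hz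
  have h2 : ‖(ContinuousLinearMap.id ℝ ℂ).smulRight v‖ ≤ 1/10 := by
    apply ContinuousLinearMap.opNorm_le_bound _ (by norm_num)
    intro w
    simp only [ContinuousLinearMap.smulRight_apply, ContinuousLinearMap.id_apply, norm_smul]
    nlinarith [norm_nonneg w]
  linarith

theorem X_norm {n : ℕ} {g : ℂ → Cn n} {v : Cn n} (hv : ‖v‖ ≤ 1/10) (h : Hol g (1/1000)) {z : ℂ} (hz : z ∈ ball (0:ℂ) 1) :
    ‖Xf v g z‖ ≤ 1 := by
  have h1 := (Sx_hol h).1 z hz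
  have h2 := (Sx_hol h).1 0 (by simp)
  have h3 := norm_sub_le (Sx g z) (Sx g 0)
  exact (norm_add_le _ _).trans (by linarith)

theorem X_hol {n : ℕ} {g : ℂ → Cn n} (v : Cn n) {M : ℝ} (h : Hol g M) {z w : ℂ} (hz : z ∈ ball (0:ℂ) 1) (hw : w ∈ ball (0:ℂ) 1) :
    ‖Xf v g z - Xf v g w‖ ≤ 62 * M * √‖z - w‖ := by
  have e : Xf v g z - Xf v g w = Sx g z - Sx g w := by unfold Xf; abel
  rw [e]; exact (Sx_hol h).2 z hz w hw

theorem ff_mem {n : ℕ} {g : ℂ → Cn n} {p v : Cn n} (hp : p ∈ ball (0 : Cn n) 1) (hv : ‖v‖ ≤ 1/10) (h : Hol g (1/1000)) {z : ℂ} (hz : z ∈ ball (0:ℂ) 1) :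
    ‖ff p v g z - p‖ ≤ ‖z‖ ∧ ff p v g z ∈ ball (0 : Cn n) 2 := by
  have hz' := mem_ball_zero_iff.1 hz
  have hp' := mem_ball_zero_iff.1 hp
  have h1 := Uf_bound h hz
  have h2 : ‖ff p v g z - p‖ ≤ ‖z‖ := by
    have e : ff p v g z - p = z • v + Uf g z := by unfold ff; abel
    rw [e]
    refine (norm_add_le _ _).trans ?_
    rw [norm_smul]
    nlinarith [norm_nonneg z]
  refine ⟨h2, ?_⟩
  rw [mem_ball_zero_iff]
  have := norm_le_insert' (ff p v g z) p
  linarith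

theorem ff_lip {n : ℕ} {g : ℂ → Cn n} {p v : Cn n} (hv : ‖v‖ ≤ 1/10) (h : Hol g (1/1000)) {z w : ℂ} (hz : z ∈ ball (0:ℂ) 1) (hw : w ∈ ball (0:ℂ) 1) :
    ‖ff p v g z - ff p v g w‖ ≤ ‖z - w‖ := by
  have := (convex_ball (0:ℂ) 1).norm_image_sub_le_of_norm_hasFDerivWithin_le (𝕜 := ℝ) (f := ff p v g) (f' := dff v g) (C := 1)
    (fun x hx => (ff_deriv h p v hx).hasFDerivWithinAt) (fun x hx => dff_norm hv h hx) hw hz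
  rwa [one_mul] at this

theorem disc_sqrt {z w : ℂ} (hz : z ∈ ball (0:ℂ) 1) (hw : w ∈ ball (0:ℂ) 1) : ‖z - w‖ ≤ 2 * √‖z - w‖ := by
  have h1 : ‖z - w‖ ≤ 2 := (norm_sub_le _ _).trans (by linarith [mem_ball_zero_iff.1 hz, mem_ball_zero_iff.1 hw])
  have h2 : √‖z - w‖ ^ 2 = ‖z - w‖ := Real.sq_sqrt (norm_nonneg _)
  have h3 : √‖z - w‖ ≤ 2 := by rw [Real.sqrt_le_left (by norm_num)]; linarith
  nlinarith [Real.sqrt_nonneg ‖z - w‖]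

theorem half_norm {n : ℕ} {x : Cn n} {c : ℝ} (h : ‖x‖ ≤ 2 * c) : ‖(I / 2) • x‖ ≤ c := by
  rw [norm_smul, norm_div, Complex.norm_I]; simp only [Complex.norm_ofNat]; linarith

theorem apply_le {n : ℕ} {A : Cn n →L[ℝ] Cn n} {x : Cn n} {a b : ℝ} (hA : ‖A‖ ≤ a) (hx : ‖x‖ ≤ b) : ‖A x‖ ≤ a * b :=
  (A.le_opNorm x).trans (mul_le_mul hA hx (norm_nonneg _) ((norm_nonneg _).trans hA))

theorem FF_self {n : ℕ} {J : Cn n → Cn n →L[ℝ] Cn n} {ε : ℝ} (hJ : Good J ε) {p v : Cn n} (hp : p ∈ ball (0 : Cn n) 1) (hv : ‖v‖ ≤ 1/10)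
    {g : ℂ → Cn n} (h : Hol g (1/1000)) : Hol (FF J p v g) (1/1000) := by
  have hε := hJ.le'
  have hε0 := hJ.pos
  constructor
  · intro z hz
    apply half_norm
    have := apply_le (hJ.near _ (ff_mem hp hv h hz).2) (X_norm hv h hz)
    linarith
  · intro z hz w hw
    have e : FF J p v g z - FF J p v g w = (I / 2) • ((J (ff p v g z) - J (ff p v g w)) (Xf v g z)
        + (J (ff p v g w) - Jstd n) (Xf v g z - Xf v g w)) := by
      unfold FF
      rw [← smul_sub]
      congr 1
      rw [map_sub, ContinuousLinearMap.sub_apply, ContinuousLinearMap.sub_apply, ContinuousLinearMap.sub_apply, ContinuousLinearMap.sub_apply]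
      abel
    rw [e]
    apply half_norm
    have s := Real.sqrt_nonneg ‖z - w‖
    have a1 : ‖J (ff p v g z) - J (ff p v g w)‖ ≤ ε * (2 * √‖z - w‖) :=
      (hJ.lip _ (ff_mem hp hv h hz).2 _ (ff_mem hp hv h hw).2).trans (by
        gcongr; exact (ff_lip hv h hz hw).trans (disc_sqrt hz hw))
    have a2 := apply_le a1 (X_norm hv h hz)
    have a3 := apply_le (hJ.near _ (ff_mem hp hv h hw).2) (X_hol v h hz hw)
    refine (norm_add_le _ _).trans ?_
    nlinarith

theorem dJ_norm {n : ℕ} {J : Cn n → Cn n →L[ℝ] Cn n} {ε : ℝ} (hJ : Good J ε) {x : Cn n} (hx : x ∈ ball (0 : Cn n) 2) :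
    ‖fderiv ℝ J x‖ ≤ ε := by
  apply norm_fderiv_le_of_lip' ℝ hJ.pos.le
  filter_upwards [isOpen_ball.mem_nhds hx] with y hy using hJ.lip y hy x hx

theorem JJ_lip {n : ℕ} {J : Cn n → Cn n →L[ℝ] Cn n} {ε δ : ℝ} (hJ : Good J ε) {p v : Cn n} (hp : p ∈ ball (0 : Cn n) 1) (hv : ‖v‖ ≤ 1/10)
    {g g' : ℂ → Cn n} (h : Hol g (1/1000)) (h' : Hol g' (1/1000)) (hd : Hol (fun ζ => g ζ - g' ζ) δ)
    {z w : ℂ} (hz : z ∈ ball (0:ℂ) 1) (hw : w ∈ ball (0:ℂ) 1) :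
    ‖(J (ff p v g z) - J (ff p v g' z)) - (J (ff p v g w) - J (ff p v g' w))‖ ≤ 28 * ε * δ * ‖z - w‖ := by
  have hε0 := hJ.pos
  have hδ := hd.nonneg
  have hD : ∀ x ∈ ball (0:ℂ) 1, HasFDerivAt (fun ζ => J (ff p v g ζ) - J (ff p v g' ζ))
      ((fderiv ℝ J (ff p v g x)).comp (dff v g x) - (fderiv ℝ J (ff p v g' x)).comp (dff v g' x)) x := by
    intro x hx
    have d1 := (hJ.diff _ (ff_mem hp hv h hx).2).hasFDerivAt.comp x (ff_deriv h p v hx)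
    have d2 := (hJ.diff _ (ff_mem hp hv h' hx).2).hasFDerivAt.comp x (ff_deriv h' p v hx)
    exact d1.sub d2
  have hB : ∀ x ∈ ball (0:ℂ) 1, ‖(fderiv ℝ J (ff p v g x)).comp (dff v g x) - (fderiv ℝ J (ff p v g' x)).comp (dff v g' x)‖ ≤ 28 * ε * δ := by
    intro x hx
    have hfd : ‖ff p v g x - ff p v g' x‖ ≤ 14 * δ := by
      have e : ff p v g x - ff p v g' x = Uf (fun ζ => g ζ - g' ζ) x := by
        rw [Uf_sub h h' hx]; unfold ff; abel
      rw [e]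
      have := Uf_bound hd hx
      have := mem_ball_zero_iff.1 hx
      nlinarith
    have hdd : ‖dff v g x - dff v g' x‖ ≤ 14 * δ := by
      have e : dff v g x - dff v g' x = Ud (fun ζ => g ζ - g' ζ) x := by
        ext1 w
        rw [Ud_apply, P_sub h h' hx, Sx_sub h h' (by simp)]
        have : dff v g x - dff v g' x = Ud g x - Ud g' x := by unfold dff; abel
        rw [this, ContinuousLinearMap.sub_apply, Ud_apply, Ud_apply]
        module
      rw [e]; exact Ud_norm hd hx
    have e : (fderiv ℝ J (ff p v g x)).comp (dff v g x) - (fderiv ℝ J (ff p v g' x)).comp (dff v g' x)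
      = (fderiv ℝ J (ff p v g x) - fderiv ℝ J (ff p v g' x)).comp (dff v g x) + (fderiv ℝ J (ff p v g' x)).comp (dff v g x - dff v g' x) := by
      rw [ContinuousLinearMap.sub_comp, ContinuousLinearMap.comp_sub]; abel
    rw [e]
    have b1 : ‖(fderiv ℝ J (ff p v g x) - fderiv ℝ J (ff p v g' x)).comp (dff v g x)‖ ≤ (ε * (14 * δ)) * 1 :=
      (ContinuousLinearMap.opNorm_comp_le _ _).trans (by
        gcongr
        · exact (hJ.dlip _ (ff_mem hp hv h hx).2 _ (ff_mem hp hv h' hx).2).trans (by gcongr)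
        · exact dff_norm hv h hx)
    have b2 : ‖(fderiv ℝ J (ff p v g' x)).comp (dff v g x - dff v g' x)‖ ≤ ε * (14 * δ) :=
      (ContinuousLinearMap.opNorm_comp_le _ _).trans (by
        gcongr
        exact dJ_norm hJ (ff_mem hp hv h' hx).2)
    exact (ContinuousLinearMap.opNorm_add_le _ _).trans ((add_le_add b1 b2).trans (le_of_eq (by ring)))
  exact (convex_ball (0:ℂ) 1).norm_image_sub_le_of_norm_hasFDerivWithin_le (𝕜 := ℝ) (f := fun ζ => J (ff p v g ζ) - J (ff p v g' ζ))
    (C := 28 * ε * δ) (fun x hx => (hD x hx).hasFDerivWithinAt) hB hw hz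

theorem FF_contr {n : ℕ} {J : Cn n → Cn n →L[ℝ] Cn n} {ε δ : ℝ} (hJ : Good J ε) {p v : Cn n} (hp : p ∈ ball (0 : Cn n) 1) (hv : ‖v‖ ≤ 1/10)
    {g g' : ℂ → Cn n} (h : Hol g (1/1000)) (h' : Hol g' (1/1000)) (hd : Hol (fun ζ => g ζ - g' ζ) δ) :
    Hol (fun ζ => FF J p v g ζ - FF J p v g' ζ) (δ / 2) := by
  have hε := hJ.le'
  have hε0 := hJ.pos
  have hδ := hd.nonneg
  have hεδ : ε * δ ≤ 1/10000 * δ := by gcongr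
  have hεδ0 : 0 ≤ ε * δ := by positivity
  have e0 : ∀ z, FF J p v g z - FF J p v g' z = (I / 2) • ((J (ff p v g z) - J (ff p v g' z)) (Xf v g z)
        + (J (ff p v g' z) - Jstd n) (Xf v g z - Xf v g' z)) := by
    intro z
    unfold FF
    rw [← smul_sub]
    congr 1
    rw [map_sub, ContinuousLinearMap.sub_apply, ContinuousLinearMap.sub_apply, ContinuousLinearMap.sub_apply, ContinuousLinearMap.sub_apply]
    abel
  have hX : ∀ z ∈ ball (0:ℂ) 1, Xf v g z - Xf v g' z = Sx (fun ζ => g ζ - g' ζ) z - Sx (fun ζ => g ζ - g' ζ) 0 := by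
    intro z hz
    rw [Sx_sub h h' hz, Sx_sub h h' (by simp)]; unfold Xf; abel
  have hXn : ∀ z ∈ ball (0:ℂ) 1, ‖Xf v g z - Xf v g' z‖ ≤ 124 * δ := by
    intro z hz
    rw [hX z hz]
    have h1 := (Sx_hol hd).1 z hz
    have h2 := (Sx_hol hd).1 0 (by simp)
    exact (norm_sub_le _ _).trans (by linarith)
  have hfd : ∀ x ∈ ball (0:ℂ) 1, ‖J (ff p v g x) - J (ff p v g' x)‖ ≤ ε * (14 * δ) := by
    intro x hx
    refine (hJ.lip _ (ff_mem hp hv h hx).2 _ (ff_mem hp hv h' hx).2).trans ?_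
    gcongr
    have e : ff p v g x - ff p v g' x = Uf (fun ζ => g ζ - g' ζ) x := by
      rw [Uf_sub h h' hx]; unfold ff; abel
    rw [e]
    have := Uf_bound hd hx
    have := mem_ball_zero_iff.1 hx
    nlinarith
  constructor
  · intro z hz
    show ‖FF J p v g z - FF J p v g' z‖ ≤ _
    rw [e0]
    apply half_norm
    refine (norm_add_le _ _).trans ?_
    have b1 := apply_le (hfd z hz) (X_norm hv h hz)
    have b2 := apply_le (hJ.near _ (ff_mem hp hv h' hz).2) (hXn z hz)
    nlinarith
  · intro z hz w hw
    show ‖(FF J p v g z - FF J p v g' z) - (FF J p v g w - FF J p v g' w)‖ ≤ _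
    rw [e0, e0, ← smul_sub]
    apply half_norm
    have s := Real.sqrt_nonneg ‖z - w‖
    have e : ((J (ff p v g z) - J (ff p v g' z)) (Xf v g z) + (J (ff p v g' z) - Jstd n) (Xf v g z - Xf v g' z))
      - ((J (ff p v g w) - J (ff p v g' w)) (Xf v g w) + (J (ff p v g' w) - Jstd n) (Xf v g w - Xf v g' w))
      = (((J (ff p v g z) - J (ff p v g' z)) - (J (ff p v g w) - J (ff p v g' w))) (Xf v g z)
        + (J (ff p v g w) - J (ff p v g' w)) (Xf v g z - Xf v g w))
        + ((J (ff p v g' z) - J (ff p v g' w)) (Xf v g z - Xf v g' z)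
        + (J (ff p v g' w) - Jstd n) ((Xf v g z - Xf v g' z) - (Xf v g w - Xf v g' w))) := by
      simp only [map_sub, ContinuousLinearMap.sub_apply]
      abel
    rw [e]
    have q := disc_sqrt hz hw
    have t1 := apply_le ((JJ_lip hJ hp hv h h' hd hz hw).trans (mul_le_mul_of_nonneg_left q (by positivity))) (X_norm hv h hz)
    have t2 := apply_le (hfd w hw) (X_hol v h hz hw)
    have a1 : ‖J (ff p v g' z) - J (ff p v g' w)‖ ≤ ε * (2 * √‖z - w‖) :=
      (hJ.lip _ (ff_mem hp hv h' hz).2 _ (ff_mem hp hv h' hw).2).trans (by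
        gcongr; exact (ff_lip hv h' hz hw).trans q)
    have t3 := apply_le a1 (hXn z hz)
    have x4 : ‖(Xf v g z - Xf v g' z) - (Xf v g w - Xf v g' w)‖ ≤ 62 * δ * √‖z - w‖ := by
      rw [hX z hz, hX w hw, sub_sub_sub_cancel_right]
      exact (Sx_hol hd).2 z hz w hw
    have t4 := apply_le (hJ.near _ (ff_mem hp hv h' hw).2) x4
    refine (norm_add_le _ _).trans ((add_le_add ((norm_add_le _ _).trans (add_le_add t1 t2)) ((norm_add_le _ _).trans (add_le_add t3 t4))).trans ?_)
    have : 28 * ε * δ * (2 * √‖z - w‖) * 1 + ε * (14 * δ) * (62 * (1 / 1000) * √‖z - w‖) + (ε * (2 * √‖z - w‖) * (124 * δ) + ε * (62 * δ * √‖z - w‖))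
      = (56 + 14 * 62 / 1000 + 248 + 62) * ((ε * δ) * √‖z - w‖) := by ring
    rw [this]
    have : (ε * δ) * √‖z - w‖ ≤ (1/10000 * δ) * √‖z - w‖ := by gcongr
    nlinarith [mul_nonneg hδ s]

noncomputable def GG {n : ℕ} (J : Cn n → Cn n →L[ℝ] Cn n) (p v : Cn n) : ℕ → ℂ → Cn n
  | 0 => fun _ => 0
  | k + 1 => FF J p v (GG J p v k)

theorem GG_hol {n : ℕ} {J : Cn n → Cn n →L[ℝ] Cn n} {ε : ℝ} (hJ : Good J ε) {p v : Cn n} (hp : p ∈ ball (0 : Cn n) 1) (hv : ‖v‖ ≤ 1/10)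
    (k : ℕ) : Hol (GG J p v k) (1/1000) := by
  induction k with
  | zero =>
    refine ⟨fun z _ => ?_, fun z _ w _ => ?_⟩
    · simp only [GG, norm_zero]; norm_num
    · simp only [GG, sub_zero, norm_zero]; positivity
  | succ k ih => exact FF_self hJ hp hv ih

theorem GG_diff {n : ℕ} {J : Cn n → Cn n →L[ℝ] Cn n} {ε : ℝ} (hJ : Good J ε) {p v : Cn n} (hp : p ∈ ball (0 : Cn n) 1) (hv : ‖v‖ ≤ 1/10)
    (k : ℕ) : Hol (fun ζ => GG J p v (k + 1) ζ - GG J p v k ζ) ((1/1000) * (1/2) ^ k) := by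
  induction k with
  | zero =>
    have := GG_hol hJ hp hv 1
    simpa [GG] using this
  | succ k ih =>
    have := FF_contr hJ hp hv (GG_hol hJ hp hv (k + 1)) (GG_hol hJ hp hv k) ih
    have e : (1/1000 : ℝ) * (1/2) ^ (k + 1) = (1/1000) * (1/2) ^ k / 2 := by ring
    rw [e]
    exact this

theorem FF_fixed {n : ℕ} {J : Cn n → Cn n →L[ℝ] Cn n} {ε : ℝ} (hJ : Good J ε) {p v : Cn n} (hp : p ∈ ball (0 : Cn n) 1) (hv : ‖v‖ ≤ 1/10) :
    ∃ g : ℂ → Cn n, Hol g (1/1000) ∧ ∀ z ∈ ball (0:ℂ) 1, FF J p v g z = g z := by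
  have hstep : ∀ z ∈ ball (0:ℂ) 1, ∀ k, dist (GG J p v k z) (GG J p v (k+1) z) ≤ (1/1000) * (1/2) ^ k := by
    intro z hz k
    rw [dist_eq_norm, norm_sub_rev]
    exact (GG_diff hJ hp hv k).1 z hz
  have hlim : ∀ z, ∃ l, z ∈ ball (0:ℂ) 1 → Tendsto (fun k => GG J p v k z) atTop (𝓝 l) := by
    intro z
    by_cases hz : z ∈ ball (0:ℂ) 1
    · obtain ⟨l, hl⟩ := cauchySeq_tendsto_of_complete (cauchySeq_of_le_geometric (1/2) (1/1000) (by norm_num) (hstep z hz))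
      exact ⟨l, fun _ => hl⟩
    · exact ⟨0, fun h => absurd h hz⟩
  choose g hg using hlim
  have hH : Hol g (1/1000) := by
    constructor
    · intro z hz
      exact le_of_tendsto (hg z hz).norm (Eventually.of_forall fun k => (GG_hol hJ hp hv k).1 z hz)
    · intro z hz w hw
      exact le_of_tendsto ((hg z hz).sub (hg w hw)).norm (Eventually.of_forall fun k => (GG_hol hJ hp hv k).2 z hz w hw)
  have hD : ∀ k, Hol (fun ζ => GG J p v k ζ - g ζ) ((1/500) * (1/2) ^ k) := by
    intro k
    constructor
    · intro z hz
      have := dist_le_of_le_geometric_of_tendsto (1/2) (1/1000) (by norm_num) (hstep z hz) (hg z hz) k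
      rw [dist_eq_norm] at this
      refine this.trans (le_of_eq (by ring))
    · intro z hz w hw
      have st : ∀ k, dist (GG J p v k z - GG J p v k w) (GG J p v (k+1) z - GG J p v (k+1) w) ≤ (1/1000 * √‖z - w‖) * (1/2) ^ k := by
        intro k
        rw [dist_eq_norm, norm_sub_rev, sub_sub_sub_comm]
        exact ((GG_diff hJ hp hv k).2 z hz w hw).trans (le_of_eq (by ring))
      have := dist_le_of_le_geometric_of_tendsto (1/2) (1/1000 * √‖z - w‖) (by norm_num) st ((hg z hz).sub (hg w hw)) k
      rw [dist_eq_norm, sub_sub_sub_comm] at this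
      exact this.trans (le_of_eq (by ring))
  refine ⟨g, hH, fun z hz => ?_⟩
  have t1 : Tendsto (fun k => GG J p v (k + 1) z) atTop (𝓝 (g z)) := (hg z hz).comp (tendsto_add_atTop_nat 1)
  have t2 : Tendsto (fun k => GG J p v (k + 1) z) atTop (𝓝 (FF J p v g z)) := by
    rw [tendsto_iff_norm_sub_tendsto_zero]
    have t3 : Tendsto (fun k : ℕ => (1/1000 : ℝ) * (1/2) ^ k) atTop (𝓝 0) := by
      have := (tendsto_pow_atTop_nhds_zero_of_lt_one (r := (1/2 : ℝ)) (by norm_num) (by norm_num)).const_mul (1/1000 : ℝ)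
      rwa [mul_zero] at this
    refine squeeze_zero (fun _ => norm_nonneg _) (fun k => ?_) t3
    have := (FF_contr hJ hp hv (GG_hol hJ hp hv k) hH (hD k)).1 z hz
    exact this.trans (le_of_eq (by ring))
  exact tendsto_nhds_unique t2 t1

/-- small discs in every direction -/
theorem disc_exists {n : ℕ} {J : Cn n → Cn n →L[ℝ] Cn n} {ε : ℝ} (hJ : Good J ε) {p v : Cn n} (hp : p ∈ ball (0 : Cn n) 1) (hv : ‖v‖ ≤ 1/10) :
    ∃ f : ℂ → Cn n, JHolOn J f unitDisc ∧ f 0 = p ∧ fderiv ℝ f 0 1 = v ∧ ∀ z ∈ ball (0:ℂ) 1, ‖f z - p‖ ≤ ‖z‖ := by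
  obtain ⟨g, hg, hfix⟩ := FF_fixed hJ hp hv
  refine ⟨ff p v g, fun z hz => ?_, ?_, ?_, fun z hz => (ff_mem hp hv hg hz).1⟩
  · have hd := ff_deriv hg p v (z := z) hz
    refine ⟨hd.differentiableAt, ?_⟩
    rw [hd.fderiv]
    apply JHol_of_apply (hJ.sq _ (ff_mem hp hv hg hz).2)
    rw [dff_one, dff_I, ← hfix z hz, FF, ContinuousLinearMap.sub_apply, Jstd_apply]
    have e : I • ((2:ℂ) • (I / 2) • (J (ff p v g z) (Xf v g z) - I • Xf v g z)) = -(J (ff p v g z) (Xf v g z) - I • Xf v g z) := by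
      rw [smul_smul, smul_smul, ← neg_one_smul ℂ]
      congr 1
      linear_combination I_mul_I
    rw [e]; abel
  · simp [ff, Uf_zero]
  · rw [(ff_deriv hg p v (by simp)).fderiv, dff_one]; simp [Xf]

theorem kobSet_upper {n : ℕ} {J : Cn n → Cn n →L[ℝ] Cn n} {ε : ℝ} (hJ : Good J ε) {p v : Cn n} (hp : p ∈ ball (0 : Cn n) 1)
    {α : ℝ} (hα0 : 0 < α) (hα : 10 * ‖v‖ ≤ α * (1 - ‖p‖)) : α ∈ kobSet J (ball 0 1) p v := by
  have hp' := mem_ball_zero_iff.1 hp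
  set t := 1 - ‖p‖ with ht
  have ht0 : 0 < t := by linarith
  have ht1 : t ≤ 1 := by linarith [norm_nonneg p]
  obtain ⟨f, hf, f0, f1, fb⟩ := disc_exists hJ hp (v := (t⁻¹ * α⁻¹) • v) (by
    rw [norm_smul, Real.norm_eq_abs, abs_of_pos (by positivity), ← mul_inv, inv_mul_le_iff₀ (by positivity)]
    linarith)
  have hf2 : JDisc J (ball 0 2) f := ⟨fun ζ hζ => by
    have h1 : ‖ζ‖ < 1 := mem_ball_zero_iff.1 hζ
    have h4 := fb ζ hζ
    have h5 := norm_le_insert' (f ζ) p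
    exact mem_ball_zero_iff.2 (by linarith), hf⟩
  obtain ⟨s1, s2⟩ := JDisc.shrink hJ.sq hf2 ht0 ht1
  refine ⟨hα0, fun ζ => f (t * ζ), ⟨?_, s1.2⟩, ?_, ?_⟩
  · intro ζ hζ
    have h1 : ‖ζ‖ < 1 := mem_ball_zero_iff.1 hζ
    have h2 : ‖(t:ℂ) * ζ‖ = t * ‖ζ‖ := by rw [norm_mul, Complex.norm_real, Real.norm_eq_abs, abs_of_pos ht0]
    have h3 : t * ‖ζ‖ < t := by nlinarith
    have h4 := fb (t * ζ) (mem_ball_zero_iff.2 (by linarith))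
    have h5 := norm_le_insert' (f (t * ζ)) p
    exact mem_ball_zero_iff.2 (by linarith)
  · simp [f0]
  · rw [s2, f1, smul_smul, ← mul_assoc, mul_inv_cancel₀ ht0.ne', one_mul]

theorem kobSet_nonempty {n : ℕ} {J : Cn n → Cn n →L[ℝ] Cn n} {ε : ℝ} (hJ : Good J ε) {p : Cn n} (hp : p ∈ ball (0 : Cn n) 1)
    (v : Cn n) : (kobSet J (ball 0 1) p v).Nonempty := by
  have hp' : 0 < 1 - ‖p‖ := by linarith [mem_ball_zero_iff.1 hp]
  refine ⟨(10 * ‖v‖ + 1) / (1 - ‖p‖), kobSet_upper hJ hp (by positivity) ?_⟩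
  rw [div_mul_cancel₀ _ hp'.ne']; linarith

theorem kob_nonneg {n : ℕ} (J : Cn n → Cn n →L[ℝ] Cn n) (D : Set (Cn n)) (p v : Cn n) : 0 ≤ kobMetric J D p v :=
  Real.sInf_nonneg fun _ h => h.1.le

theorem kob_upper {n : ℕ} {J : Cn n → Cn n →L[ℝ] Cn n} {ε : ℝ} (hJ : Good J ε) {p : Cn n} (hp : p ∈ ball (0 : Cn n) 1)
    (v : Cn n) : kobMetric J (ball 0 1) p v ≤ (10 * ‖v‖ + 1) / (1 - ‖p‖) := by
  have hp' : 0 < 1 - ‖p‖ := by linarith [mem_ball_zero_iff.1 hp]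
  refine csInf_le ⟨0, fun α hα => hα.1.le⟩ (kobSet_upper hJ hp (by positivity) ?_)
  rw [div_mul_cancel₀ _ hp'.ne']; linarith

theorem kob_lower1 {n : ℕ} {J : Cn n → Cn n →L[ℝ] Cn n} {ε : ℝ} (hJ : Good J ε) {p : Cn n} (hp : p ∈ ball (0 : Cn n) 1)
    (v : Cn n) : ‖v‖ ≤ Cg * kobMetric J (ball 0 1) p v := by
  have hC := Cg_pos
  rw [← div_le_iff₀' hC]
  refine le_csInf (kobSet_nonempty hJ hp v) fun α hα => ?_
  rw [div_le_iff₀' hC]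
  exact (kob_lower hJ hα).1

theorem kob_lower2 {n : ℕ} {J : Cn n → Cn n →L[ℝ] Cn n} {ε : ℝ} (hJ : Good J ε) {p : Cn n} (hp : p ∈ ball (0 : Cn n) 1)
    (v : Cn n) : |inner ℝ p v| ≤ Cn2 * (1 - ‖p‖ ^ 2) * kobMetric J (ball 0 1) p v := by
  have hp' := mem_ball_zero_iff.1 hp
  have hC : 0 < Cn2 * (1 - ‖p‖ ^ 2) := mul_pos Cn2_pos (by nlinarith [norm_nonneg p])
  rw [← div_le_iff₀' hC]
  refine le_csInf (kobSet_nonempty hJ hp v) fun α hα => ?_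
  rw [div_le_iff₀' hC]
  exact (kob_lower hJ hα).2

theorem piece_find {m : ℕ} {t : ℕ → ℝ} (h0 : t 0 = 0) {x : ℝ} (hx0 : 0 < x) (hx1 : x ≤ t m) :
    ∃ i < m, x ∈ Set.Icc (t i) (t (i + 1)) := by
  induction m with
  | zero => linarith
  | succ m ih =>
    by_cases h : x ≤ t m
    · obtain ⟨i, hi, hx⟩ := ih h
      exact ⟨i, by omega, hx⟩
    · exact ⟨m, by omega, (not_le.1 h).le, hx1⟩

theorem PiecewiseC1On.good {n : ℕ} {γ : ℝ → Cn n} (h : PiecewiseC1On γ) :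
    ∃ S : Set ℝ, S.Countable ∧ ∃ C : ℝ, ∀ x ∈ Ioo (0:ℝ) 1 \ S, DifferentiableAt ℝ γ x ∧ ‖deriv γ x‖ ≤ C := by
  obtain ⟨hc, m, t, h0, h1, hlt, hC⟩ := h
  have hb : ∀ i, ∃ C : ℝ, i < m → ∀ x ∈ Ioo (t i) (t (i + 1)), DifferentiableAt ℝ γ x ∧ ‖deriv γ x‖ ≤ C := by
    intro i
    by_cases hi : i < m
    · have hu := uniqueDiffOn_Icc (hlt i hi)
      have hcd := (hC i hi).continuousOn_derivWithin hu le_rfl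
      obtain ⟨C, hC'⟩ := isCompact_Icc.exists_bound_of_continuousOn hcd
      refine ⟨C, fun _ x hx => ?_⟩
      have hmem : Set.Icc (t i) (t (i + 1)) ∈ 𝓝 x := Icc_mem_nhds hx.1 hx.2
      refine ⟨((hC i hi).differentiableOn one_ne_zero x (Ioo_subset_Icc_self hx)).differentiableAt hmem, ?_⟩
      rw [← derivWithin_of_mem_nhds hmem]
      exact hC' x (Ioo_subset_Icc_self hx)
    · exact ⟨0, fun h => absurd h hi⟩
  choose C hC' using hb
  refine ⟨range t, countable_range t, ∑ i ∈ Finset.range m, |C i|, fun x hx => ?_⟩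
  obtain ⟨i, hi, hxi⟩ := piece_find h0 hx.1.1 (by rw [h1]; exact hx.1.2.le)
  have hx' : x ∈ Ioo (t i) (t (i + 1)) :=
    ⟨lt_of_le_of_ne hxi.1 fun h => hx.2 ⟨i, h⟩, lt_of_le_of_ne hxi.2 fun h => hx.2 ⟨i + 1, h.symm⟩⟩
  obtain ⟨d1, d2⟩ := hC' i hi x hx'
  refine ⟨d1, d2.trans ((le_abs_self _).trans ?_)⟩
  exact Finset.single_le_sum (f := fun i => |C i|) (fun i _ => abs_nonneg _) (Finset.mem_range.2 hi)

theorem ae_off {S : Set ℝ} (hS : S.Countable) : ∀ᵐ x ∂(volume.restrict (Ioc (0:ℝ) 1)), x ∈ Ioo (0:ℝ) 1 \ S := by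
  have h1 : ∀ᵐ x ∂(volume.restrict (Ioc (0:ℝ) 1)), x ∉ S :=
    ae_restrict_of_ae (measure_eq_zero_iff_ae_notMem.1 (hS.measure_zero _))
  have h2 : ∀ᵐ x ∂(volume.restrict (Ioc (0:ℝ) 1)), x ≠ 1 :=
    ae_restrict_of_ae (measure_eq_zero_iff_ae_notMem.1 (measure_singleton (1:ℝ)))
  filter_upwards [h1, h2, self_mem_ae_restrict measurableSet_Ioc] with x a b c
  exact ⟨⟨c.1, lt_of_le_of_ne c.2 b⟩, a⟩

theorem path_est {E : Type} [NormedAddCommGroup E] [NormedSpace ℝ E] [FiniteDimensional ℝ E]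
    {φ : ℝ → E} {K : ℝ → ℝ} {S : Set ℝ} {C : ℝ} (hS : S.Countable) (hφ : ContinuousOn φ (Set.Icc 0 1))
    (hd : ∀ x ∈ Ioo (0:ℝ) 1 \ S, DifferentiableAt ℝ φ x ∧ ‖deriv φ x‖ ≤ C * K x)
    (hK : IntervalIntegrable K volume 0 1) : ‖φ 1 - φ 0‖ ≤ C * ∫ t in (0:ℝ)..1, K t := by
  have : CompleteSpace E := FiniteDimensional.complete ℝ E
  borelize E
  have hae := ae_off hS
  have hCK : IntervalIntegrable (fun x => C * K x) volume 0 1 := hK.const_mul C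
  have hle : ∀ᵐ x ∂(volume.restrict (Ioc (0:ℝ) 1)), ‖deriv φ x‖ ≤ C * K x := by
    filter_upwards [hae] with x hx using (hd x hx).2
  have hi : IntervalIntegrable (deriv φ) volume 0 1 := by
    rw [intervalIntegrable_iff_integrableOn_Ioc_of_le zero_le_one] at hCK ⊢
    exact Integrable.mono' hCK (measurable_deriv φ).aestronglyMeasurable hle
  have := MeasureTheory.integral_eq_of_hasDerivAt_off_countable φ (deriv φ) hS (by rwa [uIcc_of_le zero_le_one])
    (fun x hx => (hd x (by simpa using hx)).1.hasDerivAt) hi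
  rw [← this, ← intervalIntegral.integral_const_mul]
  exact intervalIntegral.norm_integral_le_of_norm_le zero_le_one ((ae_restrict_iff' measurableSet_Ioc).1 hle) hCK

theorem path_compact {n : ℕ} {γ : ℝ → Cn n} (hc : ContinuousOn γ (Set.Icc 0 1)) (hm : MapsTo γ (Set.Icc 0 1) (ball 0 1)) :
    ∃ ρ < 1, ∀ t ∈ Set.Icc (0:ℝ) 1, ‖γ t‖ ≤ ρ := by
  obtain ⟨x, hx, hmax⟩ := isCompact_Icc.exists_isMaxOn (nonempty_Icc.2 (zero_le_one (α := ℝ))) hc.norm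
  exact ⟨‖γ x‖, mem_ball_zero_iff.1 (hm hx), fun t ht => hmax ht⟩

theorem kob_integrable {n : ℕ} {J : Cn n → Cn n →L[ℝ] Cn n} {ε : ℝ} (hJ : Good J ε) {γ : ℝ → Cn n} (hγ : PiecewiseC1On γ)
    (hm : MapsTo γ (Set.Icc 0 1) (ball 0 1)) :
    IntervalIntegrable (fun t => kobMetric J (ball 0 1) (γ t) (deriv γ t)) volume 0 1 := by
  obtain ⟨S, hS, C, hC⟩ := hγ.good
  obtain ⟨ρ, hρ, hb⟩ := path_compact hγ.1 hm
  have hM := kobMetric_measurable hJ (fun p hp v => kobSet_nonempty hJ hp v)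
  rw [intervalIntegrable_iff_integrableOn_Ioc_of_le zero_le_one]
  have hγm : AEMeasurable γ (volume.restrict (Ioc (0:ℝ) 1)) :=
    (hγ.1.mono Ioc_subset_Icc_self).aemeasurable measurableSet_Ioc
  have hm2 : AEMeasurable (fun t => kobMetric J (ball 0 1) (γ t) (deriv γ t)) (volume.restrict (Ioc (0:ℝ) 1)) := by
    have h1 := hM.comp_aemeasurable (hγm.prodMk (measurable_deriv γ).aemeasurable)
    refine h1.congr ?_
    filter_upwards [self_mem_ae_restrict measurableSet_Ioc] with t ht
    simp only [Function.comp]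
    rw [indicator_of_mem]
    exact ⟨hm (Ioc_subset_Icc_self ht), mem_univ _⟩
  have hconst : IntegrableOn (fun _ : ℝ => (10 * C + 1) / (1 - ρ)) (Ioc (0:ℝ) 1) := by simp
  refine Integrable.mono' hconst hm2.aestronglyMeasurable ?_
  filter_upwards [ae_off hS] with t ht
  have ht' := Ioo_subset_Icc_self ht.1
  rw [Real.norm_eq_abs, abs_of_nonneg (kob_nonneg _ _ _ _)]
  refine (kob_upper hJ (hm ht') _).trans ?_
  have h1 := (hC t ht).2
  have h2 := hb t ht'
  have h3 : 0 < 1 - ρ := by linarith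
  have h4 := norm_nonneg (deriv γ t)
  gcongr
  linarith

theorem path_lower1 {n : ℕ} {J : Cn n → Cn n →L[ℝ] Cn n} {ε : ℝ} (hJ : Good J ε) {γ : ℝ → Cn n} (hγ : PiecewiseC1On γ)
    (hm : MapsTo γ (Set.Icc 0 1) (ball 0 1)) :
    ‖γ 1 - γ 0‖ ≤ Cg * ∫ t in (0 : ℝ)..1, kobMetric J (ball 0 1) (γ t) (deriv γ t) := by
  obtain ⟨S, hS, C, hC⟩ := hγ.good
  refine path_est hS hγ.1 (fun x hx => ⟨(hC x hx).1, ?_⟩) (kob_integrable hJ hγ hm)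
  exact kob_lower1 hJ (hm (Ioo_subset_Icc_self hx.1)) _

theorem path_lower2 {n : ℕ} {J : Cn n → Cn n →L[ℝ] Cn n} {ε : ℝ} (hJ : Good J ε) {γ : ℝ → Cn n} (hγ : PiecewiseC1On γ)
    (hm : MapsTo γ (Set.Icc 0 1) (ball 0 1)) :
    ‖Real.log (1 - ‖γ 1‖ ^ 2) - Real.log (1 - ‖γ 0‖ ^ 2)‖ ≤ (2 * Cn2) * ∫ t in (0 : ℝ)..1, kobMetric J (ball 0 1) (γ t) (deriv γ t) := by
  obtain ⟨S, hS, C, hC⟩ := hγ.good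
  have hpos : ∀ t ∈ Set.Icc (0:ℝ) 1, 0 < 1 - ‖γ t‖ ^ 2 := by
    intro t ht
    have := mem_ball_zero_iff.1 (hm ht)
    nlinarith [norm_nonneg (γ t)]
  have hcont : ContinuousOn (fun t => Real.log (1 - ‖γ t‖ ^ 2)) (Set.Icc 0 1) := by
    apply ContinuousOn.log
    · exact continuousOn_const.sub (hγ.1.norm.pow 2)
    · exact fun t ht => (hpos t ht).ne'
  refine path_est (φ := fun t => Real.log (1 - ‖γ t‖ ^ 2)) hS hcont (fun x hx => ?_) (kob_integrable hJ hγ hm)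
  have hx' := Ioo_subset_Icc_self hx.1
  have hd1 : HasDerivAt (fun t => ‖γ t‖ ^ 2) (2 * inner ℝ (γ x) (deriv γ x)) x := (hC x hx).1.hasDerivAt.norm_sq
  have hd2 : HasDerivAt (fun t => Real.log (1 - ‖γ t‖ ^ 2)) (-(2 * inner ℝ (γ x) (deriv γ x)) / (1 - ‖γ x‖ ^ 2)) x :=
    (hd1.const_sub 1).log (hpos x hx').ne'
  refine ⟨hd2.differentiableAt, ?_⟩
  rw [hd2.deriv, Real.norm_eq_abs, abs_div, abs_neg, abs_mul, abs_of_pos (hpos x hx'), div_le_iff₀ (hpos x hx'), abs_two]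
  have := kob_lower2 hJ (hm hx') (deriv γ x)
  linarith

theorem seg_C1 {n : ℕ} (a b : Cn n) : PiecewiseC1On (fun t : ℝ => a + t • (b - a)) := by
  have hc : ContDiff ℝ 1 (fun t : ℝ => a + t • (b - a)) := by fun_prop
  refine ⟨hc.continuous.continuousOn, 1, fun i => i, by simp, by simp, fun i _ => by simp, fun i _ => hc.contDiffOn⟩

def kobLen {n : ℕ} (J : Cn n → Cn n →L[ℝ] Cn n) (D : Set (Cn n)) (p q : Cn n) : Set ℝ :=
  {L : ℝ | ∃ γ : ℝ → Cn n, PiecewiseC1On γ ∧ MapsTo γ (Set.Icc 0 1) D ∧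
    γ 0 = p ∧ γ 1 = q ∧ L = ∫ t in (0 : ℝ)..1, kobMetric J D (γ t) (deriv γ t)}

theorem kobLen_nonempty {n : ℕ} (J : Cn n → Cn n →L[ℝ] Cn n) {a b : Cn n} (ha : a ∈ ball (0 : Cn n) 1) (hb : b ∈ ball (0 : Cn n) 1) :
    (kobLen J (ball 0 1) a b).Nonempty := by
  refine ⟨_, _, seg_C1 a b, fun t ht => ?_, by simp, by simp, rfl⟩
  exact (convex_ball (0 : Cn n) 1).add_smul_sub_mem ha hb ht

theorem dist_pos_ball {n : ℕ} {J : Cn n → Cn n →L[ℝ] Cn n} {ε : ℝ} (hJ : Good J ε) {a b : Cn n}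
    (ha : a ∈ ball (0 : Cn n) 1) (hb : b ∈ ball (0 : Cn n) 1) (hab : a ≠ b) : 0 < kobDist J (ball 0 1) a b := by
  have hC := Cg_pos
  have h0 : 0 < ‖b - a‖ / Cg := div_pos (norm_pos_iff.2 (sub_ne_zero.2 hab.symm)) hC
  refine h0.trans_le (le_csInf (kobLen_nonempty J ha hb) ?_)
  rintro L ⟨γ, hγ, hm, g0, g1, rfl⟩
  rw [div_le_iff₀' hC, ← g0, ← g1]
  exact path_lower1 hJ hγ hm

theorem dist_ball_sub {n : ℕ} {J : Cn n → Cn n →L[ℝ] Cn n} {ε : ℝ} (hJ : Good J ε) {a : Cn n}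
    (ha : a ∈ ball (0 : Cn n) 1) (r : ℝ) : ∃ ρ < 1, {q ∈ ball (0 : Cn n) 1 | kobDist J (ball 0 1) a q < r} ⊆ closedBall 0 ρ := by
  have hC := Cn2_pos
  have hs : 0 < 1 - ‖a‖ ^ 2 := by
    have := mem_ball_zero_iff.1 ha
    nlinarith [norm_nonneg a]
  set σ := Real.exp (Real.log (1 - ‖a‖ ^ 2) - 2 * Cn2 * r) with hσ
  have hσ0 : 0 < σ := Real.exp_pos _
  refine ⟨√(1 - σ), by rw [Real.sqrt_lt' one_pos]; linarith, ?_⟩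
  rintro q ⟨hq, hd⟩
  obtain ⟨L, ⟨γ, hγ, hm, g0, g1, rfl⟩, hL⟩ := exists_lt_of_csInf_lt (kobLen_nonempty J ha hq) hd
  have h1 := path_lower2 hJ hγ hm
  rw [g0, g1, Real.norm_eq_abs] at h1
  have h2 := (abs_le.1 h1).1
  have hq' : 0 < 1 - ‖q‖ ^ 2 := by
    have := mem_ball_zero_iff.1 hq
    nlinarith [norm_nonneg q]
  have h3 : σ ≤ 1 - ‖q‖ ^ 2 := by
    rw [← Real.exp_log hq', hσ]
    apply Real.exp_le_exp.2
    nlinarith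
  rw [mem_closedBall_zero_iff]
  apply Real.le_sqrt_of_sq_le
  linarith

theorem cplx_iso_aux {V W : Type} [AddCommGroup V] [Module ℝ V] [FiniteDimensional ℝ V] [AddCommGroup W] [Module ℂ W]
    [Module ℝ W] [IsScalarTower ℝ ℂ W] [FiniteDimensional ℂ W]
    (hVW : Module.finrank ℝ V = 2 * Module.finrank ℂ W)
    (J0 : Module.End ℝ V) (h : J0 * J0 = -1) : ∃ A : V ≃ₗ[ℝ] W, ∀ v, A (J0 v) = I • A v := by
  let φ : ℂ →ₐ[ℝ] Module.End ℝ V := Complex.lift ⟨J0, h⟩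
  letI : Module ℂ V := Module.compHom V (φ : ℂ →+* Module.End ℝ V)
  have hs : ∀ (z : ℂ) (v : V), z • v = φ z v := fun _ _ => rfl
  haveI : IsScalarTower ℝ ℂ V := ⟨fun a z v => by
    rw [hs, hs, map_smul]; rfl⟩
  haveI : Module.Finite ℂ V := Module.Finite.of_restrictScalars_finite ℝ ℂ V
  have hf := Module.finrank_mul_finrank ℝ ℂ V
  rw [Complex.finrank_real_complex, hVW] at hf
  let B : V ≃ₗ[ℂ] W := LinearEquiv.ofFinrankEq V W (by omega)
  refine ⟨B.restrictScalars ℝ, fun v => ?_⟩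
  have : J0 v = (I : ℂ) • v := by
    rw [hs]
    show J0 v = (Complex.liftAux J0 h I) v
    rw [Complex.liftAux_apply_I]
  rw [this]
  exact B.map_smul I v

theorem cplx_iso {n : ℕ} (J0 : Cn n →L[ℝ] Cn n) (h : ∀ v, J0 (J0 v) = -v) :
    ∃ A : Cn n ≃L[ℝ] Cn n, ∀ v, A (J0 v) = I • A v := by
  obtain ⟨A, hA⟩ := cplx_iso_aux (V := Cn n) (W := Cn n) (finrank_real_of_complex _) J0.toLinearMap
    (LinearMap.ext fun v => by simpa using h v)
  exact ⟨A.toContinuousLinearEquiv, hA⟩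

section Transport

theorem disc_transport {n : ℕ} {J J' : Cn n → Cn n →L[ℝ] Cn n} (L : Cn n ≃L[ℝ] Cn n) (p : Cn n)
    (D : Set (Cn n)) (hc : ∀ z ∈ D, ∀ v, L (J' z v) = J (p + L z) (L v)) (f : ℂ → Cn n) :
    JDisc J ((fun z => p + L z) '' D) (fun ζ => p + L (f ζ)) ↔ JDisc J' D f := by
  have hmaps : MapsTo (fun ζ => p + L (f ζ)) unitDisc ((fun z => p + L z) '' D) ↔ MapsTo f unitDisc D := by
    constructor
    · intro h ζ hζ
      obtain ⟨z, hz, e⟩ := h hζ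
      have : z = f ζ := L.injective (add_left_cancel e)
      rwa [← this]
    · exact fun h ζ hζ => ⟨f ζ, h hζ, rfl⟩
  have hdf : ∀ ζ, DifferentiableAt ℝ (fun ζ => p + L (f ζ)) ζ ↔ DifferentiableAt ℝ f ζ := by
    intro ζ
    rw [differentiableAt_const_add_iff]
    exact L.comp_differentiableAt_iff
  have hfd : ∀ ζ, fderiv ℝ (fun ζ => p + L (f ζ)) ζ = (L : Cn n →L[ℝ] Cn n).comp (fderiv ℝ f ζ) := by
    intro ζ
    rw [fderiv_const_add]
    exact L.comp_fderiv
  unfold JDisc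
  rw [hmaps]
  apply and_congr_right
  intro hm
  unfold JHolOn
  apply forall₂_congr
  intro ζ hζ
  rw [hdf, hfd]
  apply and_congr_right
  intro _
  constructor
  · intro h
    ext1 w
    apply L.injective
    have := congrArg (fun M => M w) h
    simp only [ContinuousLinearMap.comp_apply, ContinuousLinearEquiv.coe_coe] at this ⊢
    rw [this, hc _ (hm hζ)]
  · intro h
    ext1 w
    have := congrArg (fun M => L (M w)) h
    simp only [ContinuousLinearMap.comp_apply, ContinuousLinearEquiv.coe_coe] at this ⊢
    rw [this, hc _ (hm hζ)]

theorem fderiv_transport {n : ℕ} (L : Cn n ≃L[ℝ] Cn n) (p : Cn n) (f : ℂ → Cn n) (ζ : ℂ) :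
    fderiv ℝ (fun ζ => p + L (f ζ)) ζ 1 = L (fderiv ℝ f ζ 1) := by
  rw [fderiv_const_add]
  have : fderiv ℝ (fun ζ => L (f ζ)) ζ = (L : Cn n →L[ℝ] Cn n).comp (fderiv ℝ f ζ) := L.comp_fderiv
  rw [this]; rfl

theorem deriv_transport {n : ℕ} (L : Cn n ≃L[ℝ] Cn n) (p : Cn n) (f : ℝ → Cn n) (t : ℝ) :
    deriv (fun ζ => p + L (f ζ)) t = L (deriv f t) := by
  show fderiv ℝ (fun ζ => p + L (f ζ)) t 1 = L (fderiv ℝ f t 1)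
  rw [fderiv_const_add]
  have : fderiv ℝ (fun ζ => L (f ζ)) t = (L : Cn n →L[ℝ] Cn n).comp (fderiv ℝ f t) := L.comp_fderiv
  rw [this]; rfl

theorem kobMetric_transport {n : ℕ} {J J' : Cn n → Cn n →L[ℝ] Cn n} (L : Cn n ≃L[ℝ] Cn n) (p : Cn n)
    (D : Set (Cn n)) (hc : ∀ z ∈ D, ∀ v, L (J' z v) = J (p + L z) (L v)) (a v : Cn n) :
    kobMetric J ((fun z => p + L z) '' D) (p + L a) (L v) = kobMetric J' D a v := by
  unfold kobMetric
  congr 1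
  ext α
  simp only [mem_setOf_eq]
  apply and_congr_right
  intro _
  constructor
  · rintro ⟨F, hF, F0, F1⟩
    have e : F = fun ζ => p + L (L.symm (F ζ - p)) := by
      ext1 ζ; rw [L.apply_symm_apply]; abel
    refine ⟨fun ζ => L.symm (F ζ - p), ?_, ?_, ?_⟩
    · rw [← disc_transport L p D hc, ← e]; exact hF
    · simp only [F0, add_sub_cancel_left, L.symm_apply_apply]
    · apply L.injective
      rw [← fderiv_transport L p, ← e, F1, map_smul]
  · rintro ⟨f, hf, f0, f1⟩
    refine ⟨fun ζ => p + L (f ζ), (disc_transport L p D hc f).2 hf, by simp only [f0], ?_⟩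
    rw [fderiv_transport, f1, map_smul]

theorem PiecewiseC1On.affine {n : ℕ} {γ : ℝ → Cn n} (h : PiecewiseC1On γ) (M : Cn n →L[ℝ] Cn n) (c : Cn n) :
    PiecewiseC1On (fun t => c + M (γ t)) := by
  obtain ⟨hc, m, t, h0, h1, hlt, hC⟩ := h
  have hM : ContDiff ℝ 1 (fun z => c + M z) := contDiff_const.add M.contDiff
  exact ⟨hM.continuous.comp_continuousOn hc, m, t, h0, h1, hlt, fun i hi => hM.comp_contDiffOn (hC i hi)⟩

theorem kobDist_transport {n : ℕ} {J J' : Cn n → Cn n →L[ℝ] Cn n} (L : Cn n ≃L[ℝ] Cn n) (p : Cn n)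
    (D : Set (Cn n)) (hc : ∀ z ∈ D, ∀ v, L (J' z v) = J (p + L z) (L v)) (a b : Cn n) :
    kobDist J ((fun z => p + L z) '' D) (p + L a) (p + L b) = kobDist J' D a b := by
  unfold kobDist
  congr 1
  ext l
  simp only [mem_setOf_eq]
  constructor
  · rintro ⟨F, hF, hm, F0, F1, hl⟩
    have e : F = fun ζ => p + L (L.symm (F ζ - p)) := by
      ext1 ζ; rw [L.apply_symm_apply]; abel
    refine ⟨fun ζ => L.symm (F ζ - p), ?_, ?_, ?_, ?_, ?_⟩
    · have := hF.affine (L.symm : Cn n →L[ℝ] Cn n) (-L.symm p)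
      convert this using 2
      rw [map_sub, ContinuousLinearEquiv.coe_coe]; abel
    · intro t ht
      obtain ⟨z, hz, ez⟩ := hm ht
      have : L.symm (F t - p) = z := by rw [← ez]; simp
      show L.symm (F t - p) ∈ D
      rwa [this]
    · simp only [F0, add_sub_cancel_left, L.symm_apply_apply]
    · simp only [F1, add_sub_cancel_left, L.symm_apply_apply]
    · rw [hl]
      congr 1
      ext1 t
      rw [← kobMetric_transport L p D hc, ← deriv_transport L p, ← e, L.apply_symm_apply]
      congr 1; abel
  · rintro ⟨γ, hγ, hm, g0, g1, hl⟩
    refine ⟨fun t => p + L (γ t), hγ.affine (L : Cn n →L[ℝ] Cn n) p, fun t ht => ⟨γ t, hm ht, rfl⟩, by simp only [g0], by simp only [g1], ?_⟩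
    rw [hl]
    congr 1
    ext1 t
    rw [← kobMetric_transport L p D hc, deriv_transport]

end Transport

theorem smooth_ball {n : ℕ} {H : Cn n → Cn n →L[ℝ] Cn n} (hH : ContDiffAt ℝ 2 H 0) :
    ∃ R > 0, ∃ K > 0, (∀ x ∈ ball (0 : Cn n) R, DifferentiableAt ℝ H x) ∧
      (∀ x ∈ ball (0 : Cn n) R, ∀ y ∈ ball (0 : Cn n) R, ‖H x - H y‖ ≤ K * ‖x - y‖) ∧
      (∀ x ∈ ball (0 : Cn n) R, ∀ y ∈ ball (0 : Cn n) R, ‖fderiv ℝ H x - fderiv ℝ H y‖ ≤ K * ‖x - y‖) := by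
  obtain ⟨K1, s1, hs1, hl1⟩ := (hH.of_le (by norm_num : (1 : WithTop ℕ∞) ≤ 2)).exists_lipschitzOnWith
  have hd : ContDiffAt ℝ 1 (fderiv ℝ H) 0 := hH.fderiv_right (by norm_num)
  obtain ⟨K2, s2, hs2, hl2⟩ := hd.exists_lipschitzOnWith
  have hev : ∀ᶠ x in 𝓝 (0 : Cn n), DifferentiableAt ℝ H x := by
    filter_upwards [hH.eventually (by simp)] with x hx using hx.differentiableAt (by norm_num)
  obtain ⟨R, hR, hsub⟩ := Metric.mem_nhds_iff.1 (inter_mem (inter_mem hs1 hs2) hev)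
  refine ⟨R, hR, K1 + K2 + 1, by positivity, fun x hx => (hsub hx).2, fun x hx y hy => ?_, fun x hx y hy => ?_⟩
  · have := hl1.norm_sub_le (hsub hx).1.1 (hsub hy).1.1
    refine this.trans ?_
    gcongr
    linarith [K2.2, show (K2:ℝ) ≥ 0 from K2.2]
  · have := hl2.norm_sub_le (hsub hx).1.2 (hsub hy).1.2
    refine this.trans ?_
    gcongr
    linarith [show (K1:ℝ) ≥ 0 from K1.2]

theorem norm_smul_diff {E : Type} [NormedAddCommGroup E] [NormedSpace ℝ E] {r : ℝ} (hr : 0 < r) (a b : E) :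
    ‖r • a - r • b‖ = r * ‖a - b‖ := by
  rw [← smul_sub, norm_smul, Real.norm_eq_abs, abs_of_pos hr]

theorem good_scale {n : ℕ} {H : Cn n → Cn n →L[ℝ] Cn n} {R K r : ℝ} (hK : 0 < K)
    (h1 : ∀ x ∈ ball (0 : Cn n) R, DifferentiableAt ℝ H x)
    (h2 : ∀ x ∈ ball (0 : Cn n) R, ∀ y ∈ ball (0 : Cn n) R, ‖H x - H y‖ ≤ K * ‖x - y‖)
    (h3 : ∀ x ∈ ball (0 : Cn n) R, ∀ y ∈ ball (0 : Cn n) R, ‖fderiv ℝ H x - fderiv ℝ H y‖ ≤ K * ‖x - y‖)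
    (h4 : ∀ x ∈ ball (0 : Cn n) R, ∀ v, H x (H x v) = -v) (h5 : H 0 = Jstd n)
    (hr : 0 < r) (hr1 : r ≤ 1) (hrR : 2 * r ≤ R) (hrK : 2 * K * r ≤ dl0 / 100) :
    Good (fun z => H (r • z)) (dl0 / 100) := by
  have hin : ∀ x ∈ ball (0 : Cn n) 2, r • x ∈ ball (0 : Cn n) R := by
    intro x hx
    have := mem_ball_zero_iff.1 hx
    rw [mem_ball_zero_iff, norm_smul, Real.norm_eq_abs, abs_of_pos hr]
    nlinarith
  have h0 : (0 : Cn n) ∈ ball (0 : Cn n) R := by simp; linarith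
  have hn : ∀ x y : Cn n, ‖r • x - r • y‖ = r * ‖x - y‖ := by
    intro x y; rw [← smul_sub, norm_smul, Real.norm_eq_abs, abs_of_pos hr]
  have hd : ∀ x ∈ ball (0 : Cn n) 2, HasFDerivAt (fun z => H (r • z)) (r • fderiv ℝ H (r • x)) x := by
    intro x hx
    have a := (h1 _ (hin x hx)).hasFDerivAt
    have b : HasFDerivAt (fun z : Cn n => r • z) (r • ContinuousLinearMap.id ℝ (Cn n)) x := (hasFDerivAt_id x).const_smul r
    have c := a.comp x b
    rw [ContinuousLinearMap.comp_smul, ContinuousLinearMap.comp_id] at c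
    exact c
  have hKr : 0 < K * r := by positivity
  refine ⟨fun x hx v => h4 _ (hin x hx) v, fun x hx => ?_, fun x hx => (hd x hx).differentiableAt,
    fun x hx y hy => ?_, fun x hx y hy => ?_, by have := dl0_pos; positivity, le_rfl⟩
  · have := h2 _ (hin x hx) 0 h0
    rw [h5, sub_zero, norm_smul, Real.norm_eq_abs, abs_of_pos hr] at this
    have := mem_ball_zero_iff.1 hx
    nlinarith
  · have := h2 _ (hin x hx) _ (hin y hy)
    rw [hn] at this
    refine this.trans ?_
    rw [← mul_assoc]
    gcongr
    linarith
  · rw [(hd x hx).fderiv, (hd y hy).fderiv]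
    have := h3 _ (hin x hx) _ (hin y hy)
    rw [hn] at this
    have e : ‖r • fderiv ℝ H (r • x) - r • fderiv ℝ H (r • y)‖ = r * ‖fderiv ℝ H (r • x) - fderiv ℝ H (r • y)‖ :=
      norm_smul_diff (E := Cn n →L[ℝ] Cn n →L[ℝ] Cn n) hr (fderiv ℝ H (r • x)) (fderiv ℝ H (r • y))
    rw [e]
    have q := norm_nonneg (x - y)
    calc r * ‖fderiv ℝ H (r • x) - fderiv ℝ H (r • y)‖ ≤ 1 * (K * (r * ‖x - y‖)) := by gcongr
      _ = (K * r) * ‖x - y‖ := by ring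
      _ ≤ _ := by gcongr; linarith

/-- **Basis of complete hyperbolic neighborhoods** (Corollary 3.2.3): every point of an almost
complex manifold has a basis of neighborhoods that are complete hyperbolic for the Kobayashi
pseudodistance. -/
theorem complete_hyperbolic_neighborhood_basis {n : ℕ} (Ω : Set (Cn n)) (hΩ : IsOpen Ω)
    (J : Cn n → Cn n →L[ℝ] Cn n) (hJ : IsACS Ω J) (p : Cn n) (hp : p ∈ Ω) :
    ∀ W ∈ 𝓝 p, ∃ U : Set (Cn n), IsOpen U ∧ p ∈ U ∧ U ⊆ W ∧ U ⊆ Ω ∧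
      (∀ a ∈ U, ∀ b ∈ U, a ≠ b → 0 < kobDist J U a b) ∧
      (∀ p' ∈ U, ∀ r : ℝ, 0 < r →
        IsCompact (closure {q ∈ U | kobDist J U p' q < r}) ∧
        closure {q ∈ U | kobDist J U p' q < r} ⊆ U) := by
  intro W hW
  have hsq : ∀ x ∈ Ω, ∀ v, J x (J x v) = -v := by
    intro x hx v
    have := congrArg (fun M => M v) (hJ.2 x hx)
    simpa using this
  obtain ⟨A, hA⟩ := cplx_iso (J p) (hsq p hp)
  let A1 : Cn n →L[ℝ] Cn n := A
  let A2 : Cn n →L[ℝ] Cn n := A.symm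
  let H : Cn n → Cn n →L[ℝ] Cn n := fun z => A1.comp ((J (p + A2 z)).comp A2)
  have hHs : ContDiffAt ℝ 2 H 0 := by
    have j1 : ContDiffAt ℝ 2 J (p + A2 0) := by
      rw [map_zero, add_zero]
      exact (hJ.1.contDiffAt (hΩ.mem_nhds hp)).of_le (WithTop.coe_le_coe.2 (le_top : (2 : ℕ∞) ≤ ⊤))
    have j2 : ContDiffAt ℝ 2 (fun z => p + A2 z) 0 := contDiffAt_const.add A2.contDiff.contDiffAt
    have j3 : ContDiffAt ℝ 2 (fun z => J (p + A2 z)) 0 := j1.comp (0 : Cn n) j2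
    exact contDiffAt_const.clm_comp (j3.clm_comp contDiffAt_const)
  have hApp : ∀ z v, H z v = A (J (p + A.symm z) (A.symm v)) := fun z v => rfl
  have hH0 : H 0 = Jstd n := by
    ext1 v
    rw [hApp, Jstd_apply, map_zero, add_zero, hA, A.apply_symm_apply]
  obtain ⟨R, hR, K, hK, h1, h2, h3⟩ := smooth_ball hHs
  have hcont : Tendsto (fun z => p + A.symm z) (𝓝 0) (𝓝 p) := by
    have : Continuous (fun z => p + A.symm z) := by fun_prop
    have := this.tendsto 0
    rwa [map_zero, add_zero] at this
  obtain ⟨R2, hR2, hsub⟩ := Metric.mem_nhds_iff.1 (hcont (inter_mem hW (hΩ.mem_nhds hp)))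
  set R0 := min R R2 with hR0
  have hR0p : 0 < R0 := lt_min hR hR2
  have hb1 : ball (0 : Cn n) R0 ⊆ ball 0 R := ball_subset_ball (min_le_left _ _)
  have hb2 : ball (0 : Cn n) R0 ⊆ ball 0 R2 := ball_subset_ball (min_le_right _ _)
  have hdl := dl0_pos
  set r := min 1 (min (R0 / 2) (dl0 / 100 / (2 * K))) with hr
  have hr0 : 0 < r := by positivity
  have hr1 : r ≤ 1 := min_le_left _ _
  have hr2 : 2 * r ≤ R0 := by
    have : r ≤ R0 / 2 := (min_le_right _ _).trans (min_le_left _ _)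
    linarith
  have hr3 : 2 * K * r ≤ dl0 / 100 := by
    have : r ≤ dl0 / 100 / (2 * K) := (min_le_right _ _).trans (min_le_right _ _)
    rw [le_div_iff₀ (by positivity)] at this
    linarith
  have hgood : Good (fun z => H (r • z)) (dl0 / 100) := by
    refine good_scale (R := R0) hK (fun x hx => h1 x (hb1 hx)) (fun x hx y hy => h2 x (hb1 hx) y (hb1 hy))
      (fun x hx y hy => h3 x (hb1 hx) y (hb1 hy)) (fun x hx v => ?_) hH0 hr0 hr1 hr2 hr3
    rw [hApp, hApp, A.symm_apply_apply, hsq _ (hsub (hb2 hx)).2, map_neg, A.apply_symm_apply]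
  let L : Cn n ≃L[ℝ] Cn n := (ContinuousLinearEquiv.smulLeft (Units.mk0 r hr0.ne')).trans A.symm
  have hL : ∀ z, L z = A.symm (r • z) := fun z => rfl
  have hL' : ∀ z, L z = r • A.symm z := fun z => by rw [hL, map_smul]
  have hconj : ∀ z ∈ ball (0 : Cn n) 1, ∀ v, L (H (r • z) v) = J (p + L z) (L v) := by
    intro z _ v
    rw [hL', hApp, A.symm_apply_apply, ← hL, hL' v, map_smul]
  have hinU : ∀ z ∈ ball (0 : Cn n) 1, p + L z ∈ W ∩ Ω := by
    intro z hz
    rw [hL]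
    apply hsub
    apply hb2
    have := mem_ball_zero_iff.1 hz
    rw [mem_ball_zero_iff, norm_smul, Real.norm_eq_abs, abs_of_pos hr0]
    nlinarith
  have hΦc : Continuous (fun z => p + L z) := by fun_prop
  refine ⟨(fun z => p + L z) '' ball 0 1, ?_, ⟨0, by simp, by simp⟩, ?_, ?_, ?_, ?_⟩
  · have e : (fun z => p + L z) '' ball 0 1 = (fun x => L.symm (x - p)) ⁻¹' ball 0 1 := by
      ext x
      constructor
      · rintro ⟨z, hz, rfl⟩
        simpa using hz
      · intro hx
        exact ⟨_, hx, by simp⟩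
    rw [e]
    exact isOpen_ball.preimage (by fun_prop)
  · rintro x ⟨z, hz, rfl⟩
    exact (hinU z hz).1
  · rintro x ⟨z, hz, rfl⟩
    exact (hinU z hz).2
  · rintro x ⟨a, ha, rfl⟩ y ⟨b, hb, rfl⟩ hab
    rw [kobDist_transport L p _ hconj]
    exact dist_pos_ball hgood ha hb fun h => hab (by rw [h])
  · rintro x ⟨a, ha, rfl⟩ s hs
    obtain ⟨ρ, hρ, hρs⟩ := dist_ball_sub hgood ha s
    have hcomp : IsCompact ((fun z => p + L z) '' closedBall 0 ρ) := (isCompact_closedBall 0 ρ).image hΦc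
    have hcl : closure {q ∈ (fun z => p + L z) '' ball 0 1 | kobDist J ((fun z => p + L z) '' ball 0 1) (p + L a) q < s}
        ⊆ (fun z => p + L z) '' closedBall 0 ρ := by
      apply closure_minimal _ hcomp.isClosed
      rintro y ⟨⟨b, hb, rfl⟩, hd⟩
      have hd' : kobDist J ((fun z => p + L z) '' ball 0 1) (p + L a) (p + L b) < s := hd
      rw [kobDist_transport L p _ hconj] at hd'
      exact ⟨b, hρs ⟨hb, hd'⟩, rfl⟩
    exact ⟨hcomp.of_isClosed_subset isClosed_closure hcl, hcl.trans (image_mono (closedBall_subset_ball hρ))⟩
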